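/- Let d ≥ k ≥ 3 be integers and let G be a connected graph with maximum degree k that admits a proper k-colouring. Then the set of proper d-colourings of G forms a single Kempe class, unless d = k = 3 and G is the triangular prism. -/

import Mathlib

open SimpleGraph
open scoped Classical

variable {V : Type*}

/-- A proper `k`-colouring of `G`. -/
def IsProperColoring (G : SimpleGraph V) (k : ℕ) (c : V → Fin k) : Prop :=
  ∀ ⦃u v : V⦄, G.Adj u v → c u ≠ c v

/-- `c'` is obtained from `c` by a single Kempe change: the colours `a` and `b` are
swapped on the connected component (of the subgraph induced by the vertices coloured
`a` or `b`) containing `v0`, and all other vertices keep their colour. -/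

def KempeStep (G : SimpleGraph V) (k : ℕ) (c c' : V → Fin k) : Prop :=
  ∃ a b : Fin k, ∃ v0 : {x : V | c x = a ∨ c x = b},
    ∀ v : V, c' v =
      if h : c v = a ∨ c v = b then
        if (G.induce {x : V | c x = a ∨ c x = b}).Reachable v0 ⟨v, h⟩
          then Equiv.swap a b (c v) else c v
      else c v

/-- Two colourings are Kempe equivalent if one is obtained from the other by a finite
sequence of Kempe changes. -/
def KempeEquiv (G : SimpleGraph V) (k : ℕ) (c c' : V → Fin k) : Prop :=
  Relation.ReflTransGen (KempeStep G k) c c'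

/-- The set of all proper `k`-colourings of `G` forms a single Kempe class. -/
def KempeClass (G : SimpleGraph V) (k : ℕ) : Prop :=
  ∀ c c' : V → Fin k, IsProperColoring G k c → IsProperColoring G k c' →
    KempeEquiv G k c c'

/-- `G` is `d`-degenerate: every nonempty set of vertices contains a vertex with at
most `d` neighbours inside the set. -/
def Degenerate (G : SimpleGraph V) (d : ℕ) : Prop :=
  ∀ S : Set V, S.Nonempty → ∃ v ∈ S, (S ∩ G.neighborSet v).ncard ≤ d

/-- `G` is 3-connected: more than 3 vertices, and deleting any at most 2 vertices
leaves it connected. -/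
def ThreeConnected [Fintype V] (G : SimpleGraph V) : Prop :=
  3 < Fintype.card V ∧ ∀ S : Set V, S.ncard ≤ 2 → (G.induce Sᶜ).Connected

/-- The triangular prism `K_3 □ K_2`. -/
def TriangularPrism : SimpleGraph (Fin 3 × Fin 2) :=
  (⊤ : SimpleGraph (Fin 3)) □ (⊤ : SimpleGraph (Fin 2))


section part1

/-! ## Generalised Kempe steps -/

/-- Neighbours of `v` inside `S`. -/
noncomputable def nb (G : SimpleGraph V) (S : Finset V) (v : V) : Finset V :=
  S.filter (fun w => G.Adj v w)

lemma mem_nb {G : SimpleGraph V} {S : Finset V} {v w : V} :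
    w ∈ nb G S v ↔ w ∈ S ∧ G.Adj v w := by simp [nb]

lemma nb_mono {G : SimpleGraph V} {S T : Finset V} (h : S ⊆ T) (v : V) :
    nb G S v ⊆ nb G T v := by
  intro w hw
  rw [mem_nb] at *
  exact ⟨h hw.1, hw.2⟩

def ProperOn (G : SimpleGraph V) {k : ℕ} (S : Finset V) (c : V → Fin k) : Prop :=
  ∀ u ∈ S, ∀ v ∈ S, G.Adj u v → c u ≠ c v

lemma ProperOn.mono {G : SimpleGraph V} {k : ℕ} {S T : Finset V} {c : V → Fin k}
    (h : ProperOn G T c) (hST : S ⊆ T) : ProperOn G S c :=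
  fun u hu v hv => h u (hST hu) v (hST hv)

def KS (G : SimpleGraph V) {k : ℕ} (S : Finset V) (c c' : V → Fin k) : Prop :=
  ProperOn G S c ∧ ProperOn G S c' ∧ ∃ a b : Fin k, ∀ v ∈ S,
    c' v = c v ∨ ((c v = a ∨ c v = b) ∧ (c' v = a ∨ c' v = b))

def KE (G : SimpleGraph V) {k : ℕ} (S : Finset V) (c c' : V → Fin k) : Prop :=
  Relation.ReflTransGen (KS G S) c c'

lemma KS.symm {G : SimpleGraph V} {k : ℕ} {S : Finset V} {c c' : V → Fin k}
    (h : KS G S c c') : KS G S c' c := by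
  obtain ⟨h1, h2, a, b, h⟩ := h
  refine ⟨h2, h1, a, b, fun v hv => ?_⟩
  rcases h v hv with h | h
  · exact Or.inl h.symm
  · exact Or.inr ⟨h.2, h.1⟩

lemma KE.symm {G : SimpleGraph V} {k : ℕ} {S : Finset V} {c c' : V → Fin k}
    (h : KE G S c c') : KE G S c' c := by
  induction h with
  | refl => exact Relation.ReflTransGen.refl
  | tail _ h ih => exact Relation.ReflTransGen.head h.symm ih

lemma KE.refl {G : SimpleGraph V} {k : ℕ} {S : Finset V} (c : V → Fin k) : KE G S c c :=
  Relation.ReflTransGen.refl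

lemma KE.trans {G : SimpleGraph V} {k : ℕ} {S : Finset V} {c c' c'' : V → Fin k}
    (h : KE G S c c') (h' : KE G S c' c'') : KE G S c c'' :=
  Relation.ReflTransGen.trans h h'

lemma KS.ke {G : SimpleGraph V} {k : ℕ} {S : Finset V} {c c' : V → Fin k}
    (h : KS G S c c') : KE G S c c' := Relation.ReflTransGen.single h

lemma ProperOn.congr {G : SimpleGraph V} {k : ℕ} {S : Finset V} {c c' : V → Fin k}
    (h : ProperOn G S c) (hc : ∀ v ∈ S, c' v = c v) : ProperOn G S c' := by
  intro u hu v hv huv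
  rw [hc u hu, hc v hv]
  exact h u hu v hv huv

lemma KE.of_eqOn {G : SimpleGraph V} {k : ℕ} {S : Finset V} {c c' : V → Fin k}
    (hc : ProperOn G S c) (h : ∀ v ∈ S, c' v = c v) : KE G S c c' := by
  by_cases hS : S.Nonempty
  · obtain ⟨x, hx⟩ := hS
    exact KS.ke ⟨hc, hc.congr h, c x, c x, fun v hv => Or.inl (h v hv)⟩
  · by_cases hV : Nonempty V
    · obtain ⟨x⟩ := hV
      rw [Finset.not_nonempty_iff_eq_empty] at hS
      subst hS
      exact KS.ke ⟨hc, hc.congr h, c x, c x, fun v hv => by simp at hv⟩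
    · have : c = c' := by
        ext v
        exact (hV ⟨v⟩).elim
      rw [this]
      exact KE.refl _

lemma KE.proper {G : SimpleGraph V} {k : ℕ} {S : Finset V} {c c' : V → Fin k}
    (h : KE G S c c') (hc : ProperOn G S c) : ProperOn G S c' := by
  induction h with
  | refl => exact hc
  | tail _ h _ => exact h.2.1

/-- recolouring one vertex -/
lemma KE.recolor {G : SimpleGraph V} {k : ℕ} {S : Finset V} {c c' : V → Fin k} (t : V)
    (hc : ProperOn G S c) (hc' : ProperOn G S c') (h : ∀ v ∈ S, v ≠ t → c' v = c v) :
    KE G S c c' := by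
  refine KS.ke ⟨hc, hc', c t, c' t, fun v hv => ?_⟩
  by_cases hvt : v = t
  · subst hvt
    right
    simp
  · exact Or.inl (h v hv hvt)

/-- pull-back along a homomorphism -/
lemma KE.pull {W : Type*} {G : SimpleGraph V} {H : SimpleGraph W} {k : ℕ}
    {S : Finset V} {S' : Finset W} (f : V → W)
    (hf : ∀ v ∈ S, f v ∈ S') (hadj : ∀ p ∈ S, ∀ q ∈ S, G.Adj p q → H.Adj (f p) (f q))
    {c c' : W → Fin k} (h : KE H S' c c') : KE G S (c ∘ f) (c' ∘ f) := by
  induction h with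
  | refl => exact KE.refl _
  | tail _ h ih =>
    refine ih.trans (KS.ke ?_)
    obtain ⟨h1, h2, a, b, h⟩ := h
    exact ⟨fun u hu v hv huv => h1 _ (hf u hu) _ (hf v hv) (hadj u hu v hv huv),
      fun u hu v hv huv => h2 _ (hf u hu) _ (hf v hv) (hadj u hu v hv huv),
      a, b, fun v hv => h _ (hf v hv)⟩

lemma kempe_of_KS [Fintype V] {G : SimpleGraph V} {k : ℕ} (n : ℕ) :
    ∀ c c' : V → Fin k, (Finset.univ.filter (fun v => c' v ≠ c v)).card = n →
    KS G Finset.univ c c' → KempeEquiv G k c c' := by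
  induction n using Nat.strong_induction_on with
  | _ n ih =>
  intro c c' hn h
  by_cases hD : ∃ v0, c' v0 ≠ c v0
  swap
  · push Not at hD
    have : c = c' := by
      funext v
      exact (hD v).symm
    rw [this]
    exact Relation.ReflTransGen.refl
  obtain ⟨v0, hv0⟩ := hD
  obtain ⟨hc, hc', a, b, hab⟩ := h
  have hv0' : c v0 = a ∨ c v0 = b := by
    rcases hab v0 (Finset.mem_univ _) with h | h
    · exact absurd h hv0
    · exact h.1
  let Z : V → Prop := fun v => ∃ h : c v = a ∨ c v = b,
    (G.induce {x : V | c x = a ∨ c x = b}).Reachable ⟨v0, hv0'⟩ ⟨v, h⟩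
  have hZv0 : Z v0 := ⟨hv0', SimpleGraph.Reachable.refl _⟩
  have hZstep : ∀ u v, Z u → G.Adj u v → (c v = a ∨ c v = b) → Z v := by
    rintro u v ⟨hu, hr⟩ huv hv
    refine ⟨hv, hr.trans (SimpleGraph.Adj.reachable ?_)⟩
    simpa using huv
  have hDstep : ∀ u v, c' u ≠ c u → G.Adj u v → (c v = a ∨ c v = b) → c' v ≠ c v := by
    intro u v hu huv hv heq
    have h1 := hab u (Finset.mem_univ _)
    have h3 := hc u (Finset.mem_univ _) v (Finset.mem_univ _) huv
    have h4 := hc' u (Finset.mem_univ _) v (Finset.mem_univ _) huv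
    grind
  have hZD : ∀ v, Z v → c' v ≠ c v := by
    rintro v ⟨hv, ⟨p⟩⟩
    have key : ∀ (x y : {x : V | c x = a ∨ c x = b})
        (p : (G.induce {x : V | c x = a ∨ c x = b}).Walk x y), c' x ≠ c x → c' y ≠ c y := by
      intro x y p
      induction p with
      | nil => exact id
      | @cons u v w h _ ih =>
        intro hx
        exact ih (hDstep u v hx (by simpa using h) v.2)
    exact key _ _ p hv0
  let c1 : V → Fin k := fun v => if Z v then c' v else c v
  have hstep : KempeStep G k c c1 := by
    refine ⟨a, b, ⟨v0, hv0'⟩, fun v => ?_⟩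
    by_cases hv : c v = a ∨ c v = b
    · rw [dif_pos hv]
      by_cases hr : (G.induce {x : V | c x = a ∨ c x = b}).Reachable ⟨v0, hv0'⟩ ⟨v, hv⟩
      · rw [if_pos hr]
        have hz : Z v := ⟨hv, hr⟩
        have h1 := hZD v hz
        have h2 := hab v (Finset.mem_univ _)
        simp only [c1, if_pos hz]
        rcases hv with hv | hv <;> rw [hv]
        · rw [Equiv.swap_apply_left]
          grind
        · rw [Equiv.swap_apply_right]
          grind
      · rw [if_neg hr]
        have hz : ¬ Z v := fun ⟨_, h⟩ => hr h
        simp only [c1, if_neg hz]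
    · rw [dif_neg hv]
      have hz : ¬ Z v := fun ⟨h, _⟩ => hv h
      simp only [c1, if_neg hz]
  have hc1 : ProperOn G Finset.univ c1 := by
    intro u hu v hv huv
    have A1 := hZstep u v
    have A2 := hZstep v u
    have B1 := hab u hu
    have B2 := hab v hv
    have C1 := hc u hu v hv huv
    have C2 := hc' u hu v hv huv
    have huv' := huv.symm
    have E1 := hZD u
    have E2 := hZD v
    simp only [c1]
    by_cases z1 : Z u <;> by_cases z2 : Z v <;> simp only [z1, z2, if_true, if_false] <;> grind
  refine Relation.ReflTransGen.head hstep (ih _ ?_ c1 c' rfl ⟨hc1, hc', a, b, ?_⟩)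
  · rw [← hn]
    apply Finset.card_lt_card
    rw [Finset.ssubset_iff_of_subset]
    · refine ⟨v0, by simpa using hv0, ?_⟩
      simp [c1, hZv0]
    · intro v
      simp only [Finset.mem_filter, Finset.mem_univ, true_and, c1]
      split_ifs <;> simp
  · intro v hv
    simp only [c1]
    split_ifs
    · exact Or.inl rfl
    · exact hab v hv

lemma kempe_of_KE [Fintype V] {G : SimpleGraph V} {k : ℕ} {c c' : V → Fin k}
    (h : KE G Finset.univ c c') : KempeEquiv G k c c' := by
  induction h with
  | refl => exact Relation.ReflTransGen.refl
  | tail _ h ih => exact Relation.ReflTransGen.trans ih (kempe_of_KS _ _ _ rfl h)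

end part1

section part2

/-! ## Degenerate graphs -/

lemma ProperOn.update {G : SimpleGraph V} {k : ℕ} {S : Finset V} {c : V → Fin k} {t : V} {m : Fin k}
    (h : ProperOn G (S.erase t) c) (hm : ∀ w ∈ S, G.Adj t w → c w ≠ m) :
    ProperOn G S (Function.update c t m) := by
  intro u hu v hv huv
  by_cases h1 : u = t <;> by_cases h2 : v = t
  · subst h1; subst h2; exact absurd huv (G.loopless.irrefl _)
  · subst h1
    simp only [Function.update_self, Function.update_of_ne h2]
    exact (hm v hv huv).symm
  · subst h2
    simp only [Function.update_self, Function.update_of_ne h1]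
    exact (hm u hu huv.symm)
  · simp only [Function.update_of_ne h1, Function.update_of_ne h2]
    exact h u (Finset.mem_erase.2 ⟨h1, hu⟩) v (Finset.mem_erase.2 ⟨h2, hv⟩) huv

lemma lift_step {G : SimpleGraph V} {k : ℕ} {S : Finset V} {t : V} 
    (hdeg : (nb G S t).card < k) {c d : V → Fin k} (hc : ProperOn G S c)
    (h : KS G (S.erase t) c d) :
    ∃ d1, KE G S c d1 ∧ ∀ v ∈ S.erase t, d1 v = d v := by
  obtain ⟨_, hd, a, b, hab⟩ := h
  have hnb : ∀ w ∈ nb G S t, w ∈ S.erase t ∧ w ∈ S ∧ G.Adj t w := by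
    intro w hw
    rw [mem_nb] at hw
    exact ⟨Finset.mem_erase.2 ⟨hw.2.ne', hw.1⟩, hw⟩
  have hupd : ∀ m, ∀ v ∈ S.erase t, Function.update d t m v = d v := by
    intro m v hv
    rw [Function.update_of_ne (Finset.ne_of_mem_erase hv)]
  by_cases ht : t ∈ S
  swap
  · refine ⟨d, KS.ke ⟨hc, ?_, a, b, ?_⟩, fun _ _ => rfl⟩
    · rwa [Finset.erase_eq_of_notMem ht] at hd
    · rwa [Finset.erase_eq_of_notMem ht] at hab
  -- a step keeping inside a b
  have gen : ∀ c0 : V → Fin k, ProperOn G S c0 → (∀ v, v ≠ t → c0 v = c v) → ∀ m,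
      (m = c0 t ∨ ((c0 t = a ∨ c0 t = b) ∧ (m = a ∨ m = b))) →
      (∀ w ∈ S, G.Adj t w → d w ≠ m) → KE G S c0 (Function.update d t m) := by
    intro c0 hc0 hcc m hm hw
    refine KS.ke ⟨hc0, ProperOn.update hd hw, a, b, fun v hv => ?_⟩
    by_cases hvt : v = t
    · subst hvt
      simpa using hm
    · rw [Function.update_of_ne hvt, hcc v hvt]
      exact hab v (Finset.mem_erase.2 ⟨hvt, hv⟩)
  by_cases h1 : ∀ w ∈ S, G.Adj t w → d w ≠ c t
  · exact ⟨_, gen c hc (fun _ _ => rfl) (c t) (Or.inl rfl) h1, hupd _⟩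
  push Not at h1
  obtain ⟨w, hwS, hwt, hw⟩ := h1
  have hw1 := hab w (Finset.mem_erase.2 ⟨hwt.ne', hwS⟩)
  have hw2 := hc t ht w hwS hwt
  have hpq : (c t = a ∨ c t = b) ∧ (c w = a ∨ c w = b) := by grind
  by_cases h2 : ∀ w' ∈ S, G.Adj t w' → d w' ≠ c w
  · exact ⟨_, gen c hc (fun _ _ => rfl) (c w) (Or.inr hpq) h2, hupd _⟩
  push Not at h2
  obtain ⟨w2, hw2S, hw2t, hw2'⟩ := h2
  have hw3 := hab w2 (Finset.mem_erase.2 ⟨hw2t.ne', hw2S⟩)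
  have hw4 := hc t ht w2 hw2S hw2t
  have hne : w ≠ w2 := by grind
  have heq : c w2 = c w := by grind
  have himg : ((nb G S t).image c) ⊆ ((nb G S t).erase w2).image c := by
    intro i hi
    rw [Finset.mem_image] at *
    obtain ⟨x, hx, rfl⟩ := hi
    by_cases hxw : x = w2
    · exact ⟨w, Finset.mem_erase.2 ⟨hne, mem_nb.2 ⟨hwS, hwt⟩⟩, by rw [hxw, heq]⟩
    · exact ⟨x, Finset.mem_erase.2 ⟨hxw, hx⟩, rfl⟩
  have hcard : (insert (c t) ((nb G S t).image c)).card < k := by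
    have e1 := Finset.card_insert_le (c t) ((nb G S t).image c)
    have e2 := Finset.card_le_card himg
    have e3 : (((nb G S t).erase w2).image c).card ≤ ((nb G S t).erase w2).card :=
      Finset.card_image_le
    have e4 := Finset.card_erase_of_mem (mem_nb.2 ⟨hw2S, hw2t⟩ : w2 ∈ nb G S t)
    have e5 : 0 < (nb G S t).card := Finset.card_pos.2 ⟨w2, mem_nb.2 ⟨hw2S, hw2t⟩⟩
    omega
  obtain ⟨m, hm⟩ : ∃ m, m ∉ insert (c t) ((nb G S t).image c) := by
    by_contra hcon
    push Not at hcon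
    have : (insert (c t) ((nb G S t).image c)) = Finset.univ := Finset.eq_univ_iff_forall.2 hcon
    rw [this, Finset.card_univ, Fintype.card_fin] at hcard
    exact lt_irrefl _ hcard
  rw [Finset.mem_insert, Finset.mem_image] at hm
  push Not at hm
  obtain ⟨hm1, hm2⟩ := hm
  have hm3 : ∀ x ∈ S, G.Adj t x → c x ≠ m := fun x hx hxt => hm2 x (mem_nb.2 ⟨hx, hxt⟩)
  have hprop : ProperOn G S (Function.update c t m) :=
    ProperOn.update (hc.mono (Finset.erase_subset _ _)) hm3
  refine ⟨_, (KE.recolor t hc hprop ?_).trans (gen (Function.update c t m) hprop ?_ m ?_ ?_), hupd m⟩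
  · intro v _ hv
    rw [Function.update_of_ne hv]
  · intro v hv
    rw [Function.update_of_ne hv]
  · left; simp
  · intro x hx hxt
    have f1 := hab x (Finset.mem_erase.2 ⟨hxt.ne', hx⟩)
    have f2 := hm3 x hx hxt
    have f3 := hm3 w hwS hwt
    grind

lemma lift_chain {G : SimpleGraph V} {k : ℕ} {S : Finset V} {t : V} 
    (hdeg : (nb G S t).card < k) {c d : V → Fin k} (hc : ProperOn G S c)
    (h : KE G (S.erase t) c d) :
    ∃ d1, KE G S c d1 ∧ ∀ v ∈ S.erase t, d1 v = d v := by
  induction h with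
  | refl => exact ⟨c, KE.refl _, fun _ _ => rfl⟩
  | tail h1 h2 ih =>
    obtain ⟨d1, hd1, heq⟩ := ih
    obtain ⟨x1, x2, a, b, x3⟩ := h2
    have : KS G (S.erase t) d1 _ := ⟨x1.congr heq, x2, a, b, fun v hv => by
      rw [heq v hv]; exact x3 v hv⟩
    obtain ⟨d2, hd2, heq2⟩ := lift_step hdeg (hd1.proper hc) this
    exact ⟨d2, hd1.trans hd2, heq2⟩

lemma KE_of_degenerate {G : SimpleGraph V} {k : ℕ} {S : Finset V}
    (h : ∀ T ⊆ S, T.Nonempty → ∃ t ∈ T, (nb G T t).card < k) :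
    ∀ c c' : V → Fin k, ProperOn G S c → ProperOn G S c' → KE G S c c' := by
  induction S using Finset.strongInduction with
  | _ S ih =>
  intro c c' hc hc'
  by_cases hS : S.Nonempty
  swap
  · rw [Finset.not_nonempty_iff_eq_empty] at hS
    subst hS
    exact KE.of_eqOn hc (by simp)
  obtain ⟨t, ht, hdeg⟩ := h S subset_rfl hS
  have h1 := ih (S.erase t) (Finset.erase_ssubset ht)
    (fun T hT => h T (hT.trans (Finset.erase_subset _ _))) c c'
    (hc.mono (Finset.erase_subset _ _)) (hc'.mono (Finset.erase_subset _ _))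
  obtain ⟨d, hd, heq⟩ := lift_chain hdeg hc h1
  refine hd.trans (KE.recolor t (hd.proper hc) hc' ?_)
  intro v hv hvt
  exact (heq v (Finset.mem_erase.2 ⟨hvt, hv⟩)).symm

end part2

section part3

/-! ## Connectivity of finite sets -/

def Conn (G : SimpleGraph V) (S : Finset V) : Prop :=
  S.Nonempty ∧ ∀ T ⊆ S, T.Nonempty → (∀ u ∈ T, ∀ v ∈ S, G.Adj u v → v ∈ T) → T = S

lemma Conn.exists_adj {G : SimpleGraph V} {S T : Finset V} (h : Conn G S) (hT : T ⊆ S)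
    (hne : T.Nonempty) (hTS : T ≠ S) : ∃ u ∈ T, ∃ v ∈ S, v ∉ T ∧ G.Adj u v := by
  by_contra hcon
  push Not at hcon
  apply hTS
  apply h.2 T hT hne
  intro u hu v hv huv
  by_contra hvT
  exact hcon u hu v hv hvT huv

lemma conn_singleton (G : SimpleGraph V) (v : V) : Conn G {v} := by
  refine ⟨by simp, fun T hT hne _ => ?_⟩
  exact (Finset.subset_singleton_iff.1 hT).resolve_left hne.ne_empty

lemma Conn.union {G : SimpleGraph V} {S T : Finset V} (hS : Conn G S) (hT : Conn G T)
    (h : ∃ u ∈ S, ∃ v ∈ T, u = v ∨ G.Adj u v) : Conn G (S ∪ T) := by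
  refine ⟨hS.1.mono Finset.subset_union_left, fun X hX hne hcl => ?_⟩
  obtain ⟨u, hu, v, hv, huv⟩ := h
  have h1 : (∃ x ∈ X, x ∈ S) → S ⊆ X := by
    rintro ⟨x, hx, hxS⟩
    have := hS.2 (X ∩ S) Finset.inter_subset_right ⟨x, Finset.mem_inter.2 ⟨hx, hxS⟩⟩ (by
      intro p hp q hq hpq
      rw [Finset.mem_inter] at *
      exact ⟨hcl p hp.1 q (Finset.mem_union_left _ hq) hpq, hq⟩)
    rw [← this]
    exact Finset.inter_subset_left
  have h2 : (∃ x ∈ X, x ∈ T) → T ⊆ X := by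
    rintro ⟨x, hx, hxT⟩
    have := hT.2 (X ∩ T) Finset.inter_subset_right ⟨x, Finset.mem_inter.2 ⟨hx, hxT⟩⟩ (by
      intro p hp q hq hpq
      rw [Finset.mem_inter] at *
      exact ⟨hcl p hp.1 q (Finset.mem_union_right _ hq) hpq, hq⟩)
    rw [← this]
    exact Finset.inter_subset_left
  have h3 : S ⊆ X → T ⊆ X := by
    intro hSX
    apply h2
    rcases huv with rfl | huv
    · exact ⟨u, hSX hu, hv⟩
    · exact ⟨v, hcl u (hSX hu) v (Finset.mem_union_right _ hv) huv, hv⟩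
  have h4 : T ⊆ X → S ⊆ X := by
    intro hTX
    apply h1
    rcases huv with rfl | huv
    · exact ⟨u, hTX hv, hu⟩
    · exact ⟨u, hcl v (hTX hv) u (Finset.mem_union_left _ hu) huv.symm, hu⟩
  obtain ⟨x, hx⟩ := hne
  apply Finset.Subset.antisymm hX
  rcases Finset.mem_union.1 (hX hx) with hxS | hxT
  · exact Finset.union_subset (h1 ⟨x, hx, hxS⟩) (h3 (h1 ⟨x, hx, hxS⟩))
  · exact Finset.union_subset (h4 (h2 ⟨x, hx, hxT⟩)) (h2 ⟨x, hx, hxT⟩)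

lemma Conn.ins {G : SimpleGraph V} {S : Finset V} (hS : Conn G S) {x s : V} (hs : s ∈ S)
    (h : G.Adj x s) : Conn G (insert x S) := by
  rw [← Finset.singleton_union]
  exact (conn_singleton G x).union hS ⟨x, by simp, s, hs, Or.inr h⟩

lemma exists_comp {G : SimpleGraph V} (S : Finset V) {v : V} (hv : v ∈ S) :
    ∃ E ⊆ S, v ∈ E ∧ Conn G E ∧ ∀ u ∈ E, ∀ w ∈ S, G.Adj u w → w ∈ E := by
  obtain ⟨E, hE, hmax⟩ := Finset.exists_max_image
    (S.powerset.filter (fun E => v ∈ E ∧ Conn G E)) Finset.card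
    ⟨{v}, by simp [hv, conn_singleton]⟩
  rw [Finset.mem_filter, Finset.mem_powerset] at hE
  refine ⟨E, hE.1, hE.2.1, hE.2.2, fun u hu w hw huw => ?_⟩
  by_contra hwE
  have := hmax (insert w E) (by
    rw [Finset.mem_filter, Finset.mem_powerset]
    exact ⟨Finset.insert_subset hw hE.1, Finset.mem_insert_of_mem hE.2.1,
      hE.2.2.ins hu huw.symm⟩)
  rw [Finset.card_insert_of_notMem hwE] at this
  omega

lemma Conn.exists_noncut {G : SimpleGraph V} {A S : Finset V} (hA : Conn G A) (hS : Conn G S)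
    (hSA : S ⊆ A) (hne : S ≠ A) : ∃ w ∈ A, w ∉ S ∧ Conn G (A.erase w) := by
  obtain ⟨M, hM, hmax⟩ := Finset.exists_max_image
    (A.powerset.filter (fun E => S ⊆ E ∧ E ≠ A ∧ Conn G E)) Finset.card
    ⟨S, by simp [hSA, hS, hne]⟩
  rw [Finset.mem_filter, Finset.mem_powerset] at hM
  obtain ⟨hMA, hSM, hMne, hMc⟩ := hM
  obtain ⟨u, hu, v, hv, hvM, huv⟩ := hA.exists_adj hMA hMc.1 hMne
  have h1 : Conn G (insert v M) := hMc.ins hu huv.symm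
  have h2 : insert v M = A := by
    by_contra hcon
    have := hmax (insert v M) (by
      rw [Finset.mem_filter, Finset.mem_powerset]
      exact ⟨Finset.insert_subset hv hMA, hSM.trans (Finset.subset_insert _ _), hcon, h1⟩)
    rw [Finset.card_insert_of_notMem hvM] at this
    omega
  refine ⟨v, hv, fun h => hvM (hSM h), ?_⟩
  rw [← h2, Finset.erase_insert hvM]
  exact hMc

lemma Conn.sdiff_comp {G : SimpleGraph V} {A S E : Finset V} (hA : Conn G A) (hS : Conn G S)
    (hSA : S ⊆ A) (hE : E ⊆ A \ S) (hcl : ∀ u ∈ E, ∀ w ∈ A \ S, G.Adj u w → w ∈ E) :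
    Conn G (A \ E) := by
  have hSE : ∀ x ∈ S, x ∉ E := fun x hx hxE => (Finset.mem_sdiff.1 (hE hxE)).2 hx
  refine ⟨?_, fun T hT hne hTcl => ?_⟩
  · obtain ⟨s, hs⟩ := hS.1
    exact ⟨s, Finset.mem_sdiff.2 ⟨hSA hs, hSE s hs⟩⟩
  by_cases hTS : ∃ t ∈ T, t ∈ S
  · have h1 : S ⊆ T := by
      obtain ⟨t, ht, htS⟩ := hTS
      have := hS.2 (T ∩ S) Finset.inter_subset_right ⟨t, Finset.mem_inter.2 ⟨ht, htS⟩⟩ (by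
        intro p hp q hq hpq
        rw [Finset.mem_inter] at *
        exact ⟨hTcl p hp.1 q (Finset.mem_sdiff.2 ⟨hSA hq, hSE q hq⟩) hpq, hq⟩)
      rw [← this]
      exact Finset.inter_subset_left
    have h2 : T ∪ E = A := by
      apply hA.2
      · exact Finset.union_subset (hT.trans Finset.sdiff_subset) (hE.trans Finset.sdiff_subset)
      · exact hne.mono Finset.subset_union_left
      · intro u hu v hv huv
        rw [Finset.mem_union] at *
        by_cases hvE : v ∈ E
        · exact Or.inr hvE
        rcases hu with hu | hu
        · exact Or.inl (hTcl u hu v (Finset.mem_sdiff.2 ⟨hv, hvE⟩) huv)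
        · by_cases hvS : v ∈ S
          · exact Or.inl (h1 hvS)
          · exact Or.inr (hcl u hu v (Finset.mem_sdiff.2 ⟨hv, hvS⟩) huv)
    apply Finset.Subset.antisymm hT
    intro x hx
    rw [Finset.mem_sdiff, ← h2, Finset.mem_union] at hx
    tauto
  · push Not at hTS
    exfalso
    have h2 : T = A := by
      apply hA.2 T (hT.trans Finset.sdiff_subset) hne
      intro u hu v hv huv
      by_cases hvE : v ∈ E
      · exfalso
        have := hcl v hvE u (Finset.mem_sdiff.2 ⟨(Finset.mem_sdiff.1 (hT hu)).1, hTS u hu⟩) huv.symm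
        exact (Finset.mem_sdiff.1 (hT hu)).2 this
      · exact hTcl u hu v (Finset.mem_sdiff.2 ⟨hv, hvE⟩) huv
    obtain ⟨s, hs⟩ := hS.1
    exact hTS s (h2 ▸ hSA hs) hs

lemma deg_slack {G : SimpleGraph V} {B : Finset V} (hB : Conn G B) (f : V → ℕ)
    (hf : ∀ v ∈ B, (nb G B v).card ≤ f v) (hs : ∃ s ∈ B, (nb G B s).card < f s) :
    ∀ T ⊆ B, T.Nonempty → ∃ t ∈ T, (nb G T t).card < f t := by
  intro T hT hne
  by_cases hTB : T = B
  · subst hTB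
    exact hs
  · obtain ⟨u, hu, v, hv, hvT, huv⟩ := hB.exists_adj hT hne hTB
    refine ⟨u, hu, lt_of_lt_of_le ?_ (hf u (hT hu))⟩
    apply Finset.card_lt_card
    rw [Finset.ssubset_iff_of_subset (nb_mono hT u)]
    exact ⟨v, mem_nb.2 ⟨hv, huv⟩, fun h => hvT (mem_nb.1 h).1⟩

/-! ## List colouring -/

def LCol (G : SimpleGraph V) {k : ℕ} (B : Finset V) (L : V → Finset (Fin k)) : Prop :=
  ∃ c : V → Fin k, ProperOn G B c ∧ ∀ v ∈ B, c v ∈ L v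

lemma greedy {G : SimpleGraph V} {k : ℕ} (B : Finset V) (L : V → Finset (Fin k))
    (hk : 0 < k)
    (h : ∀ T ⊆ B, T.Nonempty → ∃ t ∈ T, (nb G T t).card < (L t).card) : LCol G B L := by
  induction B using Finset.strongInduction with
  | _ B ih =>
  by_cases hB : B.Nonempty
  swap
  · rw [Finset.not_nonempty_iff_eq_empty] at hB
    subst hB
    exact ⟨fun _ => ⟨0, hk⟩, by intro u hu; simp at hu, by simp⟩
  obtain ⟨t, ht, hdeg⟩ := h B subset_rfl hB
  obtain ⟨c, hc, hcL⟩ := ih (B.erase t) (Finset.erase_ssubset ht)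
    (fun T hT => h T (hT.trans (Finset.erase_subset _ _)))
  have : ((nb G B t).image c).card < (L t).card := lt_of_le_of_lt Finset.card_image_le hdeg
  obtain ⟨m, hm, hmi⟩ := Finset.exists_mem_notMem_of_card_lt_card this
  refine ⟨Function.update c t m, ProperOn.update hc ?_, ?_⟩
  · intro w hw htw hcw
    exact hmi (Finset.mem_image.2 ⟨w, mem_nb.2 ⟨hw, htw⟩, hcw⟩)
  · intro v hv
    by_cases hvt : v = t
    · subst hvt; simpa using hm
    · rw [Function.update_of_ne hvt]
      exact hcL v (Finset.mem_erase.2 ⟨hvt, hv⟩)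

lemma lcol_of_slack {G : SimpleGraph V} {k : ℕ} {B : Finset V} {L : V → Finset (Fin k)}
    (hk : 0 < k) (hB : Conn G B) (hL : ∀ v ∈ B, (nb G B v).card ≤ (L v).card)
    (hs : ∃ s ∈ B, (nb G B s).card < (L s).card) : LCol G B L :=
  greedy B L hk (deg_slack hB (fun v => (L v).card) hL hs)

structure Bad (G : SimpleGraph V) {k : ℕ} (B : Finset V) (L : V → Finset (Fin k)) : Prop where
  pos : 0 < k
  conn : Conn G B
  deg : ∀ v ∈ B, (nb G B v).card ≤ (L v).card
  ncol : ¬ LCol G B L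

lemma Bad.eq {G : SimpleGraph V} {k : ℕ} {B : Finset V} {L : V → Finset (Fin k)}
    (h : Bad G B L) : ∀ v ∈ B, (L v).card = (nb G B v).card := by
  intro v hv
  by_contra hcon
  exact h.ncol (lcol_of_slack h.pos h.conn h.deg ⟨v, hv, lt_of_le_of_ne (h.deg v hv) (Ne.symm hcon)⟩)

noncomputable def delL (G : SimpleGraph V) {k : ℕ} (L : V → Finset (Fin k)) (v : V) (j : Fin k) :
    V → Finset (Fin k) := fun w => if G.Adj v w then (L w).erase j else L w

lemma nb_erase {G : SimpleGraph V} {B : Finset V} (v w : V) :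
    nb G (B.erase v) w = (nb G B w).erase v := by
  ext x
  simp only [mem_nb, Finset.mem_erase]
  tauto

lemma Bad.delete {G : SimpleGraph V} {k : ℕ} {B : Finset V} {L : V → Finset (Fin k)}
    (h : Bad G B L) {v : V} (hv : v ∈ B) (hc : Conn G (B.erase v)) {j : Fin k} (hj : j ∈ L v) :
    Bad G (B.erase v) (delL G L v j) := by
  refine ⟨h.pos, hc, fun w hw => ?_, ?_⟩
  · have hwB := Finset.mem_of_mem_erase hw
    rw [nb_erase]
    unfold delL
    split_ifs with hvw
    · have h1 : v ∈ nb G B w := mem_nb.2 ⟨hv, hvw.symm⟩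
      rw [Finset.card_erase_of_mem h1]
      have := h.deg w hwB
      have := Finset.pred_card_le_card_erase (s := L w) (a := j)
      omega
    · exact (Finset.card_le_card (Finset.erase_subset _ _)).trans (h.deg w hwB)
  · rintro ⟨c, hcp, hcL⟩
    apply h.ncol
    refine ⟨Function.update c v j, ProperOn.update hcp ?_, ?_⟩
    · intro w hw hvw hcw
      have := hcL w (Finset.mem_erase.2 ⟨hvw.ne', hw⟩)
      unfold delL at this
      rw [if_pos hvw, hcw] at this
      simp at this
    · intro w hw
      by_cases hwv : w = v
      · subst hwv; simpa using hj
      · rw [Function.update_of_ne hwv]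
        have := hcL w (Finset.mem_erase.2 ⟨hwv, hw⟩)
        unfold delL at this
        split_ifs at this
        · exact Finset.mem_of_mem_erase this
        · exact this

lemma Bad.sub {G : SimpleGraph V} {k : ℕ} {B : Finset V} {L : V → Finset (Fin k)}
    (h : Bad G B L) {v w : V} (hv : v ∈ B) (hc : Conn G (B.erase v)) (hw : w ∈ B)
    (hvw : G.Adj v w) : L v ⊆ L w := by
  intro j hj
  by_contra hjw
  have h1 := (h.delete hv hc hj).eq w (Finset.mem_erase.2 ⟨hvw.ne', hw⟩)
  rw [nb_erase] at h1
  unfold delL at h1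
  rw [if_pos hvw, Finset.erase_eq_of_notMem hjw, h.eq w hw,
    Finset.card_erase_of_mem (mem_nb.2 ⟨hv, hvw.symm⟩)] at h1
  have : 0 < (nb G B w).card := Finset.card_pos.2 ⟨v, mem_nb.2 ⟨hv, hvw.symm⟩⟩
  omega

/-! ## Non-cut vertices -/

noncomputable def NC (G : SimpleGraph V) (B : Finset V) : Finset V :=
  B.filter (fun w => Conn G (B.erase w))

lemma mem_NC {G : SimpleGraph V} {B : Finset V} {w : V} :
    w ∈ NC G B ↔ w ∈ B ∧ Conn G (B.erase w) := by simp [NC]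

lemma conn_star {G : SimpleGraph V} {S : Finset V} {b : V} (hb : b ∈ S)
    (h : ∀ v ∈ S, v ≠ b → G.Adj b v) : Conn G S := by
  refine ⟨⟨b, hb⟩, fun T hT hne hcl => ?_⟩
  have hbT : b ∈ T := by
    obtain ⟨t, ht⟩ := hne
    by_cases htb : t = b
    · exact htb ▸ ht
    · exact hcl t ht b hb (h t (hT ht) htb).symm
  apply Finset.Subset.antisymm hT
  intro v hv
  by_cases hvb : v = b
  · exact hvb ▸ hbT
  · exact hcl b hbT v hv (h v hv hvb)

lemma lemmaN {G : SimpleGraph V} (n : ℕ) : ∀ (B : Finset V), B.card = n → ∀ b ∈ B, Conn G B →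
    (nb G B b).card ≤ ((NC G B).erase b).card := by
  induction n with
  | zero => 
    intro B hB b hb
    rw [Finset.card_eq_zero] at hB
    subst hB
    simp at hb
  | succ n ih =>
  intro B hB b hb hconn
  by_cases hstar : insert b (nb G B b) = B
  · apply Finset.card_le_card
    intro w hw
    have hw' := mem_nb.1 hw
    refine Finset.mem_erase.2 ⟨hw'.2.ne', mem_NC.2 ⟨hw'.1, ?_⟩⟩
    apply conn_star (b := b)
    · exact Finset.mem_erase.2 ⟨hw'.2.ne, hb⟩
    · intro v hv hvb
      have : v ∈ insert b (nb G B b) := by rw [hstar]; exact Finset.mem_of_mem_erase hv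
      rw [Finset.mem_insert, mem_nb] at this
      exact (this.resolve_left hvb).2
  · obtain ⟨w, hwB, hw, hwc⟩ := hconn.exists_noncut (S := insert b (nb G B b))
      (conn_star (b := b) (by simp) (by
        intro v hv hvb
        rw [Finset.mem_insert, mem_nb] at hv
        exact (hv.resolve_left hvb).2))
      (Finset.insert_subset hb (Finset.filter_subset _ _)) hstar
    have hwb : w ≠ b := fun h => hw (by simp [h])
    have hwnb : w ∉ nb G B b := fun h => hw (Finset.mem_insert_of_mem h)
    have ihw := ih (B.erase w) (by rw [Finset.card_erase_of_mem hwB, hB]; rfl) b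
      (Finset.mem_erase.2 ⟨hwb.symm, hb⟩) hwc
    rw [nb_erase, Finset.erase_eq_of_notMem hwnb] at ihw
    refine ihw.trans ?_
    have hwNC : w ∈ (NC G B).erase b := Finset.mem_erase.2 ⟨hwb, mem_NC.2 ⟨hwB, hwc⟩⟩
    have key : ∀ y ∈ NC G (B.erase w), y ∉ NC G B → ∀ x ∈ B, G.Adj w x → x = y := by
      intro y hy hyB x hx hwx
      by_contra hxy
      apply hyB
      have hy' := mem_NC.1 hy
      have hyw := Finset.ne_of_mem_erase hy'.1
      refine mem_NC.2 ⟨Finset.mem_of_mem_erase hy'.1, ?_⟩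
      have := hy'.2.ins (x := w) (s := x)
        (Finset.mem_erase.2 ⟨hxy, Finset.mem_erase.2 ⟨hwx.ne', hx⟩⟩) hwx
      rwa [Finset.erase_right_comm, Finset.insert_erase (Finset.mem_erase.2 ⟨hyw.symm, hwB⟩)] at this
    by_cases hy : ∃ y ∈ NC G (B.erase w), y ∉ NC G B
    · obtain ⟨y0, hy0, hy0B⟩ := hy
      have hsub : (NC G (B.erase w)).erase b ⊆ insert y0 (((NC G B).erase b).erase w) := by
        intro y hy
        rw [Finset.mem_erase] at hy
        have hy' := mem_NC.1 hy.2
        by_cases hyB : y ∈ NC G B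
        · exact Finset.mem_insert_of_mem (Finset.mem_erase.2 ⟨Finset.ne_of_mem_erase hy'.1,
            Finset.mem_erase.2 ⟨hy.1, hyB⟩⟩)
        · obtain ⟨u, hu, x, hx, hxT, hux⟩ := hconn.exists_adj (T := {w}) (by simpa using hwB) (by simp)
            (by
              intro h
              rw [← h] at hb
              exact hwb (Finset.mem_singleton.1 hb).symm)
          rw [Finset.mem_singleton] at hu
          subst hu
          rw [← key y hy.2 hyB x hx hux, ← key y0 hy0 hy0B x hx hux]
          simp
      refine (Finset.card_le_card hsub).trans ?_
      refine (Finset.card_insert_le _ _).trans ?_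
      rw [Finset.card_erase_of_mem hwNC]
      have : 0 < ((NC G B).erase b).card := Finset.card_pos.2 ⟨w, hwNC⟩
      omega
    · push Not at hy
      exact Finset.card_le_card (Finset.erase_subset_erase _ hy)

lemma nc_card {G : SimpleGraph V} {B : Finset V} {b : V} (hB : Conn G B) (hb : b ∈ NC G B) :
    (nb G B b).card + 1 ≤ (NC G B).card := by
  have := lemmaN B.card B rfl b (mem_NC.1 hb).1 hB
  rw [Finset.card_erase_of_mem hb] at this
  have : 0 < (NC G B).card := Finset.card_pos.2 ⟨b, hb⟩
  omega

lemma nc_nonempty {G : SimpleGraph V} {B : Finset V} (hB : Conn G B) (h : 2 ≤ B.card) :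
    (NC G B).Nonempty := by
  obtain ⟨b, hb⟩ := hB.1
  obtain ⟨w, hw, -, hwc⟩ := hB.exists_noncut (conn_singleton G b) (by simpa using hb) (by
    intro h'
    rw [← h'] at h
    simp at h)
  exact ⟨w, mem_NC.2 ⟨hw, hwc⟩⟩

end part3

section part4

/-! ## The neighbourhood of a non-cut vertex in an uncolourable component -/

lemma claimG {G : SimpleGraph V} {k : ℕ} (n : ℕ) : ∀ (B : Finset V) (L : V → Finset (Fin k)),
    B.card = n → Bad G B L → ∀ v ∈ NC G B, 3 ≤ (nb G B v).card →
    ∀ c ∈ nb G B v, ∀ c' ∈ nb G B v, c ≠ c' → G.Adj c c' := by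
  induction n with
  | zero => 
    intro B L hB hb v hv
    rw [Finset.card_eq_zero] at hB
    subst hB
    simp [NC] at hv
  | succ n ih =>
  intro B L hn hbad v hv h3 c hc c' hc' hne
  by_contra hcc
  obtain ⟨d, hd, hdc, hdc'⟩ : ∃ d ∈ nb G B v, d ≠ c ∧ d ≠ c' := by
    by_contra hcon
    push Not at hcon
    have : nb G B v ⊆ {c, c'} := by
      intro x hx
      have := hcon x hx
      simp only [Finset.mem_insert, Finset.mem_singleton]
      tauto
    have := (Finset.card_le_card this).trans Finset.card_le_two
    omega
  obtain ⟨hvB, hvA⟩ := mem_NC.1 hv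
  have mA : ∀ x ∈ nb G B v, x ∈ B.erase v := fun x hx =>
    Finset.mem_erase.2 ⟨(mem_nb.1 hx).2.ne', (mem_nb.1 hx).1⟩
  by_cases hw : ∃ w ∈ NC G (B.erase v), w ≠ c ∧ w ≠ c' ∧ w ≠ d
  · obtain ⟨w, hw, h1, h2, h4⟩ := hw
    obtain ⟨hwA, hwc⟩ := mem_NC.1 hw
    have hwB := Finset.mem_of_mem_erase hwA
    have hwv := Finset.ne_of_mem_erase hwA
    have hconn : Conn G (B.erase w) := by
      have := hwc.ins (x := v) (s := c) (Finset.mem_erase.2 ⟨h1.symm, mA c hc⟩) (mem_nb.1 hc).2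
      rwa [Finset.erase_right_comm, Finset.insert_erase (Finset.mem_erase.2 ⟨hwv.symm, hvB⟩)] at this
    have hLw : (L w).Nonempty := by
      obtain ⟨u, hu, x, hx, hxT, hux⟩ := hbad.conn.exists_adj (T := {w}) (by simpa using hwB) (by simp)
        (by intro h
            rw [← h] at hvB
            exact hwv (Finset.mem_singleton.1 hvB).symm)
      rw [Finset.mem_singleton] at hu
      subst hu
      rw [← Finset.card_pos, hbad.eq u hwB]
      exact Finset.card_pos.2 ⟨x, mem_nb.2 ⟨hx, hux⟩⟩
    obtain ⟨j, hj⟩ := hLw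
    have hmem : ∀ x, x ∈ nb G B v → x ≠ w → x ∈ nb G (B.erase w) v := by
      intro x hx hxw
      rw [nb_erase]
      exact Finset.mem_erase.2 ⟨hxw, hx⟩
    refine hcc (ih (B.erase w) _ ?_ (hbad.delete hwB hconn hj) v ?_ ?_ c (hmem c hc h1.symm)
      c' (hmem c' hc' h2.symm) hne)
    · rw [Finset.card_erase_of_mem hwB, hn]; rfl
    · refine mem_NC.2 ⟨Finset.mem_erase.2 ⟨hwv.symm, hvB⟩, ?_⟩
      rwa [Finset.erase_right_comm]
    · have : ({c, c', d} : Finset V) ⊆ nb G (B.erase w) v := by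
        intro x hx
        simp only [Finset.mem_insert, Finset.mem_singleton] at hx
        rcases hx with rfl | rfl | rfl
        · exact hmem _ hc h1.symm
        · exact hmem _ hc' h2.symm
        · exact hmem _ hd h4.symm
      have h5 := Finset.card_le_card this
      rwa [Finset.card_eq_three.2 ⟨c, c', d, hne, hdc.symm, hdc'.symm, rfl⟩] at h5
  · push Not at hw
    set A := B.erase v with hAdef
    have hsub : NC G A ⊆ {c, c', d} := by
      intro w hw'
      simp only [Finset.mem_insert, Finset.mem_singleton]
      have := hw w hw'
      tauto
    have hA2 : 2 ≤ A.card := by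
      have : ({c, c'} : Finset V) ⊆ A := by
        intro x hx
        simp only [Finset.mem_insert, Finset.mem_singleton] at hx
        rcases hx with rfl | rfl
        · exact mA _ hc
        · exact mA _ hc'
      have h5 := Finset.card_le_card this
      rwa [Finset.card_pair hne] at h5
    obtain ⟨w0, hw0⟩ := nc_nonempty hvA hA2
    have hw0nb : w0 ∈ nb G B v := by
      have := hsub hw0
      simp only [Finset.mem_insert, Finset.mem_singleton] at this
      rcases this with rfl | rfl | rfl <;> assumption
    have hw0B := (mem_nb.1 hw0nb).1
    have hw0v := (mem_nb.1 hw0nb).2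
    have hconn0 : Conn G (B.erase w0) := by
      obtain ⟨x, hx, hxw⟩ : ∃ x ∈ nb G B v, x ≠ w0 := by
        by_cases h : c = w0
        · exact ⟨c', hc', fun h' => hne (h.trans h'.symm)⟩
        · exact ⟨c, hc, h⟩
      have := (mem_NC.1 hw0).2.ins (x := v) (s := x) (Finset.mem_erase.2 ⟨hxw, mA x hx⟩) (mem_nb.1 hx).2
      rwa [hAdef, Finset.erase_right_comm, Finset.insert_erase (Finset.mem_erase.2 ⟨hw0v.ne, hvB⟩)] at this
    have hL : L w0 = L v := Finset.Subset.antisymm (hbad.sub hw0B hconn0 hvB hw0v.symm)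
      (hbad.sub hvB hvA hw0B hw0v)
    have hdeg0 : 3 ≤ (nb G B w0).card := by
      rw [← hbad.eq w0 hw0B, hL, hbad.eq v hvB]; exact h3
    have hdegA : 2 ≤ (nb G A w0).card := by
      rw [hAdef, nb_erase, Finset.card_erase_of_mem (mem_nb.2 ⟨hvB, hw0v.symm⟩)]
      omega
    have hNC3 := nc_card hvA hw0
    have heq : NC G A = {c, c', d} := by
      apply Finset.eq_of_subset_of_card_le hsub
      refine Finset.card_le_three.trans ?_
      omega
    have hcNC : Conn G (A.erase c) := (mem_NC.1 (by rw [heq]; simp : c ∈ NC G A)).2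
    have hcNC' : Conn G (A.erase c') := (mem_NC.1 (by rw [heq]; simp : c' ∈ NC G A)).2
    set R := (A.erase c).erase c' with hR
    have hdR : d ∈ R := by
      rw [hR, Finset.mem_erase, Finset.mem_erase]
      exact ⟨hdc', hdc, mA d hd⟩
    have hRconn : Conn G R := by
      obtain ⟨E, hE, hdE, hEc, hEcl⟩ := exists_comp (G := G) R hdR
      by_contra hcon
      have hER : E ≠ R := by
        rintro rfl
        exact hcon hEc
      have hadj : ∀ y, y ∈ A → y ∉ R → (∀ x ∈ A, x ∉ R → x = c ∨ x = c') → 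
          ∀ y', y' ∈ A → y' ∉ R → y ≠ y' → (∀ x ∈ A, x ∉ R → x = y ∨ x = y') → Conn G (A.erase y) → 
          ∃ e ∈ E, G.Adj e y' := by
        intro y hy hyR _ y' hy' hy'R hyy hall hcy
        have hEy : E ⊆ A.erase y := by
          intro x hx
          refine Finset.mem_erase.2 ⟨fun h => hyR (h ▸ hE hx), ?_⟩
          exact Finset.mem_of_mem_erase (Finset.mem_of_mem_erase (hE hx))
        obtain ⟨e, he, x, hx, hxE, hex⟩ := hcy.exists_adj hEy hEc.1 (by
          intro h
          have : y' ∈ E := by rw [h]; exact Finset.mem_erase.2 ⟨hyy.symm, hy'⟩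
          exact hy'R (hE this))
        refine ⟨e, he, ?_⟩
        have hxR : x ∉ R := fun hxR => hxE (hEcl e he x hxR hex)
        rcases hall x (Finset.mem_of_mem_erase hx) hxR with rfl | rfl
        · exact absurd rfl (Finset.ne_of_mem_erase hx)
        · exact hex
      have hall : ∀ x ∈ A, x ∉ R → x = c ∨ x = c' := by
        intro x hx hxR
        rw [hR, Finset.mem_erase, Finset.mem_erase] at hxR
        tauto
      have hcR : c ∉ R := by simp [hR]
      have hcR' : c' ∉ R := by simp [hR]
      obtain ⟨e1, he1, hec'⟩ := hadj c (mA c hc) hcR hall c' (mA c' hc') hcR' hne hall hcNC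
      obtain ⟨e2, he2, hec⟩ := hadj c' (mA c' hc') hcR' hall c (mA c hc) hcR hne.symm
        (fun x hx hxR => (hall x hx hxR).symm) hcNC'
      have hEE : Conn G (insert c' (insert c E)) := 
        (hEc.ins he2 hec.symm).ins (Finset.mem_insert_of_mem he1) hec'.symm
      obtain ⟨w, hwA, hwn, hwc⟩ := hvA.exists_noncut hEE (by
        apply Finset.insert_subset (mA c' hc')
        apply Finset.insert_subset (mA c hc)
        exact hE.trans ((Finset.erase_subset _ _).trans (Finset.erase_subset _ _))) (by
        intro h
        apply hER
        apply Finset.Subset.antisymm hE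
        intro x hx
        have hxA : x ∈ A := Finset.mem_of_mem_erase (Finset.mem_of_mem_erase hx)
        rw [← h, Finset.mem_insert, Finset.mem_insert] at hxA
        rcases hxA with rfl | rfl | hxA
        · exact absurd hx hcR'
        · exact absurd hx hcR
        · exact hxA)
      have := hsub (mem_NC.2 ⟨hwA, hwc⟩)
      simp only [Finset.mem_insert, Finset.mem_singleton] at this hwn
      rcases this with rfl | rfl | rfl
      · exact hwn (by simp)
      · exact hwn (by simp)
      · exact hwn (by simp [hdE])
    have hvR : v ∉ R := fun h =>
      (Finset.ne_of_mem_erase (Finset.mem_of_mem_erase (Finset.mem_of_mem_erase h))) rfl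
    have hRv : Conn G (insert v R) := hRconn.ins hdR (mem_nb.1 hd).2
    have hvw : ∀ x ∈ B, x ≠ c → x ≠ c' → x ∈ insert v R := by
      intro x hx h1 h2
      rw [Finset.mem_insert, hR, Finset.mem_erase, Finset.mem_erase, hAdef, Finset.mem_erase]
      tauto
    have hRB : ∀ x ∈ insert v R, x ∈ B ∧ x ≠ c ∧ x ≠ c' := by
      intro x hx
      rw [Finset.mem_insert, hR, Finset.mem_erase, Finset.mem_erase, hAdef, Finset.mem_erase] at hx
      rcases hx with rfl | hx
      · exact ⟨hvB, (mem_nb.1 hc).2.ne, (mem_nb.1 hc').2.ne⟩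
      · tauto
    obtain ⟨j, hj⟩ : (L v).Nonempty := by
      rw [← Finset.card_pos, hbad.eq v hvB]; omega
    have hjc : j ∈ L c := hbad.sub hvB hvA (mem_nb.1 hc).1 (mem_nb.1 hc).2 hj
    have hjc' : j ∈ L c' := hbad.sub hvB hvA (mem_nb.1 hc').1 (mem_nb.1 hc').2 hj
    have hcol : LCol G (insert v R) (fun w => if G.Adj c w ∨ G.Adj c' w then (L w).erase j else L w) := by
      have hnbR : ∀ w, nb G (insert v R) w = ((nb G B w).erase c).erase c' := by
        intro w
        ext x
        rw [mem_nb, Finset.mem_erase, Finset.mem_erase, mem_nb]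
        constructor
        · intro h
          have := hRB x h.1
          tauto
        · intro h
          exact ⟨hvw x h.2.2.1 h.2.1 h.1, h.2.2.2⟩
      apply lcol_of_slack hbad.pos hRv
      · intro w hw'
        have hwB := (hRB w hw').1
        have hdw := hbad.deg w hwB
        rw [hnbR]
        split_ifs with hadj
        · have e1 := Finset.pred_card_le_card_erase (s := L w) (a := j)
          have e2 : (((nb G B w).erase c).erase c').card ≤ (nb G B w).card - 1 := by
            rcases hadj with hadj | hadj
            · rw [← Finset.card_erase_of_mem (mem_nb.2 ⟨(mem_nb.1 hc).1, hadj.symm⟩)]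
              exact Finset.card_le_card (Finset.erase_subset _ _)
            · rw [← Finset.card_erase_of_mem (mem_nb.2 ⟨(mem_nb.1 hc').1, hadj.symm⟩)]
              exact Finset.card_le_card (Finset.erase_subset_erase _ (Finset.erase_subset _ _))
          omega
        · exact (Finset.card_le_card ((Finset.erase_subset _ _).trans
            (Finset.erase_subset _ _))).trans hdw
      · refine ⟨v, by simp, ?_⟩
        rw [hnbR, if_pos (Or.inl (mem_nb.1 hc).2.symm), Finset.card_erase_of_mem hj, hbad.eq v hvB,
          Finset.card_erase_of_mem (Finset.mem_erase.2 ⟨hne.symm, hc'⟩), Finset.card_erase_of_mem hc]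
        omega
    obtain ⟨col, hcp, hcL⟩ := hcol
    apply hbad.ncol
    refine ⟨fun x => if x = c ∨ x = c' then j else col x, ?_, ?_⟩
    · have hside : ∀ x ∈ B, (x ≠ c ∧ x ≠ c') → ∀ y, (y = c ∨ y = c') → G.Adj y x → col x ≠ j := by
        intro x hx hxn y hy hyx hcolx
        have := hcL x (hvw x hx hxn.1 hxn.2)
        have hor : G.Adj c x ∨ G.Adj c' x := by
          rcases hy with rfl | rfl
          · exact Or.inl hyx
          · exact Or.inr hyx
        simp only [if_pos hor, hcolx] at this
        simp at this
      intro x hx y hy hxy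
      simp only
      by_cases hxc : x = c ∨ x = c' <;> by_cases hyc : y = c ∨ y = c'
      · exfalso
        rcases hxc with rfl | rfl <;> rcases hyc with rfl | rfl
        · exact G.loopless.irrefl _ hxy
        · exact hcc hxy
        · exact hcc hxy.symm
        · exact G.loopless.irrefl _ hxy
      · rw [if_pos hxc, if_neg hyc]
        exact (hside y hy (by tauto) x hxc hxy).symm
      · rw [if_neg hxc, if_pos hyc]
        exact (hside x hx (by tauto) y hyc hxy.symm)
      · rw [if_neg hxc, if_neg hyc]
        exact hcp x (hvw x hx (by tauto) (by tauto)) y (hvw y hy (by tauto) (by tauto)) hxy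
    · intro x hx
      simp only
      by_cases hxc : x = c ∨ x = c'
      · rw [if_pos hxc]
        rcases hxc with rfl | rfl <;> assumption
      · rw [if_neg hxc]
        have := hcL x (hvw x hx (by tauto) (by tauto))
        simp only at this
        split_ifs at this
        · exact Finset.mem_of_mem_erase this
        · exact this

/-! ## Precolouring extension -/

/-- lists left over by a precolouring `c0` of `D` -/
noncomputable def preL (G : SimpleGraph V) {k : ℕ} (D : Finset V) (c0 : V → Fin k) (v : V) :
    Finset (Fin k) := Finset.univ \ (nb G D v).image c0

structure PreBad [Fintype V] (G : SimpleGraph V) {k : ℕ} (D : Finset V) (c0 : V → Fin k)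
    (B : Finset V) : Prop where
  disj : ∀ b ∈ B, b ∉ D
  closed : ∀ b ∈ B, ∀ v, G.Adj b v → v ∉ D → v ∈ B
  bad : Bad G B (preL G D c0)

lemma pre [Fintype V] {G : SimpleGraph V} {k : ℕ} (hk : 0 < k)
    (hreg : ∀ v, (nb G Finset.univ v).card = k) (D : Finset V) (c0 : V → Fin k)
    (h0 : ProperOn G D c0) (hno : ¬ ∃ c, ProperOn G Finset.univ c ∧ ∀ v ∈ D, c v = c0 v) :
    ∃ B, PreBad G D c0 B := by
  by_contra hcon
  -- all components are colourable
  have key : ∀ n, ∀ S : Finset V, S.card = n → (∀ b ∈ S, b ∉ D) →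
      (∀ b ∈ S, ∀ v, G.Adj b v → v ∉ D → v ∈ S) → LCol G S (preL G D c0) := by
    intro n
    induction n using Nat.strong_induction_on with
    | _ n ih =>
    intro S hn hSD hScl
    by_cases hS : S.Nonempty
    swap
    · rw [Finset.not_nonempty_iff_eq_empty] at hS
      subst hS
      exact ⟨fun _ => ⟨0, hk⟩, by intro u hu; simp at hu, by simp⟩
    obtain ⟨s, hs⟩ := hS
    obtain ⟨E, hES, hsE, hEc, hEcl⟩ := exists_comp (G := G) S hs
    have hEcl' : ∀ b ∈ E, ∀ v, G.Adj b v → v ∉ D → v ∈ E := fun b hb v hbv hv =>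
      hEcl b hb v (hScl b (hES hb) v hbv hv) hbv
    have h1 : LCol G E (preL G D c0) := by
      by_contra hE
      apply hcon
      refine ⟨E, fun b hb => hSD b (hES hb), hEcl', hk, hEc, ?_, hE⟩
      intro v hv
      unfold preL
      rw [Finset.card_sdiff_of_subset (Finset.subset_univ _), Finset.card_univ, Fintype.card_fin]
      have e1 : ((nb G D v).image c0).card ≤ (nb G D v).card := Finset.card_image_le
      have e2 : (nb G E v).card + (nb G D v).card = (nb G Finset.univ v).card := by
        rw [← Finset.card_union_of_disjoint]
        · congr 1
          ext x
          simp only [Finset.mem_union, mem_nb, Finset.mem_univ, true_and]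
          have := hEcl' v hv x
          tauto
        · rw [Finset.disjoint_left]
          intro x hx hx'
          exact hSD x (hES (mem_nb.1 hx).1) (mem_nb.1 hx').1
      rw [hreg] at e2
      omega
    have h2 : LCol G (S \ E) (preL G D c0) := by
      refine ih (S \ E).card ?_ (S \ E) rfl (fun b hb => hSD b (Finset.mem_sdiff.1 hb).1) ?_
      · rw [← hn]
        exact Finset.card_lt_card (Finset.sdiff_ssubset hES ⟨s, hsE⟩)
      · intro b hb v hbv hv
        rw [Finset.mem_sdiff] at *
        refine ⟨hScl b hb.1 v hbv hv, fun hvE => hb.2 (hEcl v hvE b hb.1 hbv.symm)⟩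
    obtain ⟨c1, p1, l1⟩ := h1
    obtain ⟨c2, p2, l2⟩ := h2
    refine ⟨fun x => if x ∈ E then c1 x else c2 x, ?_, ?_⟩
    · intro u hu v hv huv
      by_cases hu' : u ∈ E
      · have hv' : v ∈ E := hEcl u hu' v hv huv
        simp only [hu', hv', if_true]
        exact p1 u hu' v hv' huv
      · have hv' : v ∉ E := fun hv' => hu' (hEcl v hv' u hu huv.symm)
        simp only [hu', hv', if_false]
        exact p2 u (Finset.mem_sdiff.2 ⟨hu, hu'⟩) v (Finset.mem_sdiff.2 ⟨hv, hv'⟩) huv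
    · intro v hv
      by_cases hv' : v ∈ E
      · simp only [hv', if_true]
        exact l1 v hv'
      · simp only [hv', if_false]
        exact l2 v (Finset.mem_sdiff.2 ⟨hv, hv'⟩)
  obtain ⟨c, hc, hcL⟩ := key _ (Finset.univ \ D) rfl (by simp) (by simp)
  apply hno
  refine ⟨fun x => if x ∈ D then c0 x else c x, ?_, ?_⟩
  · have hside : ∀ u ∈ D, ∀ v, v ∉ D → G.Adj u v → c v ≠ c0 u := by
      intro u hu v hv huv heq
      have := hcL v (by simp [hv])
      unfold preL at this
      rw [Finset.mem_sdiff] at this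
      exact this.2 (Finset.mem_image.2 ⟨u, mem_nb.2 ⟨hu, huv.symm⟩, heq.symm⟩)
    intro u _ v _ huv
    by_cases hu : u ∈ D <;> by_cases hv : v ∈ D <;> simp only [hu, hv, if_true, if_false]
    · exact h0 u hu v hv huv
    · exact (hside u hu v hv huv).symm
    · exact hside v hv u hu huv.symm
    · exact hc u (by simp [hu]) v (by simp [hv]) huv
  · intro v hv
    simp [hv]

section PreBad
variable [Fintype V] {G : SimpleGraph V} {k : ℕ} {D : Finset V} {c0 : V → Fin k} {B : Finset V}

lemma PreBad.deg (h : PreBad G D c0 B) (hreg : ∀ v, (nb G Finset.univ v).card = k) {b : V}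
    (hb : b ∈ B) : (nb G B b).card + (nb G D b).card = k := by
  rw [← hreg b, ← Finset.card_union_of_disjoint]
  · congr 1
    ext x
    simp only [Finset.mem_union, mem_nb, Finset.mem_univ, true_and]
    have := h.closed b hb x
    tauto
  · rw [Finset.disjoint_left]
    intro x hx hx'
    exact h.disj x (mem_nb.1 hx).1 (mem_nb.1 hx').1

lemma PreBad.inj (h : PreBad G D c0 B) (hreg : ∀ v, (nb G Finset.univ v).card = k) {b : V}
    (hb : b ∈ B) : ∀ u ∈ D, ∀ u' ∈ D, G.Adj b u → G.Adj b u' → c0 u = c0 u' → u = u' := by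
  have h1 := h.bad.eq b hb
  have h2 := h.deg hreg hb
  unfold preL at h1
  rw [Finset.card_sdiff_of_subset (Finset.subset_univ _), Finset.card_univ, Fintype.card_fin] at h1
  have e1 : ((nb G D b).image c0).card ≤ (nb G D b).card := Finset.card_image_le
  have h3 : Set.InjOn c0 (nb G D b : Set V) := by
    rw [← Finset.card_image_iff]
    omega
  intro u hu u' hu' hbu hbu' heq
  exact h3 (by simpa [mem_nb] using ⟨hu, hbu⟩) (by simpa [mem_nb] using ⟨hu', hbu'⟩) heq

lemma PreBad.clique (h : PreBad G D c0 B) {b : V}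
    (hb : b ∈ NC G B) (h3 : 3 ≤ (nb G B b).card) :
    ∀ c ∈ nb G B b, ∀ c' ∈ nb G B b, c ≠ c' → G.Adj c c' :=
  claimG _ B _ rfl h.bad b hb h3

lemma PreBad.mem_L (_h : PreBad G D c0 B) {b : V} {i : Fin k} : i ∈ preL G D c0 b ↔ ∀ u ∈ D, G.Adj b u → c0 u ≠ i := by
  unfold preL
  simp only [Finset.mem_sdiff, Finset.mem_univ, true_and, Finset.mem_image, mem_nb]
  constructor
  · intro h u hu hbu heq
    exact h ⟨u, ⟨hu, hbu⟩, heq⟩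
  · rintro h ⟨u, ⟨hu, hbu⟩, heq⟩
    exact h u hu hbu heq

end PreBad

end part4

section part5

/-! ## Labels of pairs of vertices at distance two -/

def D2 (G : SimpleGraph V) (a b : V) : Prop := a ≠ b ∧ ¬ G.Adj a b ∧ ∃ x, G.Adj x a ∧ G.Adj x b

lemma D2.symm {G : SimpleGraph V} {a b : V} (h : D2 G a b) : D2 G b a := by
  obtain ⟨h1, h2, x, h3, h4⟩ := h
  exact ⟨h1.symm, fun h => h2 h.symm, x, h4, h3⟩

/-- `G` is a regular, 3-connected graph, and `Φ` is a non-constant Kempe-invariant. -/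
structure Ctx [Fintype V] (G : SimpleGraph V) (k : ℕ) (Φ : (V → Fin k) → Bool) : Prop where
  hk : 3 ≤ k
  reg : ∀ v, (nb G Finset.univ v).card = k
  c3 : ∀ a b, Conn G (Finset.univ \ {a, b})
  inv : ∀ c c', ProperOn G Finset.univ c → ProperOn G Finset.univ c' →
    KE G Finset.univ c c' → Φ c = Φ c'
  ex : ∀ i, ∃ c, ProperOn G Finset.univ c ∧ Φ c = i

lemma merge_KE [Fintype V] {G : SimpleGraph V} {k : ℕ} (hk : 3 ≤ k)
    (hreg : ∀ v, (nb G Finset.univ v).card = k) {a b : V}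
    (hc3 : Conn G (Finset.univ \ {a, b})) (hab : D2 G a b) {c c' : V → Fin k}
    (hc : ProperOn G Finset.univ c) (hc' : ProperOn G Finset.univ c') (h : c a = c b)
    (h' : c' a = c' b) : KE G Finset.univ c c' := by
  obtain ⟨hne, hnadj, x, hxa, hxb⟩ := hab
  let H : SimpleGraph V := SimpleGraph.fromRel (fun p q => G.Adj p q ∨ (p = a ∧ G.Adj b q))
  let f : V → V := fun v => if v = b then a else v
  have hHadj : ∀ p q, H.Adj p q ↔ p ≠ q ∧ (G.Adj p q ∨ (p = a ∧ G.Adj b q) ∨ (q = a ∧ G.Adj b p)) := by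
    intro p q
    simp only [H, SimpleGraph.fromRel_adj]
    constructor
    · rintro ⟨h1, (h | h) | (h | h)⟩
      · exact ⟨h1, Or.inl h⟩
      · exact ⟨h1, Or.inr (Or.inl h)⟩
      · exact ⟨h1, Or.inl h.symm⟩
      · exact ⟨h1, Or.inr (Or.inr h)⟩
    · rintro ⟨h1, h | h | h⟩
      · exact ⟨h1, Or.inl (Or.inl h)⟩
      · exact ⟨h1, Or.inl (Or.inr h)⟩
      · exact ⟨h1, Or.inr (Or.inr h)⟩
  have hprop : ∀ c : V → Fin k, ProperOn G Finset.univ c → c a = c b →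
      ProperOn H (Finset.univ.erase b) c := by
    intro c hc hcab p _ q _ hpq
    rw [hHadj] at hpq
    rcases hpq.2 with h1 | ⟨h1, h2⟩ | ⟨h1, h2⟩
    · exact hc p (by simp) q (by simp) h1
    · rw [h1, hcab]; exact hc b (by simp) q (by simp) h2
    · rw [h1, hcab]; exact (hc b (by simp) p (by simp) h2).symm
  have hcf : ∀ c : V → Fin k, c a = c b → c ∘ f = c := by
    intro c hcab
    funext v
    simp only [f, Function.comp]
    split_ifs with hv
    · rw [hv, hcab]
    · rfl
  have hnb : ∀ T : Finset V, T ⊆ Finset.univ.erase b → ∀ v, v ≠ a → v ≠ b → ∀ N : Finset V,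
      N ⊆ nb G Finset.univ v → (∀ y, G.Adj v y → y ∉ N → f y ∈ N.image f ∨ f y ∉ T) →
      (nb H T v).card ≤ N.card := by
    intro T hT v hva hvb N hN hall
    refine (Finset.card_le_card ?_).trans (Finset.card_image_le (s := N) (f := f))
    intro w hw
    obtain ⟨hwT, hw⟩ := mem_nb.1 hw
    rw [hHadj] at hw
    have hwb : w ≠ b := Finset.ne_of_mem_erase (hT hwT)
    have : ∃ y, G.Adj v y ∧ f y = w := by
      rcases hw.2 with h1 | ⟨h1, h2⟩ | ⟨h1, h2⟩
      · exact ⟨w, h1, by simp [f, hwb]⟩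
      · exact absurd h1 hva
      · exact ⟨b, h2.symm, by simp [f, h1]⟩
    obtain ⟨y, hy, rfl⟩ := this
    by_cases hyN : y ∈ N
    · exact Finset.mem_image_of_mem f hyN
    · rcases hall y hy hyN with h | h
      · exact h
      · exact absurd hwT h
  have hdegen : ∀ T ⊆ Finset.univ.erase b, T.Nonempty → ∃ t ∈ T, (nb H T t).card < k := by
    intro T hT hTne
    have hpos : 0 < k := by omega
    by_cases hTa : T ⊆ {a}
    · obtain ⟨t, ht⟩ := hTne
      refine ⟨t, ht, ?_⟩
      have : nb H T t = ∅ := by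
        rw [Finset.eq_empty_iff_forall_notMem]
        intro w hw
        obtain ⟨hwT, hw⟩ := mem_nb.1 hw
        apply hw.ne
        rw [Finset.mem_singleton.1 (hTa ht), Finset.mem_singleton.1 (hTa hwT)]
      rw [this]
      simpa using hpos
    have hTb : ∀ t ∈ T, t ≠ b := fun t ht => Finset.ne_of_mem_erase (hT ht)
    obtain ⟨u, hu, hua, N, hN, hNc, hall⟩ : ∃ u ∈ T, u ≠ a ∧ ∃ N : Finset V, N ⊆ nb G Finset.univ u ∧
        N.card < k ∧ (∀ y, G.Adj u y → y ∉ N → f y ∈ N.image f ∨ f y ∉ T) := by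
      by_cases hTR : T.erase a = Finset.univ \ {a, b}
      · have hx : x ∈ T.erase a := by
          rw [hTR]; simp [hxa.ne, hxb.ne]
        refine ⟨x, Finset.mem_of_mem_erase hx, hxa.ne, (nb G Finset.univ x).erase b,
          Finset.erase_subset _ _, ?_, ?_⟩
        · rw [Finset.card_erase_of_mem (mem_nb.2 ⟨by simp, hxb⟩), hreg]; omega
        · intro y hy hyN
          left
          have hyb : y = b := by
            by_contra hyb
            exact hyN (Finset.mem_erase.2 ⟨hyb, mem_nb.2 ⟨by simp, hy⟩⟩)
          refine Finset.mem_image.2 ⟨a, Finset.mem_erase.2 ⟨hne, mem_nb.2 ⟨by simp, hxa⟩⟩, ?_⟩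
          simp [f, hyb]
      · obtain ⟨u, hu, v, hv, hvT, huv⟩ := hc3.exists_adj (T := T.erase a) (by
          intro t ht
          have := hTb t (Finset.mem_of_mem_erase ht)
          have := Finset.ne_of_mem_erase ht
          simp [*]) (by
          by_contra hcon
          rw [Finset.not_nonempty_iff_eq_empty, Finset.erase_eq_empty_iff] at hcon
          rcases hcon with h | h
          · exact hTne.ne_empty h
          · exact hTa (by rw [h])) hTR
        have hv' : v ≠ a ∧ v ≠ b := by simpa using hv
        refine ⟨u, Finset.mem_of_mem_erase hu, Finset.ne_of_mem_erase hu,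
          (nb G Finset.univ u).erase v, Finset.erase_subset _ _, ?_, ?_⟩
        · rw [Finset.card_erase_of_mem (mem_nb.2 ⟨by simp, huv⟩), hreg]; omega
        · intro y hy hyN
          right
          have hyb : y = v := by
            by_contra hyb
            exact hyN (Finset.mem_erase.2 ⟨hyb, mem_nb.2 ⟨by simp, hy⟩⟩)
          subst hyb
          simp only [f, hv'.2, if_false]
          exact fun h => hvT (Finset.mem_erase.2 ⟨hv'.1, h⟩)
    exact ⟨u, hu, lt_of_le_of_lt (hnb T hT u hua (hTb u hu) N hN hall) hNc⟩
  have := (KE_of_degenerate hdegen c c' (hprop c hc h) (hprop c' hc' h')).pull (G := G)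
    (S := Finset.univ) f (by
      intro v _
      simp only [f]
      split_ifs with hv
      · simp [hne]
      · simp [hv]) (by
      intro p _ q _ hpq
      rw [hHadj]
      simp only [f]
      split_ifs with h1 h2 h2
      · subst h1; subst h2; exact absurd hpq (G.loopless.irrefl _)
      · subst h1
        refine ⟨?_, Or.inr (Or.inl ⟨rfl, hpq⟩)⟩
        rintro rfl
        exact hnadj hpq.symm
      · subst h2
        refine ⟨?_, Or.inr (Or.inr ⟨rfl, hpq.symm⟩)⟩
        rintro rfl
        exact hnadj hpq
      · exact ⟨hpq.ne, Or.inl hpq⟩)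
  rwa [hcf c h, hcf c' h'] at this

lemma nb_clique_insert {G : SimpleGraph V} {B : Finset V} {b : V}
    (h : ∀ c ∈ nb G B b, ∀ c' ∈ nb G B b, c ≠ c' → G.Adj c c') :
    ∀ u ∈ insert b (nb G B b), ∀ v ∈ insert b (nb G B b), u ≠ v → G.Adj u v := by
  intro u hu v hv huv
  rw [Finset.mem_insert] at hu hv
  rcases hu with rfl | hu <;> rcases hv with rfl | hv
  · exact absurd rfl huv
  · exact (mem_nb.1 hv).2
  · exact (mem_nb.1 hu).2.symm
  · exact h u hu v hv huv

lemma card_insert_nb {G : SimpleGraph V} {B : Finset V} {b : V} : (insert b (nb G B b)).card = (nb G B b).card + 1 := by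
  rw [Finset.card_insert_of_notMem]
  intro h
  exact G.loopless.irrefl _ (mem_nb.1 h).2

lemma nb_pair_le_one {G : SimpleGraph V} {b s t : V} (hst : ¬ (G.Adj b s ∧ G.Adj b t)) :
    (nb G {s, t} b).card ≤ 1 := by
  rw [Finset.card_le_one]
  intro u hu v hv
  simp only [mem_nb, Finset.mem_insert, Finset.mem_singleton] at hu hv
  rcases hu with ⟨rfl | rfl, hu⟩ <;> rcases hv with ⟨rfl | rfl, hv⟩
  · rfl
  · exact absurd ⟨hu, hv⟩ hst
  · exact absurd ⟨hv, hu⟩ hst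
  · rfl

lemma nb_split {G : SimpleGraph V} (p p' q q' b : V) :
    nb G {p, p', q, q'} b = nb G {p, p'} b ∪ nb G {q, q'} b := by
  ext x
  simp only [Finset.mem_union, mem_nb, Finset.mem_insert, Finset.mem_singleton]
  tauto

lemma nb_pair_zero {G : SimpleGraph V} {b s t : V} (hst : ¬ (G.Adj b s ∨ G.Adj b t)) :
    (nb G {s, t} b).card = 0 := by
  rw [Finset.card_eq_zero, Finset.eq_empty_iff_forall_notMem]
  intro u hu
  simp only [mem_nb, Finset.mem_insert, Finset.mem_singleton] at hu
  rcases hu with ⟨rfl | rfl, hu⟩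
  · exact hst (Or.inl hu)
  · exact hst (Or.inr hu)

noncomputable def lab [Fintype V] (G : SimpleGraph V) {k : ℕ} (Φ : (V → Fin k) → Bool) (a b : V) : Bool :=
  decide (∃ c, ProperOn G Finset.univ c ∧ Φ c = true ∧ c a = c b)

section ctx
variable [Fintype V] {G : SimpleGraph V} {k : ℕ} {Φ : (V → Fin k) → Bool}

lemma lab_comm (a b : V) : lab G Φ a b = lab G Φ b a := by
  unfold lab
  congr 1
  simp only [eq_comm]

lemma Ctx.col (h : Ctx G k Φ) {a b : V} (hab : D2 G a b) {c : V → Fin k}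
    (hc : ProperOn G Finset.univ c) (hcab : c a = c b) : lab G Φ a b = Φ c := by
  unfold lab
  cases hΦ : Φ c with
  | true =>
    rw [decide_eq_true_eq]
    exact ⟨c, hc, hΦ, hcab⟩
  | false =>
    rw [decide_eq_false_iff_not]
    rintro ⟨c', hc', hΦ', hcab'⟩
    have := h.inv c c' hc hc' (merge_KE h.hk h.reg (h.c3 a b) hab hc hc' hcab hcab')
    rw [hΦ, hΦ'] at this
    exact absurd this (by decide)

lemma Ctx.nbhd (h : Ctx G k Φ) (x : V) (i : Bool) :
    ∃ a b, G.Adj x a ∧ G.Adj x b ∧ a ≠ b ∧ ¬ G.Adj a b ∧ lab G Φ a b = i ∧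
      ∃ c : V → Fin k, ProperOn G Finset.univ c ∧ c a = c b := by
  obtain ⟨c, hc, hΦ⟩ := h.ex i
  obtain ⟨a, ha, b, hb, hne, hcab⟩ := Finset.exists_ne_map_eq_of_card_lt_of_maps_to
    (s := nb G Finset.univ x) (t := Finset.univ.erase (c x)) (f := c) (by
      rw [h.reg, Finset.card_erase_of_mem (by simp), Finset.card_univ, Fintype.card_fin]
      have := h.hk
      omega) (by
      intro a ha
      have ha' := (mem_nb.1 (Finset.mem_coe.1 ha)).2
      simp only [Finset.coe_erase, Finset.coe_univ, Set.mem_sdiff, Set.mem_univ, true_and,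
        Set.mem_singleton_iff]
      exact (hc x (by simp) a (by simp) ha').symm)
  have ha' := (mem_nb.1 ha).2
  have hb' := (mem_nb.1 hb).2
  have hnadj : ¬ G.Adj a b := fun hadj => hc a (by simp) b (by simp) hadj hcab
  exact ⟨a, b, ha', hb', hne, hnadj, (h.col ⟨hne, hnadj, x, ha', hb'⟩ hc hcab).trans hΦ, c, hc, hcab⟩

/-- no `K_k` -/
def KFree (G : SimpleGraph V) (k : ℕ) : Prop :=
  ∀ K : Finset V, (∀ u ∈ K, ∀ v ∈ K, u ≠ v → G.Adj u v) → K.card < k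

lemma PreBad.ncdeg {D B : Finset V} {c0 : V → Fin k} (h : PreBad G D c0 B) (hkf : KFree G k)
    (hk : 4 ≤ k) {b : V} (hb : b ∈ NC G B) : (nb G B b).card ≤ k - 2 := by
  by_contra hcon
  have h3 : 3 ≤ (nb G B b).card := by omega
  have := hkf _ (nb_clique_insert (h.clique hb h3))
  rw [card_insert_nb] at this
  omega

lemma lemmaI (h : Ctx G k Φ) (hkf : KFree G k) (hk : 4 ≤ k) (S : Finset V)
    (hS : ∀ u ∈ S, ∀ v ∈ S, ¬ G.Adj u v) :
    ∃ c : V → Fin k, ProperOn G Finset.univ c ∧ ∀ u ∈ S, ∀ v ∈ S, c u = c v := by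
  by_contra hcon
  have hpos : 0 < k := by omega
  let c0 : V → Fin k := fun _ => ⟨0, hpos⟩
  obtain ⟨B, hB⟩ := pre hpos h.reg S c0 (fun u hu v hv huv => absurd huv (hS u hu v hv)) (by
    rintro ⟨c, hc, hcS⟩
    exact hcon ⟨c, hc, fun u hu v hv => by rw [hcS u hu, hcS v hv]⟩)
  have hle : ∀ b ∈ B, (nb G S b).card ≤ 1 := by
    intro b hb
    rw [Finset.card_le_one]
    intro u hu v hv
    have hu := mem_nb.1 hu
    have hv := mem_nb.1 hv
    exact hB.inj h.reg hb u hu.1 v hv.1 hu.2 hv.2 rfl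
  have h2 : 2 ≤ B.card := by
    obtain ⟨b, hb⟩ := hB.bad.conn.1
    have := hB.deg h.reg hb
    have := hle b hb
    have : (nb G B b).card ≤ B.card := Finset.card_le_card (Finset.filter_subset _ _)
    omega
  obtain ⟨b, hb⟩ := nc_nonempty hB.bad.conn h2
  have e1 := hB.ncdeg hkf hk hb
  have e2 := hB.deg h.reg (mem_NC.1 hb).1
  have e3 := hle b (mem_NC.1 hb).1
  omega

lemma Ctx.lab_indep (h : Ctx G k Φ) (hkf : KFree G k) (hk : 4 ≤ k) (S : Finset V)
    (hS : ∀ u ∈ S, ∀ v ∈ S, ¬ G.Adj u v) {a b c d : V} (ha : a ∈ S) (hb : b ∈ S) (hc : c ∈ S)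
    (hd : d ∈ S) (hab : D2 G a b) (hcd : D2 G c d) : lab G Φ a b = lab G Φ c d := by
  obtain ⟨f, hf, hfS⟩ := lemmaI h hkf hk S hS
  rw [h.col hab hf (hfS a ha b hb), h.col hcd hf (hfS c hc d hd)]

/-- The obstruction obtained from two pairs with different labels. -/
structure PB (G : SimpleGraph V) (k : ℕ) (p p' q q' : V) (B : Finset V) : Prop where
  disj : ∀ b ∈ B, b ≠ p ∧ b ≠ p' ∧ b ≠ q ∧ b ≠ q'
  closed : ∀ b ∈ B, ∀ v, G.Adj b v → v = p ∨ v = p' ∨ v = q ∨ v = q' ∨ v ∈ B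
  conn : Conn G B
  np : ∀ b ∈ B, ¬ (G.Adj b p ∧ G.Adj b p')
  nq : ∀ b ∈ B, ¬ (G.Adj b q ∧ G.Adj b q')
  ncp : ∀ b ∈ NC G B, G.Adj b p ∨ G.Adj b p'
  ncq : ∀ b ∈ NC G B, G.Adj b q ∨ G.Adj b q'
  ncdeg : ∀ b ∈ NC G B, (nb G B b).card = k - 2
  deg : ∀ b ∈ B, (nb G B b).card + (nb G {p, p', q, q'} b).card = k
  clique : 5 ≤ k → ∀ b ∈ NC G B, ∀ c ∈ nb G B b, ∀ c' ∈ nb G B b, c ≠ c' → G.Adj c c'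
  ncard : k - 1 ≤ (NC G B).card

lemma pairBad (h : Ctx G k Φ) (hkf : KFree G k) (hk : 4 ≤ k) {p p' q q' : V}
    (hp : D2 G p p') (hq : D2 G q q') (hl : lab G Φ p p' ≠ lab G Φ q q')
    (h1 : p ≠ q) (h2 : p ≠ q') (h3 : p' ≠ q) (h4 : p' ≠ q') : ∃ B, PB G k p p' q q' B := by
  have hpos : 0 < k := by omega
  let i0 : Fin k := ⟨0, hpos⟩
  let i1 : Fin k := ⟨1, by omega⟩
  have hi : i0 ≠ i1 := by simp [i0, i1]
  let c0 : V → Fin k := fun v => if v = p ∨ v = p' then i0 else i1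
  have cp : c0 p = i0 := by simp [c0]
  have cp' : c0 p' = i0 := by simp [c0]
  have cq : c0 q = i1 := by simp [c0, h1.symm, h3.symm]
  have cq' : c0 q' = i1 := by simp [c0, h2.symm, h4.symm]
  have hmem : ∀ v, v ∈ ({p, p', q, q'} : Finset V) ↔ v = p ∨ v = p' ∨ v = q ∨ v = q' := by simp
  obtain ⟨B, hB⟩ := pre hpos h.reg {p, p', q, q'} c0 (by
    intro u hu v hv huv
    rw [hmem] at hu hv
    have a1 := hp.2.1
    have a2 := hq.2.1
    have a3 := fun h : G.Adj p' p => hp.2.1 h.symm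
    have a4 := fun h : G.Adj q' q => hq.2.1 h.symm
    have a5 : ∀ x, ¬ G.Adj x x := fun x => G.loopless.irrefl x
    rcases hu with rfl | rfl | rfl | rfl <;> rcases hv with rfl | rfl | rfl | rfl <;>
      first
      | exact absurd huv (a5 _)
      | exact absurd huv a1
      | exact absurd huv a2
      | exact absurd huv a3
      | exact absurd huv a4
      | (simp only [cp, cp', cq, cq']; first | exact hi | exact hi.symm)) (by
    rintro ⟨c, hc, hcS⟩
    apply hl
    rw [h.col hp hc, h.col hq hc]
    · rw [hcS q (by simp), hcS q' (by simp), cq, cq']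
    · rw [hcS p (by simp), hcS p' (by simp), cp, cp'])
  have hnp : ∀ b ∈ B, ¬ (G.Adj b p ∧ G.Adj b p') := fun b hb ⟨e1, e2⟩ =>
    hp.1 (hB.inj h.reg hb p (by simp) p' (by simp) e1 e2 (by rw [cp, cp']))
  have hnq : ∀ b ∈ B, ¬ (G.Adj b q ∧ G.Adj b q') := fun b hb ⟨e1, e2⟩ =>
    hq.1 (hB.inj h.reg hb q (by simp) q' (by simp) e1 e2 (by rw [cq, cq']))
  have hdeg := fun b hb => hB.deg h.reg (b := b) hb
  have hcu : ∀ b, (nb G {p, p', q, q'} b).card ≤ (nb G {p, p'} b).card + (nb G {q, q'} b).card := by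
    intro b
    rw [nb_split]
    exact Finset.card_union_le _ _
  have hge : ∀ b ∈ B, k - 2 ≤ (nb G B b).card := by
    intro b hb
    have := hdeg b hb
    have := hcu b
    have := nb_pair_le_one (hnp b hb)
    have := nb_pair_le_one (hnq b hb)
    omega
  have hncdeg : ∀ b ∈ NC G B, (nb G B b).card = k - 2 := fun b hb =>
    le_antisymm (hB.ncdeg hkf hk hb) (hge b (mem_NC.1 hb).1)
  refine ⟨B, ?_, ?_, hB.bad.conn, hnp, hnq, ?_, ?_, hncdeg, hdeg, ?_, ?_⟩
  · intro b hb
    have := hB.disj b hb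
    rw [hmem] at this
    push Not at this
    exact this
  · intro b hb v hbv
    by_contra hcon
    push Not at hcon
    have := hB.closed b hb v hbv
    rw [hmem] at this
    exact hcon.2.2.2.2 (this (by
      push Not
      exact ⟨hcon.1, hcon.2.1, hcon.2.2.1, hcon.2.2.2.1⟩))
  · intro b hb
    by_contra hcon
    have := nb_pair_zero hcon
    have := hdeg b (mem_NC.1 hb).1
    have := hcu b
    have := nb_pair_le_one (hnq b (mem_NC.1 hb).1)
    have := hncdeg b hb
    omega
  · intro b hb
    by_contra hcon
    have := nb_pair_zero hcon
    have := hdeg b (mem_NC.1 hb).1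
    have := hcu b
    have := nb_pair_le_one (hnp b (mem_NC.1 hb).1)
    have := hncdeg b hb
    omega
  · intro hk5 b hb
    exact hB.clique hb (by rw [hncdeg b hb]; omega)
  · have h2 : 2 ≤ B.card := by
      obtain ⟨b, hb⟩ := hB.bad.conn.1
      have := hge b hb
      have : (nb G B b).card ≤ B.card := Finset.card_le_card (Finset.filter_subset _ _)
      omega
    obtain ⟨b, hb⟩ := nc_nonempty hB.bad.conn h2
    have := nc_card hB.bad.conn hb
    rw [hncdeg b hb] at this
    omega

end ctx

end part5

section part6

/-! ## `k ≥ 4` and a clique of size `k` -/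

section clique
variable [Fintype V] {G : SimpleGraph V} {k : ℕ} {Φ : (V → Fin k) → Bool}

lemma clique_outer (hreg : ∀ v, (nb G Finset.univ v).card = k) {K : Finset V} (hKc : K.card = k)
    (hK : ∀ u ∈ K, ∀ v ∈ K, u ≠ v → G.Adj u v) (hk : 1 ≤ k) :
    ∃ u : V → V, ∀ y ∈ K, G.Adj y (u y) ∧ u y ∉ K ∧ ∀ w, G.Adj y w → w ∈ K ∨ w = u y := by
  have : ∀ y : V, ∃ u, y ∈ K → G.Adj y u ∧ u ∉ K ∧ ∀ w, G.Adj y w → w ∈ K ∨ w = u := by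
    intro y
    by_cases hy : y ∈ K
    swap
    · exact ⟨y, fun h => absurd h hy⟩
    have h1 : (nb G Finset.univ y \ K.erase y).card = 1 := by
      rw [Finset.card_sdiff_of_subset, hreg, Finset.card_erase_of_mem hy, hKc]
      · omega
      · intro w hw
        rw [Finset.mem_erase] at hw
        exact mem_nb.2 ⟨by simp, hK y hy w hw.2 hw.1.symm⟩
    obtain ⟨u, hu⟩ := Finset.card_eq_one.1 h1
    refine ⟨u, fun _ => ?_⟩
    have hu1 : u ∈ nb G Finset.univ y \ K.erase y := by rw [hu]; simp
    rw [Finset.mem_sdiff, mem_nb, Finset.mem_erase] at hu1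
    refine ⟨hu1.1.2, fun h => hu1.2 ⟨hu1.1.2.ne', h⟩, fun w hw => ?_⟩
    by_cases hwK : w ∈ K
    · exact Or.inl hwK
    · right
      have : w ∈ nb G Finset.univ y \ K.erase y := by
        rw [Finset.mem_sdiff, mem_nb, Finset.mem_erase]
        exact ⟨⟨by simp, hw⟩, fun h => hwK h.2⟩
      rw [hu] at this
      simpa using this
  choose u hu using this
  exact ⟨u, hu⟩

/-- swapping the colours of two vertices of a clique -/
lemma swapK (h : Ctx G k Φ) {K : Finset V} 
    (hK : ∀ u ∈ K, ∀ v ∈ K, u ≠ v → G.Adj u v) {u : V → V}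
    (hu : ∀ y ∈ K, G.Adj y (u y) ∧ u y ∉ K ∧ ∀ w, G.Adj y w → w ∈ K ∨ w = u y)
    {c : V → Fin k} (hc : ProperOn G Finset.univ c) {l m : V} (hl : l ∈ K) (hm : m ∈ K)
    (hlm : l ≠ m) (h1 : c m ≠ c (u l)) (h2 : c l ≠ c (u m)) :
    ∃ c' : V → Fin k, ProperOn G Finset.univ c' ∧ Φ c' = Φ c ∧ c' l = c m ∧ c' m = c l ∧
      ∀ v, v ≠ l → v ≠ m → c' v = c v := by
  let c' : V → Fin k := fun v => if v = l then c m else if v = m then c l else c v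
  have e1 : c' l = c m := by simp [c']
  have e2 : c' m = c l := by simp [c', hlm.symm]
  have e3 : ∀ v, v ≠ l → v ≠ m → c' v = c v := by
    intro v h1 h2
    simp [c', h1, h2]
  have side : ∀ v, v ≠ l → v ≠ m → (G.Adj l v → c' v ≠ c m) ∧ (G.Adj m v → c' v ≠ c l) := by
    intro v hvl hvm
    rw [e3 v hvl hvm]
    constructor
    · intro hlv
      rcases (hu l hl).2.2 v hlv with hv | rfl
      · exact hc v (by simp) m (by simp) (hK v hv m hm hvm)
      · exact h1.symm
    · intro hlv
      rcases (hu m hm).2.2 v hlv with hv | rfl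
      · exact hc v (by simp) l (by simp) (hK v hv l hl hvl)
      · exact h2.symm
  have hclm := hc l (by simp) m (by simp) (hK l hl m hm hlm)
  have hc' : ProperOn G Finset.univ c' := by
    intro x _ y _ hxy
    by_cases hxl : x = l
    · subst hxl
      by_cases hym : y = m
      · subst hym
        rw [e1, e2]
        exact hclm.symm
      · rw [e1]
        exact ((side y hxy.ne' hym).1 hxy).symm
    by_cases hxm : x = m
    · subst hxm
      by_cases hyl : y = l
      · subst hyl
        rw [e1, e2]
        exact hclm
      · rw [e2]
        exact ((side y hyl hxy.ne').2 hxy).symm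
    by_cases hyl : y = l
    · subst hyl
      rw [e1]
      exact (side x hxl hxm).1 hxy.symm
    by_cases hym : y = m
    · subst hym
      rw [e2]
      exact (side x hxl hxm).2 hxy.symm
    rw [e3 x hxl hxm, e3 y hyl hym]
    exact hc x (by simp) y (by simp) hxy
  refine ⟨c', hc', ?_, e1, e2, e3⟩
  refine (h.inv c c' hc hc' (KS.ke ⟨hc, hc', c l, c m, fun v _ => ?_⟩)).symm
  by_cases hvl : v = l
  · subst hvl; right; simp [e1]
  by_cases hvm : v = m
  · subst hvm; right; simp [e2]
  exact Or.inl (e3 v hvl hvm)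

lemma cliqueK_label (h : Ctx G k Φ) (hk : 4 ≤ k) {K : Finset V} (hKc : K.card = k)
    (hK : ∀ u ∈ K, ∀ v ∈ K, u ≠ v → G.Adj u v) {u : V → V}
    (hu : ∀ y ∈ K, G.Adj y (u y) ∧ u y ∉ K ∧ ∀ w, G.Adj y w → w ∈ K ∨ w = u y)
    {c : V → Fin k} (hc : ProperOn G Finset.univ c) {x l : V} (hx : x ∈ K) (hl : l ∈ K)
    (hxl : c (u l) ≠ c (u x)) : lab G Φ (u x) l = Φ c := by
  have hne : l ≠ x := fun h => hxl (by rw [h])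
  have hD2 : D2 G (u x) l := by
    refine ⟨fun h => (hu x hx).2.1 (h ▸ hl), fun hadj => ?_, x, (hu x hx).1, hK x hx l hl hne.symm⟩
    rcases (hu l hl).2.2 _ hadj.symm with h | h
    · exact (hu x hx).2.1 h
    · exact hxl (by rw [h])
  suffices ∃ c' : V → Fin k, ProperOn G Finset.univ c' ∧ Φ c' = Φ c ∧ c' (u x) = c' l by
    obtain ⟨c', h1, h2, h3⟩ := this
    rw [← h2]
    exact h.col hD2 h1 h3
  have hinj : ∀ y ∈ K, ∀ z ∈ K, y ≠ z → c y ≠ c z := fun y hy z hz hyz =>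
    hc y (by simp) z (by simp) (hK y hy z hz hyz)
  have hout : ∀ y ∈ K, c y ≠ c (u y) := fun y hy => hc y (by simp) _ (by simp) (hu y hy).1
  have hsurj : ∀ i, ∃ y ∈ K, c y = i := by
    have : K.image c = Finset.univ := by
      apply Finset.eq_univ_of_card
      rw [Finset.card_image_of_injOn, hKc, Fintype.card_fin]
      intro y hy z hz hyz
      by_contra hcon
      exact hinj y hy z hz hcon hyz
    intro i
    have hi : i ∈ K.image c := by rw [this]; simp
    simpa using hi
  have huK : ∀ y ∈ K, ∀ z ∈ K, u y ≠ z := fun y hy z hz h => (hu y hy).2.1 (h ▸ hz)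
  obtain ⟨m, hm, hcm⟩ := hsurj (c (u x))
  by_cases hml : m = l
  · subst hml
    exact ⟨c, hc, rfl, hcm.symm⟩
  have hmx : m ≠ x := by
    rintro rfl
    exact hout m hm hcm
  by_cases h1 : c (u m) = c l
  swap
  · obtain ⟨c1, p1, p2, p3, p4, p5⟩ := swapK h hK hu hc hl hm (Ne.symm hml)
      (by rw [hcm]; exact hxl.symm) (Ne.symm h1)
    exact ⟨c1, p1, p2, by rw [p3, p5 _ (huK x hx l hl) (huK x hx m hm), hcm]⟩
  by_cases h2 : c (u l) = c x
  swap
  · obtain ⟨c1, p1, p2, p3, p4, p5⟩ := swapK h hK hu hc hl hx hne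
      (Ne.symm h2) (by rw [← hcm]; exact hinj l hl m hm (Ne.symm hml))
    have q1 : ∀ y ∈ K, c1 (u y) = c (u y) := fun y hy => p5 _ (huK y hy l hl) (huK y hy x hx)
    have q2 : c1 m = c m := p5 m hml hmx
    obtain ⟨c2, r1, r2, r3, r4, r5⟩ := swapK h hK hu p1 hl hm (Ne.symm hml)
      (by rw [q1 l hl, q2, hcm]; exact hxl.symm)
      (by rw [q1 m hm, p3, h1]; exact hinj x hx l hl hne.symm)
    exact ⟨c2, r1, r2.trans p2, by
      rw [r3, r5 _ (huK x hx l hl) (huK x hx m hm), q1 x hx, q2, hcm]⟩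
  by_cases h3 : ∃ z ∈ K, z ≠ x ∧ z ≠ l ∧ z ≠ m ∧ c (u z) ≠ c l
  · obtain ⟨z, hz, hzx, hzl, hzm, hcz⟩ := h3
    obtain ⟨c1, p1, p2, p3, p4, p5⟩ := swapK h hK hu hc hl hz (Ne.symm hzl)
      (by rw [h2]; exact hinj z hz x hx hzx) hcz.symm
    have q1 : ∀ y ∈ K, c1 (u y) = c (u y) := fun y hy => p5 _ (huK y hy l hl) (huK y hy z hz)
    have q2 : c1 m = c m := p5 m hml hzm.symm
    obtain ⟨c2, r1, r2, r3, r4, r5⟩ := swapK h hK hu p1 hl hm (Ne.symm hml)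
      (by rw [q1 l hl, q2, hcm]; exact hxl.symm)
      (by rw [q1 m hm, p3, h1]; exact hinj z hz l hl hzl)
    exact ⟨c2, r1, r2.trans p2, by
      rw [r3, r5 _ (huK x hx l hl) (huK x hx m hm), q1 x hx, q2, hcm]⟩
  push Not at h3
  obtain ⟨z, hz, hzn⟩ : ∃ z ∈ K, z ∉ ({x, l, m} : Finset V) := by
    by_contra hcon
    push Not at hcon
    have : K ⊆ {x, l, m} := hcon
    have := Finset.card_le_card this
    have := Finset.card_le_three (a := x) (b := l) (c := m)
    omega
  simp only [Finset.mem_insert, Finset.mem_singleton, not_or] at hzn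
  obtain ⟨hzx, hzl, hzm⟩ := hzn
  have hcz := h3 z hz hzx hzl hzm
  obtain ⟨c1, p1, p2, p3, p4, p5⟩ := swapK h hK hu hc hx hz (Ne.symm hzx)
      (by rw [← hcm]; exact hinj z hz m hm hzm) (by rw [hcz]; exact hinj x hx l hl hne.symm)
  have q1 : ∀ y ∈ K, c1 (u y) = c (u y) := fun y hy => p5 _ (huK y hy x hx) (huK y hy z hz)
  have q2 : c1 m = c m := p5 m hmx (Ne.symm hzm)
  have q3 : c1 l = c l := p5 l hne (Ne.symm hzl)
  obtain ⟨c2, r1, r2, r3, r4, r5⟩ := swapK h hK hu p1 hl hx hne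
    (by rw [q1 l hl, p3, h2]; exact hinj z hz x hx hzx)
    (by rw [q1 x hx, q3, ← hcm]; exact hinj l hl m hm (Ne.symm hml))
  have s1 : ∀ y ∈ K, c2 (u y) = c (u y) := fun y hy => 
    (r5 _ (huK y hy l hl) (huK y hy x hx)).trans (q1 y hy)
  have s2 : c2 m = c m := (r5 m hml hmx).trans q2
  obtain ⟨c3, t1, t2, t3, t4, t5⟩ := swapK h hK hu r1 hl hm (Ne.symm hml)
    (by rw [s1 l hl, s2, hcm]; exact hxl.symm)
    (by rw [s1 m hm, r3, p3, h1]; exact hinj z hz l hl hzl)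
  exact ⟨c3, t1, (t2.trans r2).trans p2, by
      rw [t3, t5 _ (huK x hx l hl) (huK x hx m hm), s1 x hx, s2, hcm]⟩

lemma no_cliqueK (h : Ctx G k Φ) (hk : 4 ≤ k) {K : Finset V} (hKc : K.card = k)
    (hK : ∀ u ∈ K, ∀ v ∈ K, u ≠ v → G.Adj u v) : False := by
  obtain ⟨u, hu⟩ := clique_outer h.reg hKc hK (by omega)
  obtain ⟨c, hc, hΦ⟩ := h.ex true
  obtain ⟨d, hd, hΦ'⟩ := h.ex false
  have hnc : ∀ c : V → Fin k, ProperOn G Finset.univ c → ∀ x ∈ K, ∃ l ∈ K, c (u l) ≠ c (u x) := by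
    intro c hc x hx
    by_contra hcon
    push Not at hcon
    have : K.image c = Finset.univ := by
      apply Finset.eq_univ_of_card
      rw [Finset.card_image_of_injOn, hKc, Fintype.card_fin]
      intro y hy z hz hyz
      by_contra hcon
      exact hc y (by simp) z (by simp) (hK y hy z hz hcon) hyz
    have hi : c (u x) ∈ K.image c := by rw [this]; simp
    obtain ⟨y, hy, hyx⟩ := Finset.mem_image.1 hi
    exact hc y (by simp) _ (by simp) (hu y hy).1 (hyx.trans (hcon y hy).symm)
  have key : ∀ x ∈ K, ∀ l ∈ K, c (u l) ≠ c (u x) → d (u l) ≠ d (u x) → False := by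
    intro x hx l hl h1 h2
    have e1 := cliqueK_label h hk hKc hK hu hc hx hl h1
    have e2 := cliqueK_label h hk hKc hK hu hd hx hl h2
    rw [e1, hΦ, hΦ'] at e2
    exact absurd e2 (by decide)
  have hKne : K.Nonempty := by rw [← Finset.card_pos]; omega
  obtain ⟨x, hx⟩ := hKne
  obtain ⟨l, hl, hcl⟩ := hnc c hc x hx
  obtain ⟨y, hy, hdy⟩ := hnc d hd x hx
  have a1 : d (u l) = d (u x) := by
    by_contra hcon
    exact key x hx l hl hcl hcon
  have a2 : c (u y) = c (u x) := by
    by_contra hcon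
    exact key x hx y hy hcon hdy
  refine key y hy l hl ?_ ?_
  · rw [a2]; exact hcl
  · rw [a1]; exact hdy.symm

lemma Ctx.kfree (h : Ctx G k Φ) (hk : 4 ≤ k) : KFree G k := by
  intro K hK
  by_contra hcon
  obtain ⟨K', hK', hcard⟩ := Finset.exists_subset_card_eq (not_lt.1 hcon)
  exact no_cliqueK h hk hcard (fun u hu v hv => hK u (hK' hu) v (hK' hv))

end clique

end part6

section part7

/-! ## The case `k = 4` -/

structure N4 (G : SimpleGraph V) (x a b c d : V) : Prop where
  ab : a ≠ b
  ac : a ≠ c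
  ad : a ≠ d
  bc : b ≠ c
  bd : b ≠ d
  cd : c ≠ d
  adj : ∀ w, G.Adj x w ↔ w = a ∨ w = b ∨ w = c ∨ w = d

section four
variable {G : SimpleGraph V}

lemma N4.p1 {x a b c d : V} (h : N4 G x a b c d) : N4 G x b a c d :=
  ⟨h.ab.symm, h.bc, h.bd, h.ac, h.ad, h.cd, fun w => by rw [h.adj]; tauto⟩
lemma N4.p2 {x a b c d : V} (h : N4 G x a b c d) : N4 G x a c b d :=
  ⟨h.ac, h.ab, h.ad, h.bc.symm, h.cd, h.bd, fun w => by rw [h.adj]; tauto⟩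
lemma N4.p3 {x a b c d : V} (h : N4 G x a b c d) : N4 G x a b d c :=
  ⟨h.ab, h.ad, h.ac, h.bd, h.bc, h.cd.symm, fun w => by rw [h.adj]; tauto⟩
lemma N4.xa {x a b c d : V} (h : N4 G x a b c d) : G.Adj x a := (h.adj a).2 (by simp)
lemma N4.xb {x a b c d : V} (h : N4 G x a b c d) : G.Adj x b := (h.adj b).2 (by simp)
lemma N4.xc {x a b c d : V} (h : N4 G x a b c d) : G.Adj x c := (h.adj c).2 (by simp)
lemma N4.xd {x a b c d : V} (h : N4 G x a b c d) : G.Adj x d := (h.adj d).2 (by simp)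

lemma n4_of_sub [Fintype V] {x : V} (hreg : (nb G Finset.univ x).card = 4) (S : Finset V)
    (hS : ∀ s ∈ S, G.Adj x s) : (nb G Finset.univ x \ S).card = 4 - S.card := by
  rw [Finset.card_sdiff_of_subset, hreg]
  intro s hs
  exact mem_nb.2 ⟨by simp, hS s hs⟩

lemma n4_1 [Fintype V] {x a : V} (hreg : (nb G Finset.univ x).card = 4) (ha : G.Adj x a) :
    ∃ b c d, N4 G x a b c d := by
  have h1 := n4_of_sub hreg {a} (by simpa using ha)
  rw [Finset.card_singleton] at h1
  obtain ⟨b, c, d, hbc, hbd, hcd, heq⟩ := Finset.card_eq_three.1 h1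
  have hm : ∀ w, G.Adj x w ∧ w ≠ a ↔ w = b ∨ w = c ∨ w = d := by
    intro w
    have : w ∈ nb G Finset.univ x \ {a} ↔ w ∈ ({b, c, d} : Finset V) := by rw [heq]
    simpa [mem_nb] using this
  refine ⟨b, c, d, ?_, ?_, ?_, hbc, hbd, hcd, ?_⟩
  · exact fun h => ((hm b).2 (by simp)).2 h.symm
  · exact fun h => ((hm c).2 (by simp)).2 h.symm
  · exact fun h => ((hm d).2 (by simp)).2 h.symm
  · intro w
    have := hm w
    by_cases hw : w = a
    · subst hw; simp [ha]
    · simp only [hw, false_or, ← this]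
      tauto

lemma n4_2 [Fintype V] {x a b : V} (hreg : (nb G Finset.univ x).card = 4) (ha : G.Adj x a)
    (hb : G.Adj x b) (hab : a ≠ b) : ∃ c d, N4 G x a b c d := by
  obtain ⟨p, q, r, h⟩ := n4_1 hreg ha
  rcases (h.adj b).1 hb with rfl | rfl | rfl | rfl
  · exact absurd rfl hab
  · exact ⟨q, r, h⟩
  · exact ⟨p, r, h.p2⟩
  · exact ⟨p, q, h.p3.p2⟩

lemma n4_3 [Fintype V] {x a b c : V} (hreg : (nb G Finset.univ x).card = 4) (ha : G.Adj x a)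
    (hb : G.Adj x b) (hc : G.Adj x c) (hab : a ≠ b) (hac : a ≠ c) (hbc : b ≠ c) :
    ∃ d, N4 G x a b c d := by
  obtain ⟨p, q, h⟩ := n4_2 hreg ha hb hab
  rcases (h.adj c).1 hc with rfl | rfl | rfl | rfl
  · exact absurd rfl hac
  · exact absurd rfl hbc
  · exact ⟨q, h⟩
  · exact ⟨p, h.p3⟩

lemma n4_4 [Fintype V] {x a b c d : V} (hreg : (nb G Finset.univ x).card = 4) (ha : G.Adj x a)
    (hb : G.Adj x b) (hc : G.Adj x c) (hd : G.Adj x d) (hab : a ≠ b) (hac : a ≠ c) (hbc : b ≠ c)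
    (had : a ≠ d) (hbd : b ≠ d) (hcd : c ≠ d) : N4 G x a b c d := by
  obtain ⟨p, h⟩ := n4_3 hreg ha hb hc hab hac hbc
  rcases (h.adj d).1 hd with rfl | rfl | rfl | rfl
  · exact absurd rfl had
  · exact absurd rfl hbd
  · exact absurd rfl hcd
  · exact h

variable [Fintype V] {Φ : (V → Fin 4) → Bool}

lemma PB.three {p p' q q' : V} {B : Finset V} (h : PB G 4 p p' q q' B) (s t : V) :
    ∃ n ∈ NC G B, n ≠ s ∧ n ≠ t := by
  by_contra hcon
  push Not at hcon
  have : NC G B ⊆ {s, t} := by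
    intro n hn
    have := hcon n hn
    simp only [Finset.mem_insert, Finset.mem_singleton]
    tauto
  have := (Finset.card_le_card this).trans Finset.card_le_two
  have := h.ncard
  omega

lemma PB.NCsub {p p' q q' : V} {B : Finset V} (h : PB G 4 p p' q q' B) {r s t : V}
    (hsub : ∀ n ∈ NC G B, n = r ∨ n = s ∨ n = t) :
    r ∈ NC G B ∧ s ∈ NC G B ∧ t ∈ NC G B ∧ r ≠ s ∧ r ≠ t ∧ s ≠ t := by
  have h1 := h.three
  refine ⟨?_, ?_, ?_, ?_, ?_, ?_⟩
  · obtain ⟨n, hn, h2, h3⟩ := h1 s t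
    rcases hsub n hn with rfl | rfl | rfl
    · exact hn
    · exact absurd rfl h2
    · exact absurd rfl h3
  · obtain ⟨n, hn, h2, h3⟩ := h1 r t
    rcases hsub n hn with rfl | rfl | rfl
    · exact absurd rfl h2
    · exact hn
    · exact absurd rfl h3
  · obtain ⟨n, hn, h2, h3⟩ := h1 r s
    rcases hsub n hn with rfl | rfl | rfl
    · exact absurd rfl h2
    · exact absurd rfl h3
    · exact hn
  · rintro rfl
    obtain ⟨n, hn, h2, h3⟩ := h1 r t
    rcases hsub n hn with rfl | rfl | rfl <;> contradiction
  · rintro rfl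
    obtain ⟨n, hn, h2, h3⟩ := h1 r s
    rcases hsub n hn with rfl | rfl | rfl <;> contradiction
  · rintro rfl
    obtain ⟨n, hn, h2, h3⟩ := h1 r s
    rcases hsub n hn with rfl | rfl | rfl <;> contradiction

/-- basic facts about a noncut vertex -/
lemma PB.facts {p p' q q' : V} {B : Finset V} (h : PB G 4 p p' q q' B) {n : V} (hn : n ∈ NC G B) :
    n ∈ B ∧ (n ≠ p ∧ n ≠ p' ∧ n ≠ q ∧ n ≠ q') ∧
    (G.Adj p n ∨ G.Adj p' n) ∧ (G.Adj q n ∨ G.Adj q' n) := by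
  have hB := (mem_NC.1 hn).1
  refine ⟨hB, h.disj n hB, ?_, ?_⟩
  · exact (h.ncp n hn).imp (fun h => h.symm) (fun h => h.symm)
  · exact (h.ncq n hn).imp (fun h => h.symm) (fun h => h.symm)

/-- a vertex adjacent to both ends of a pair is not in `B` -/
lemma PB.notp {p p' q q' : V} {B : Finset V} (h : PB G 4 p p' q q' B) {w : V}
    (h1 : G.Adj w p) (h2 : G.Adj w p') : w ∉ B := fun hw => h.np w hw ⟨h1, h2⟩
lemma PB.notq {p p' q q' : V} {B : Finset V} (h : PB G 4 p p' q q' B) {w : V}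
    (h1 : G.Adj w q) (h2 : G.Adj w q') : w ∉ B := fun hw => h.nq w hw ⟨h1, h2⟩
lemma PB.out {p p' q q' : V} {B : Finset V} (h : PB G 4 p p' q q' B) {w v : V} (hw : w ∉ B)
    (h0 : w ≠ p ∧ w ≠ p' ∧ w ≠ q ∧ w ≠ q') (hv : G.Adj w v) : v ∉ B := by
  intro hvB
  rcases h.closed v hvB w hv.symm with h1 | h1 | h1 | h1 | h1
  · exact h0.1 h1
  · exact h0.2.1 h1
  · exact h0.2.2.1 h1
  · exact h0.2.2.2 h1
  · exact hw h1

lemma no_K4 (h : Ctx G 4 Φ) {x a b c : V} (hxa : G.Adj x a) (hxb : G.Adj x b) (hxc : G.Adj x c)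
    (hab : G.Adj a b) (hbc : G.Adj b c) (hac : G.Adj a c) : False := by
  have hkf := h.kfree le_rfl
  have := hkf {x, a, b, c} (by
    intro u hu v hv huv
    simp only [Finset.mem_insert, Finset.mem_singleton] at hu hv
    have := hxa.symm; have := hxb.symm; have := hxc.symm; have := hab.symm
    have := hbc.symm; have := hac.symm
    rcases hu with rfl | rfl | rfl | rfl <;> rcases hv with rfl | rfl | rfl | rfl <;>
      first | exact absurd rfl huv | assumption)
  rw [Finset.card_insert_of_notMem, Finset.card_eq_three.2 ⟨a, b, c, hab.ne, hac.ne, hbc.ne, rfl⟩] at this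
  · omega
  · simp [hxa.ne, hxb.ne, hxc.ne]

lemma lab3 (h : Ctx G 4 Φ) {x a b c : V} (hxa : G.Adj x a) (hxb : G.Adj x b) (hxc : G.Adj x c)
    (hab : ¬ G.Adj a b) (hbc : ¬ G.Adj b c) (hac : ¬ G.Adj a c) (nab : a ≠ b) (nac : a ≠ c)
    (nbc : b ≠ c) : lab G Φ a b = lab G Φ a c ∧ lab G Φ a b = lab G Φ b c := by
  have hS : ∀ u ∈ ({a, b, c} : Finset V), ∀ v ∈ ({a, b, c} : Finset V), ¬ G.Adj u v := by
    intro u hu v hv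
    simp only [Finset.mem_insert, Finset.mem_singleton] at hu hv
    have : ¬ G.Adj b a := fun h => hab h.symm
    have : ¬ G.Adj c b := fun h => hbc h.symm
    have : ¬ G.Adj c a := fun h => hac h.symm
    rcases hu with rfl | rfl | rfl <;> rcases hv with rfl | rfl | rfl <;>
      first | assumption | exact G.loopless.irrefl _
  have e1 : D2 G a b := ⟨nab, hab, x, hxa, hxb⟩
  have e2 : D2 G a c := ⟨nac, hac, x, hxa, hxc⟩
  have e3 : D2 G b c := ⟨nbc, hbc, x, hxb, hxc⟩
  exact ⟨h.lab_indep (h.kfree le_rfl) le_rfl {a, b, c} hS (by simp) (by simp) (by simp) (by simp) e1 e2,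
    h.lab_indep (h.kfree le_rfl) le_rfl {a, b, c} hS (by simp) (by simp) (by simp) (by simp) e1 e3⟩

/-- the labels of nonadjacent pairs in `N(x)` are not all equal -/
lemma lab_nconst (h : Ctx G 4 Φ) {x a b c d : V} (hN : N4 G x a b c d) (i : Bool)
    (h1 : ¬ G.Adj a b → lab G Φ a b = i) (h2 : ¬ G.Adj a c → lab G Φ a c = i)
    (h3 : ¬ G.Adj a d → lab G Φ a d = i) (h4 : ¬ G.Adj b c → lab G Φ b c = i)
    (h5 : ¬ G.Adj b d → lab G Φ b d = i) (h6 : ¬ G.Adj c d → lab G Φ c d = i) : False := by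
  obtain ⟨p, q, hp, hq, hne, hpq, hl, -⟩ := h.nbhd x (!i)
  have hqp : ¬ G.Adj q p := fun h => hpq h.symm
  have hl' : lab G Φ q p = !i := by rw [lab_comm]; exact hl
  have hni : ∀ j : Bool, j = i → j = !i → False := by
    intro j h1 h2; subst h1; cases j <;> simp at h2
  rw [hN.adj] at hp hq
  rcases hp with rfl | rfl | rfl | rfl <;> rcases hq with rfl | rfl | rfl | rfl <;>
    first
    | exact absurd rfl hne
    | exact hni _ (h1 hpq) hl
    | exact hni _ (h2 hpq) hl
    | exact hni _ (h3 hpq) hl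
    | exact hni _ (h4 hpq) hl
    | exact hni _ (h5 hpq) hl
    | exact hni _ (h6 hpq) hl
    | exact hni _ (h1 hqp) hl'
    | exact hni _ (h2 hqp) hl'
    | exact hni _ (h3 hqp) hl'
    | exact hni _ (h4 hqp) hl'
    | exact hni _ (h5 hqp) hl'
    | exact hni _ (h6 hqp) hl'

lemma no_edge1 (h : Ctx G 4 Φ) {x a b c d : V} (hN : N4 G x a b c d)
    (hac : ¬ G.Adj a c) (had : ¬ G.Adj a d) (hbc : ¬ G.Adj b c) (hbd : ¬ G.Adj b d)
    (hcd : ¬ G.Adj c d) : False := by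
  have e1 := lab3 h hN.xa hN.xc hN.xd hac hcd had hN.ac hN.ad hN.cd
  have e2 := lab3 h hN.xb hN.xc hN.xd hbc hcd hbd hN.bc hN.bd hN.cd
  by_cases hab : G.Adj a b
  · apply lab_nconst h hN (lab G Φ c d) <;> intro hh <;> grind
  · have e3 := lab3 h hN.xa hN.xb hN.xc hab hbc hac hN.ab hN.ac hN.bc
    apply lab_nconst h hN (lab G Φ c d) <;> intro hh <;> grind

/-- star -/
lemma no_star (h : Ctx G 4 Φ) {x a b c d : V} (hN : N4 G x a b c d)
    (hab : G.Adj a b) (hac : G.Adj a c) (had : G.Adj a d)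
    (hbc : ¬ G.Adj b c) (hbd : ¬ G.Adj b d) (hcd : ¬ G.Adj c d) : False := by
  have e2 := lab3 h hN.xb hN.xc hN.xd hbc hcd hbd hN.bc hN.bd hN.cd
  apply lab_nconst h hN (lab G Φ c d) <;> intro hh <;> grind

/-- path plus isolated vertex -/
lemma no_P3K1 (h : Ctx G 4 Φ) {x a b c d : V} (hN : N4 G x a b c d)
    (hab : G.Adj a b) (hbc : G.Adj b c)
    (hac : ¬ G.Adj a c) (had : ¬ G.Adj a d) (hbd : ¬ G.Adj b d) (hcd : ¬ G.Adj c d) : False := by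
  have hkf := h.kfree le_rfl
  have hxd := hN.xd
  obtain ⟨e, f, g, hd, hef, hfg, heg, hxe, hxf, hxg⟩ : ∃ e f g, N4 G d x e f g ∧ G.Adj e f ∧ G.Adj f g ∧
      ¬ G.Adj e g ∧ ¬ G.Adj x e ∧ ¬ G.Adj x f ∧ ¬ G.Adj x g := by
    obtain ⟨e, f, g, hd⟩ := n4_1 (h.reg d) hN.xd.symm
    have iso : ∀ y, G.Adj d y → ¬ G.Adj x y := by
      intro y hdy hxy
      rcases (hN.adj y).1 hxy with rfl | rfl | rfl | rfl
      · exact had hdy.symm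
      · exact hbd hdy.symm
      · exact hcd hdy.symm
      · exact G.loopless.irrefl _ hdy
    have ie := iso e hd.xb
    have jf := iso f hd.xc
    have kg := iso g hd.xd
    by_cases h1 : G.Adj e f <;> by_cases h2 : G.Adj f g <;> by_cases h3 : G.Adj e g
    · exact (no_K4 h hd.xb hd.xc hd.xd h1 h2 h3).elim
    · exact ⟨e, f, g, hd, h1, h2, h3, ie, jf, kg⟩
    · exact ⟨f, e, g, hd.p2, h1.symm, h3, h2, jf, ie, kg⟩
    · exact (no_edge1 h hd.p1.p2 (fun h => ie h.symm) h3 (fun h => jf h.symm) h2 kg).elim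
    · exact ⟨e, g, f, hd.p3, h3, h2.symm, h1, ie, kg, jf⟩
    · exact (no_edge1 h hd.p2.p3.p1.p2 (fun h => jf h.symm) (fun h => h1 h.symm) (fun h => kg h.symm)
        (fun h => h3 h.symm) ie).elim
    · exact (no_edge1 h hd.p3.p1.p2 (fun h => ie h.symm) h1 (fun h => kg h.symm)
        (fun h => h2 h.symm) jf).elim
    · exact (no_edge1 h hd jf kg h1 h3 h2).elim
  have e1 := lab3 h hN.xa hN.xc hN.xd hac hcd had hN.ac hN.ad hN.cd
  have e2 := lab3 h hd.xa hd.xb hd.xd hxe heg hxg hd.ab hd.ad hd.bd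
  have e3 : lab G Φ x f ≠ lab G Φ x e := by
    intro h3
    apply lab_nconst h hd (lab G Φ x e) <;> intro hh <;> grind
  have nxe : ∀ y, G.Adj d y → a ≠ y ∧ c ≠ y := by
    intro y hy
    exact ⟨by rintro rfl; exact had hy.symm, by rintro rfl; exact hcd hy.symm⟩
  have hxin : ∀ n, G.Adj x n → ¬ (G.Adj n a ∧ G.Adj n c) → n ≠ a → n ≠ c → n = d := by
    intro n hn h1 h2 h3
    rcases (hN.adj n).1 hn with rfl | rfl | rfl | rfl
    · exact absurd rfl h2
    · exact absurd ⟨hab.symm, hbc⟩ h1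
    · exact absurd rfl h3
    · rfl
  by_cases hl : lab G Φ a c = lab G Φ x f
  · have hl2 : lab G Φ a c ≠ lab G Φ x e := by rw [hl]; exact e3
    obtain ⟨B, hB⟩ := pairBad h hkf le_rfl (p := a) (p' := c) (q := x) (q' := e)
      ⟨hN.ac, hac, x, hN.xa, hN.xc⟩ ⟨hd.ab, hxe, d, hd.xa, hd.xb⟩ hl2
      hN.xa.ne' (nxe e hd.xb).1 hN.xc.ne' (nxe e hd.xb).2
    have hdB : d ∉ B := hB.notq hd.xa hd.xb
    have hfB : f ∉ B := hB.out hdB ⟨hN.ad.symm, hN.cd.symm, hd.xa.ne, hd.xb.ne⟩ hd.xc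
    obtain ⟨e1, e2, he⟩ := n4_2 (h.reg e) hd.xb.symm hef hd.xc.ne
    obtain ⟨n, hn, hn1, hn2⟩ := hB.three e1 e2
    obtain ⟨hnB, hnd, hnp, hnq⟩ := hB.facts hn
    rcases hnq with hnx | hne
    · have := hxin n hnx (hB.np n hnB) hnd.1 hnd.2.1
      exact hdB (this ▸ hnB)
    · rcases (he.adj n).1 hne with rfl | rfl | rfl | rfl
      · exact hdB hnB
      · exact hfB hnB
      · exact hn1 rfl
      · exact hn2 rfl
  · obtain ⟨B, hB⟩ := pairBad h hkf le_rfl (p := a) (p' := c) (q := x) (q' := f)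
      ⟨hN.ac, hac, x, hN.xa, hN.xc⟩ ⟨hd.ac, hxf, d, hd.xa, hd.xc⟩ hl
      hN.xa.ne' (nxe f hd.xc).1 hN.xc.ne' (nxe f hd.xc).2
    have hdB : d ∉ B := hB.notq hd.xa hd.xc
    have heB : e ∉ B := hB.out hdB ⟨hN.ad.symm, hN.cd.symm, hd.xa.ne, hd.xc.ne⟩ hd.xb
    have hgB : g ∉ B := hB.out hdB ⟨hN.ad.symm, hN.cd.symm, hd.xa.ne, hd.xc.ne⟩ hd.xd
    obtain ⟨f4, hf⟩ := n4_3 (h.reg f) hd.xc.symm hef.symm hfg hd.xb.ne hd.xd.ne hd.bd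
    obtain ⟨n, hn, hn1, hn2⟩ := hB.three f4 f4
    obtain ⟨hnB, hnd, hnp, hnq⟩ := hB.facts hn
    rcases hnq with hnx | hne
    · have := hxin n hnx (hB.np n hnB) hnd.1 hnd.2.1
      exact hdB (this ▸ hnB)
    · rcases (hf.adj n).1 hne with rfl | rfl | rfl | rfl
      · exact hdB hnB
      · exact heB hnB
      · exact hgB hnB
      · exact hn1 rfl

lemma no_C4 (h : Ctx G 4 Φ) {x a b c d : V} (hN : N4 G x a b c d)
    (hab : G.Adj a b) (hbc : G.Adj b c) (hcd : G.Adj c d) (hda : G.Adj d a) : False := by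
  have hkf := h.kfree le_rfl
  have hac : ¬ G.Adj a c := fun h' => no_K4 h hN.xa hN.xb hN.xc hab hbc h'
  have hbd : ¬ G.Adj b d := fun h' => no_K4 h hN.xb hN.xc hN.xd hbc hcd h'
  have hl : lab G Φ a c ≠ lab G Φ b d := by
    intro hl
    apply lab_nconst h hN (lab G Φ a c) <;> intro hh <;> grind [SimpleGraph.adj_comm]
  obtain ⟨B, hB⟩ := pairBad h hkf le_rfl (p := a) (p' := c) (q := b) (q' := d)
      ⟨hN.ac, hac, x, hN.xa, hN.xc⟩ ⟨hN.bd, hbd, x, hN.xb, hN.xd⟩ hl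
      hN.ab hN.ad hN.bc.symm hN.cd
  obtain ⟨a', ha⟩ := n4_3 (h.reg a) hN.xa.symm hab hda.symm hN.xb.ne hN.xd.ne hN.bd
  obtain ⟨c', hc⟩ := n4_3 (h.reg c) hN.xc.symm hbc.symm hcd hN.xb.ne hN.xd.ne hN.bd
  have hxB : x ∉ B := hB.notp hN.xa hN.xc
  obtain ⟨n, hn, hn1, hn2⟩ := hB.three a' c'
  obtain ⟨hnB, hnd, hnp, hnq⟩ := hB.facts hn
  rcases hnp with hna | hnc
  · rcases (ha.adj n).1 hna with rfl | rfl | rfl | rfl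
    · exact hxB hnB
    · exact hnd.2.2.1 rfl
    · exact hnd.2.2.2 rfl
    · exact hn1 rfl
  · rcases (hc.adj n).1 hnc with rfl | rfl | rfl | rfl
    · exact hxB hnB
    · exact hnd.2.2.1 rfl
    · exact hnd.2.2.2 rfl
    · exact hn2 rfl

end four

end part7

section part8

section fourb
variable {G : SimpleGraph V}

structure P4 (G : SimpleGraph V) (x a b c d : V) : Prop where
  n : N4 G x a b c d
  ab : G.Adj a b
  bc : G.Adj b c
  cd : G.Adj c d
  ac : ¬ G.Adj a c
  ad : ¬ G.Adj a d
  bd : ¬ G.Adj b d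

lemma P4.rev {x a b c d : V} (h : P4 G x a b c d) : P4 G x d c b a :=
  ⟨h.n.p1.p2.p3.p1.p2.p1, h.cd.symm, h.bc.symm, h.ab.symm, fun h' => h.bd h'.symm,
    fun h' => h.ad h'.symm, fun h' => h.ac h'.symm⟩

variable [Fintype V] {Φ : (V → Fin 4) → Bool}

lemma P4.pre (h : Ctx G 4 Φ) {x a b c d : V} (hP : P4 G x a b c d) :
    ∃ y, N4 G b a x c y ∧ ¬ G.Adj x y ∧ d ≠ y ∧
      ((G.Adj a y ∧ ¬ G.Adj c y) ∨ (¬ G.Adj a y ∧ G.Adj c y)) := by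
  obtain ⟨y, hy⟩ := n4_3 (h.reg b) hP.ab.symm hP.n.xb.symm hP.bc hP.n.xa.ne' hP.n.ac hP.n.xc.ne
  have hdy : d ≠ y := by rintro rfl; exact hP.bd hy.xd
  have hxy : ¬ G.Adj x y := by
    intro hh
    rcases (hP.n.adj y).1 hh with e | e | e | e
    · exact hy.ad e.symm
    · exact hy.xd.ne e.symm
    · exact hy.cd e.symm
    · exact hdy e.symm
  refine ⟨y, hy, hxy, hdy, ?_⟩
  by_cases h1 : G.Adj a y <;> by_cases h2 : G.Adj c y
  · exact (no_C4 h hy hP.n.xa.symm hP.n.xc h2 h1.symm).elim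
  · exact Or.inl ⟨h1, h2⟩
  · exact Or.inr ⟨h1, h2⟩
  · exact (no_P3K1 h hy hP.n.xa.symm hP.n.xc hP.ac h1 hxy h2).elim

lemma P4.aux1 (h : Ctx G 4 Φ) {x a b c d y s t : V} (hP : P4 G x a b c d)
    (hb : N4 G b a x c y) (hc : N4 G c d x b y) (ha : N4 G a x b s t) (hd : N4 G d x c s t)
    (hxy : ¬ G.Adj x y) (hl : lab G Φ x y ≠ lab G Φ b d) : False := by
  have hkf := h.kfree le_rfl
  have hN := hP.n
  obtain ⟨B, hB⟩ := pairBad h hkf le_rfl (p := x) (p' := y) (q := b) (q' := d)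
    ⟨hb.bd, hxy, b, hb.xb, hb.xd⟩ ⟨hN.bd, hP.bd, x, hN.xb, hN.xd⟩ hl
    hN.xb.ne hN.xd.ne hb.xd.ne' hc.ad.symm
  have hcB : c ∉ B := hB.notq hP.bc.symm hP.cd
  have hsub : ∀ n ∈ NC G B, n = a ∨ n = s ∨ n = t := by
    intro n hn
    obtain ⟨hnB, hnd, hnp, hnq⟩ := hB.facts hn
    rcases hnq with h1 | h1
    · rcases (hb.adj n).1 h1 with rfl | rfl | rfl | rfl
      · simp
      · exact absurd rfl hnd.1
      · exact absurd hnB hcB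
      · exact absurd rfl hnd.2.1
    · rcases (hd.adj n).1 h1 with rfl | rfl | rfl | rfl
      · exact absurd rfl hnd.1
      · exact absurd hnB hcB
      · simp
      · simp
  obtain ⟨haN, hsN, htN, -, -, hst⟩ := hB.NCsub hsub
  have key : ∀ n ∈ NC G B, G.Adj a n → G.Adj y n := by
    intro n hn han
    obtain ⟨hnB, hnd, hnp, hnq⟩ := hB.facts hn
    rcases hnp with h1 | h1
    · rcases (hN.adj n).1 h1 with rfl | rfl | rfl | rfl
      · exact absurd han (G.loopless.irrefl _)
      · exact absurd rfl hnd.2.2.1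
      · exact absurd hnB hcB
      · exact absurd rfl hnd.2.2.2
    · exact h1
  have hys := key s hsN ha.xc
  have hyt := key t htN ha.xd
  have fs := (hB.facts hsN).2.1
  have ft := (hB.facts htN).2.1
  have hcs : c ≠ s := by rintro rfl; exact hcB (hB.facts hsN).1
  have hct : c ≠ t := by rintro rfl; exact hcB (hB.facts htN).1
  have hy : N4 G y b c s t := n4_4 (h.reg y) hb.xd.symm hc.xd.symm hys hyt hN.bc fs.2.2.1.symm hcs
    ft.2.2.1.symm hct hst
  have hbn : ∀ n, G.Adj a n → n ≠ x → n ≠ c → n ≠ y → ¬ G.Adj b n := by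
    intro n h0 h1 h2 h3 h4
    rcases (hb.adj n).1 h4 with rfl | rfl | rfl | rfl
    · exact G.loopless.irrefl _ h0
    · exact h1 rfl
    · exact h2 rfl
    · exact h3 rfl
  have hcn : ∀ n, G.Adj d n → n ≠ x → n ≠ b → n ≠ y → ¬ G.Adj c n := by
    intro n h0 h1 h2 h3 h4
    rcases (hc.adj n).1 h4 with rfl | rfl | rfl | rfl
    · exact G.loopless.irrefl _ h0
    · exact h1 rfl
    · exact h2 rfl
    · exact h3 rfl
  have bs := hbn s ha.xc fs.1 hcs.symm hys.ne'
  have bt := hbn t ha.xd ft.1 hct.symm hyt.ne'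
  have cs := hcn s hd.xc fs.1 fs.2.2.1 hys.ne'
  have ct := hcn t hd.xd ft.1 ft.2.2.1 hyt.ne'
  by_cases hadj : G.Adj s t
  · have hay : ¬ G.Adj a y := by
      intro hh
      rcases (ha.adj y).1 hh with e | e | e | e
      · exact hb.bd e.symm
      · exact hb.xd.ne e.symm
      · exact hys.ne e
      · exact hyt.ne e
    have hdy : ¬ G.Adj d y := by
      intro hh
      rcases (hd.adj y).1 hh with e | e | e | e
      · exact hb.bd e.symm
      · exact hc.xd.ne e.symm
      · exact hys.ne e
      · exact hyt.ne e
    have hs : N4 G s t a d y := n4_4 (h.reg s) hadj ha.xc.symm hd.xc.symm hys.symm ha.xd.ne'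
      hd.xd.ne' hN.ad hyt.ne' hb.ad hc.ad
    exact no_star h hs ha.xd.symm hd.xd.symm hyt.symm hP.ad hay hdy
  · exact no_edge1 h hy bs bt cs ct hadj

lemma P4.aux2 (h : Ctx G 4 Φ) {x a b c d y z s : V} (hP : P4 G x a b c d)
    (hb : N4 G b a x c y) (hc : N4 G c d x b z) (ha : N4 G a x b y s) (hd : N4 G d x c z s)
    (hs : N4 G s a d y z) (hxs : ¬ G.Adj x s) (hl : lab G Φ x s ≠ lab G Φ a c) : False := by
  have hkf := h.kfree le_rfl
  have hN := hP.n
  have hsc : s ≠ c := by rintro rfl; exact hP.ac ha.xd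
  obtain ⟨B, hB⟩ := pairBad h hkf le_rfl (p := x) (p' := s) (q := a) (q' := c)
    ⟨ha.ad, hxs, a, ha.xa, ha.xd⟩ ⟨hN.ac, hP.ac, x, hN.xa, hN.xc⟩ hl
    hN.xa.ne hN.xc.ne ha.xd.ne' hsc
  have hbB : b ∉ B := hB.notq hP.ab.symm hP.bc
  have hdB : d ∉ B := hB.notp hd.xa hd.xd
  obtain ⟨n, hn, h1, h2⟩ := hB.three y z
  obtain ⟨hnB, hnd, hnp, hnq⟩ := hB.facts hn
  rcases hnp with h3 | h3
  · rcases (hN.adj n).1 h3 with rfl | rfl | rfl | rfl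
    · exact hnd.2.2.1 rfl
    · exact hbB hnB
    · exact hnd.2.2.2 rfl
    · exact hdB hnB
  · rcases (hs.adj n).1 h3 with rfl | rfl | rfl | rfl
    · exact hnd.2.2.1 rfl
    · exact hdB hnB
    · exact h1 rfl
    · exact h2 rfl

lemma P4.labeq (h : Ctx G 4 Φ) {x a b c d : V} (hP : P4 G x a b c d) :
    lab G Φ a c = lab G Φ b d := by
  by_contra hl
  have hkf := h.kfree le_rfl
  have hN := hP.n
  obtain ⟨y, hb, hxy, hdy, hcase⟩ := hP.pre h
  obtain ⟨z, hc, hxz, haz, hcase'⟩ := hP.rev.pre h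
  obtain ⟨B, hB⟩ := pairBad h hkf le_rfl (p := a) (p' := c) (q := b) (q' := d)
      ⟨hN.ac, hP.ac, x, hN.xa, hN.xc⟩ ⟨hN.bd, hP.bd, x, hN.xb, hN.xd⟩ hl
      hN.ab hN.ad hN.bc.symm hN.cd
  have hxB : x ∉ B := hB.notp hN.xa hN.xc
  have sub1 : ∀ s t, N4 G a x b s t → ∀ n ∈ NC G B, n = s ∨ n = t ∨ n = z := by
    intro s t ha n hn
    obtain ⟨hnB, hnd, hnp, hnq⟩ := hB.facts hn
    rcases hnp with h3 | h3
    · rcases (ha.adj n).1 h3 with rfl | rfl | rfl | rfl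
      · exact absurd hnB hxB
      · exact absurd rfl hnd.2.2.1
      · simp
      · simp
    · rcases (hc.adj n).1 h3 with rfl | rfl | rfl | rfl
      · exact absurd rfl hnd.2.2.2
      · exact absurd hnB hxB
      · exact absurd rfl hnd.2.2.1
      · simp
  have sub2 : ∀ s t, N4 G d x c s t → ∀ n ∈ NC G B, n = s ∨ n = t ∨ n = y := by
    intro s t hd n hn
    obtain ⟨hnB, hnd, hnp, hnq⟩ := hB.facts hn
    rcases hnq with h3 | h3
    · rcases (hb.adj n).1 h3 with rfl | rfl | rfl | rfl
      · exact absurd rfl hnd.1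
      · exact absurd hnB hxB
      · exact absurd rfl hnd.2.1
      · simp
    · rcases (hd.adj n).1 h3 with rfl | rfl | rfl | rfl
      · exact absurd hnB hxB
      · exact absurd rfl hnd.2.1
      · simp
      · simp
  rcases hcase with ⟨hay, hcy⟩ | ⟨hay, hcy⟩
  · have hbz : ¬ G.Adj b z := by
      intro hh
      rcases (hb.adj z).1 hh with e | e | e | e
      · exact haz e.symm
      · exact hc.bd e.symm
      · exact hc.xd.ne e.symm
      · exact hcy (e ▸ hc.xd)
    have hdz : G.Adj d z := by
      rcases hcase' with h1 | h1
      · exact h1.1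
      · exact absurd h1.2 hbz
    obtain ⟨s, ha⟩ := n4_3 (h.reg a) hN.xa.symm hP.ab hay hN.xb.ne hb.bd hb.xd.ne
    obtain ⟨t, hd⟩ := n4_3 (h.reg d) hN.xd.symm hP.cd.symm hdz hN.xc.ne hc.bd hc.xd.ne
    obtain ⟨hyN, hsN, hzN, hys, hyz, hsz⟩ := hB.NCsub (sub1 _ _ ha)
    have hst : s = t := by
      rcases sub2 _ _ hd s hsN with e | e | e
      · exact absurd e hsz
      · exact e
      · exact absurd e hys.symm
    subst hst
    have hsc : s ≠ c := by rintro rfl; exact hP.ac ha.xd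
    have hsb : s ≠ b := by rintro rfl; exact hP.bd hd.xd.symm
    have hxs : ¬ G.Adj x s := by
      intro hh
      rcases (hN.adj s).1 hh with e | e | e | e
      · exact ha.xd.ne e.symm
      · exact hsb e
      · exact hsc e
      · exact hd.xd.ne e.symm
    have hbs : ¬ G.Adj b s := by
      intro hh
      rcases (hb.adj s).1 hh with e | e | e | e
      · exact ha.xd.ne e.symm
      · exact ha.ad e.symm
      · exact hsc e
      · exact hys e.symm
    have hcs : ¬ G.Adj c s := by
      intro hh
      rcases (hc.adj s).1 hh with e | e | e | e
      · exact hd.xd.ne e.symm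
      · exact ha.ad e.symm
      · exact hsb e
      · exact hsz e
    have hysA : G.Adj y s := by
      by_contra hh
      exact no_P3K1 h ha hN.xb hb.xd hxy hxs hbs hh
    have hzsA : G.Adj z s := by
      by_contra hh
      exact no_P3K1 h hd hN.xc hc.xd hxz hxs hcs hh
    have hs : N4 G s a d y z := n4_4 (h.reg s) ha.xd.symm hd.xd.symm hysA.symm hzsA.symm hN.ad
      hb.ad hdy haz hc.ad hyz
    by_cases hl2 : lab G Φ x s = lab G Φ a c
    · exact hP.rev.aux2 h hc hb hd ha hs.p1.p3 hxs (by
        rw [hl2, lab_comm (a := d)]; exact hl)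
    · exact hP.aux2 h hb hc ha hd hs hxs hl2
  · have hyz : y = z := by
      rcases (hc.adj y).1 hcy with e | e | e | e
      · exact absurd e hdy.symm
      · exact absurd e.symm hb.bd
      · exact absurd e.symm hb.xd.ne
      · exact e
    subst hyz
    obtain ⟨s, t, ha⟩ := n4_2 (h.reg a) hN.xa.symm hP.ab hN.xb.ne
    obtain ⟨s', t', hd⟩ := n4_2 (h.reg d) hN.xd.symm hP.cd.symm hN.xc.ne
    obtain ⟨hsN, htN, hyN, hst, hsy, hty⟩ := hB.NCsub (sub1 _ _ ha)
    have hd' : N4 G d x c s t := by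
      rcases sub2 _ _ hd s hsN with e | e | e <;> rcases sub2 _ _ hd t htN with e' | e' | e'
      · exact absurd (e.trans e'.symm) hst
      · rw [e, e']; exact hd
      · exact absurd e' hty
      · rw [e, e']; exact hd.p3
      · exact absurd (e.trans e'.symm) hst
      · exact absurd e' hty
      · exact absurd e hsy
      · exact absurd e hsy
      · exact absurd e hsy
    by_cases hl2 : lab G Φ x y = lab G Φ b d
    · exact hP.rev.aux1 h hc hb hd' ha hxy (by
        rw [hl2, lab_comm (a := c)]; exact Ne.symm hl)
    · exact hP.aux1 h hb hc ha hd' hxy hl2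

lemma no_P4 (h : Ctx G 4 Φ) {x a b c d : V} (hP : P4 G x a b c d) : False := by
  have hkf := h.kfree le_rfl
  have hN := hP.n
  obtain ⟨y, hb, hxy, hdy, hcase⟩ := hP.pre h
  have e1 := hP.labeq h
  have hl : lab G Φ a c ≠ lab G Φ a d := by
    intro hl
    apply lab_nconst h hN (lab G Φ a c)
    · exact fun hh => absurd hP.ab hh
    · exact fun _ => rfl
    · exact fun _ => hl.symm
    · exact fun hh => absurd hP.bc hh
    · exact fun _ => e1.symm
    · exact fun hh => absurd hP.cd hh
  have hl2 : lab G Φ x y ≠ lab G Φ a d := by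
    rcases hcase with ⟨hay, hcy⟩ | ⟨hay, hcy⟩
    · have hPb : P4 G b c x a y := ⟨hb.p1.p2.p1, hN.xc.symm, hN.xa, hay,
        fun h => hP.ac h.symm, hcy, hxy⟩
      rw [← hPb.labeq h, lab_comm]; exact hl
    · have hPb : P4 G b a x c y := ⟨hb, hN.xa.symm, hN.xc, hcy, hP.ac, hay, hxy⟩
      rw [← hPb.labeq h]; exact hl
  obtain ⟨B, hB⟩ := pairBad h hkf le_rfl (p := x) (p' := y) (q := a) (q' := d)
    ⟨hb.bd, hxy, b, hb.xb, hb.xd⟩ ⟨hN.ad, hP.ad, x, hN.xa, hN.xd⟩ hl2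
    hN.xa.ne hN.xd.ne hb.ad.symm hdy.symm
  have hbB : b ∉ B := hB.notp hb.xb hb.xd
  have hcB : c ∉ B := hB.out hbB ⟨hN.xb.ne', hb.xd.ne, hN.ab.symm, hN.bd⟩ hP.bc
  have fin : ∀ r s t, N4 G y b r s t → (r = a ∨ r = c) → False := by
    intro r s t hy hr
    obtain ⟨n, hn, h1, h2⟩ := hB.three s t
    obtain ⟨hnB, hnd, hnp, hnq⟩ := hB.facts hn
    rcases hnp with h3 | h3
    · rcases (hN.adj n).1 h3 with rfl | rfl | rfl | rfl
      · exact hnd.2.2.1 rfl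
      · exact hbB hnB
      · exact hcB hnB
      · exact hnd.2.2.2 rfl
    · rcases (hy.adj n).1 h3 with rfl | rfl | rfl | rfl
      · exact hbB hnB
      · rcases hr with rfl | rfl
        · exact hnd.2.2.1 rfl
        · exact hcB hnB
      · exact h1 rfl
      · exact h2 rfl
  rcases hcase with ⟨hay, hcy⟩ | ⟨hay, hcy⟩
  · obtain ⟨s, t, hy⟩ := n4_2 (h.reg y) hb.xd.symm hay.symm hN.ab.symm
    exact fin a s t hy (Or.inl rfl)
  · obtain ⟨s, t, hy⟩ := n4_2 (h.reg y) hb.xd.symm hcy.symm hN.bc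
    exact fin c s t hy (Or.inr rfl)

end fourb

end part8

section part9

section fourc
variable {G : SimpleGraph V}

structure M2 (G : SimpleGraph V) (x a b c d : V) : Prop where
  n : N4 G x a b c d
  ab : G.Adj a b
  cd : G.Adj c d
  ac : ¬ G.Adj a c
  ad : ¬ G.Adj a d
  bc : ¬ G.Adj b c
  bd : ¬ G.Adj b d

lemma M2.s1 {x a b c d : V} (h : M2 G x a b c d) : M2 G x b a c d :=
  ⟨h.n.p1, h.ab.symm, h.cd, h.bc, h.bd, h.ac, h.ad⟩
lemma M2.s3 {x a b c d : V} (h : M2 G x a b c d) : M2 G x a b d c :=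
  ⟨h.n.p3, h.ab, h.cd.symm, h.ad, h.ac, h.bd, h.bc⟩
lemma M2.s2 {x a b c d : V} (h : M2 G x a b c d) : M2 G x c d a b :=
  ⟨h.n.p2.p1.p3.p2, h.cd, h.ab, fun e => h.ac e.symm, fun e => h.bc e.symm,
    fun e => h.ad e.symm, fun e => h.bd e.symm⟩

variable [Fintype V] {Φ : (V → Fin 4) → Bool}

lemma m2_of_edge (h : Ctx G 4 Φ) {x a b c d : V} (hN : N4 G x a b c d) (hab : G.Adj a b) :
    M2 G x a b c d := by
  by_cases hcd : G.Adj c d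
  · by_cases h1 : G.Adj a c
    · by_cases h2 : G.Adj a d
      · exact (no_K4 h hN.xa hN.xc hN.xd h1 hcd h2).elim
      by_cases h3 : G.Adj b c
      · exact (no_K4 h hN.xa hN.xb hN.xc hab h3 h1).elim
      by_cases h4 : G.Adj b d
      · exact (no_C4 h hN.p2.p3 h1 hcd h4.symm hab.symm).elim
      · exact (no_P4 h ⟨hN.p1, hab.symm, h1, hcd, h3, h4, h2⟩).elim
    by_cases h2 : G.Adj a d
    · by_cases h4 : G.Adj b d
      · exact (no_K4 h hN.xa hN.xb hN.xd hab h4 h2).elim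
      by_cases h3 : G.Adj b c
      · exact (no_C4 h hN.p3.p2.p3 h2 hcd.symm h3.symm hab.symm).elim
      · exact (no_P4 h ⟨hN.p1.p3, hab.symm, h2, hcd.symm, h4, h3, h1⟩).elim
    by_cases h3 : G.Adj b c
    · by_cases h4 : G.Adj b d
      · exact (no_K4 h hN.xb hN.xc hN.xd h3 hcd h4).elim
      · exact (no_P4 h ⟨hN, hab, h3, hcd, h1, h2, h4⟩).elim
    by_cases h4 : G.Adj b d
    · exact (no_P4 h ⟨hN.p3, hab, h4, hcd.symm, h2, h1, h3⟩).elim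
    exact ⟨hN, hab, hcd, h1, h2, h3, h4⟩
  · exfalso
    have hdc : ¬ G.Adj d c := fun e => hcd e.symm
    by_cases h1 : G.Adj a c
    · by_cases h3 : G.Adj b c
      · exact (no_K4 h hN.xa hN.xb hN.xc hab h3 h1).elim
      by_cases h2 : G.Adj a d
      · by_cases h4 : G.Adj b d
        · exact (no_K4 h hN.xa hN.xb hN.xd hab h4 h2).elim
        · exact no_star h hN hab h1 h2 h3 h4 hcd
      by_cases h4 : G.Adj b d
      · exact no_P4 h ⟨hN.p2.p1, h1.symm, hab, h4, fun e => h3 e.symm, hcd, h2⟩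
      · exact no_P3K1 h hN.p2.p1 h1.symm hab (fun e => h3 e.symm) hcd h2 h4
    by_cases h3 : G.Adj b c
    · by_cases h2 : G.Adj a d
      · by_cases h4 : G.Adj b d
        · exact (no_K4 h hN.xa hN.xb hN.xd hab h4 h2).elim
        · exact no_P4 h ⟨hN.p1.p2.p1, h3.symm, hab.symm, h2, fun e => h1 e.symm, hcd, h4⟩
      by_cases h4 : G.Adj b d
      · exact no_star h hN.p1 hab.symm h3 h4 h1 h2 hcd
      · exact no_P3K1 h hN.p1.p2.p1 h3.symm hab.symm (fun e => h1 e.symm) hcd h4 h2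
    by_cases h2 : G.Adj a d
    · by_cases h4 : G.Adj b d
      · exact (no_K4 h hN.xa hN.xb hN.xd hab h4 h2).elim
      · exact no_P3K1 h hN.p3.p2.p1 h2.symm hab (fun e => h4 e.symm) hdc h1 h3
    by_cases h4 : G.Adj b d
    · exact no_P3K1 h hN.p3.p1.p2.p1 h4.symm hab.symm (fun e => h2 e.symm) hdc h3 h1
    exact no_edge1 h hN h1 h2 h3 h4 hcd

lemma m2_ex (h : Ctx G 4 Φ) {x a : V} (hxa : G.Adj x a) : ∃ b c d, M2 G x a b c d := by
  obtain ⟨b, c, d, hN⟩ := n4_1 (h.reg x) hxa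
  by_cases h1 : G.Adj a b
  · exact ⟨b, c, d, m2_of_edge h hN h1⟩
  by_cases h2 : G.Adj a c
  · exact ⟨c, b, d, m2_of_edge h hN.p2 h2⟩
  by_cases h3 : G.Adj a d
  · exact ⟨d, b, c, m2_of_edge h hN.p3.p2 h3⟩
  exfalso
  by_cases h4 : G.Adj b c
  · exact h3 (m2_of_edge h hN.p1.p2 h4).cd
  · exact no_edge1 h hN.p3.p2 h1 h2 (fun e => (m2_of_edge h hN.p1.p3.p2 e.symm).ac (by
      exact absurd (m2_of_edge h hN.p1.p3.p2 e.symm).cd h2)) (fun e => by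
      exact absurd (m2_of_edge h hN.p2.p1.p3.p2 e.symm).cd h1) h4

lemma tri_uniq (h : Ctx G 4 Φ) {x a p q : V} (hxa : G.Adj x a) (hp : G.Adj x p) (hq : G.Adj x q)
    (hap : G.Adj a p) (haq : G.Adj a q) : p = q := by
  obtain ⟨b, c, d, hM⟩ := m2_ex h hxa
  have key : ∀ w, G.Adj x w → G.Adj a w → w = b := by
    intro w h1 h2
    rcases (hM.n.adj w).1 h1 with rfl | rfl | rfl | rfl
    · exact absurd h2 (G.loopless.irrefl _)
    · rfl
    · exact absurd h2 hM.ac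
    · exact absurd h2 hM.ad
  rw [key p hp hap, key q hq haq]

lemma m2_of_tri (h : Ctx G 4 Φ) {x a b : V} (hxa : G.Adj x a) (hxb : G.Adj x b) (hab : G.Adj a b) :
    ∃ c d, M2 G x a b c d := by
  obtain ⟨c, d, hN⟩ := n4_2 (h.reg x) hxa hxb hab.ne
  exact ⟨c, d, m2_of_edge h hN hab⟩

/-- two common neighbours -/
lemma m2_two (h : Ctx G 4 Φ) {x a b d n m : V} (hax : G.Adj a x) (hab : G.Adj a b)
    (hxb : G.Adj x b) (had : a ≠ d) (hnm : n ≠ m) (h1 : G.Adj a n) (h2 : G.Adj a m)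
    (h3 : G.Adj d n) (h4 : G.Adj d m) (hnx : n ≠ x) (hmx : m ≠ x) (hnb : n ≠ b) (hmb : m ≠ b) :
    False := by
  obtain ⟨p, q, hM⟩ := m2_of_tri h hax hab hxb
  have : G.Adj n m := by
    rcases (hM.n.adj n).1 h1 with e | e | e | e
    · exact absurd e hnx
    · exact absurd e hnb
    · rcases (hM.n.adj m).1 h2 with e' | e' | e' | e'
      · exact absurd e' hmx
      · exact absurd e' hmb
      · exact absurd (e.trans e'.symm) hnm
      · rw [e, e']; exact hM.cd
    · rcases (hM.n.adj m).1 h2 with e' | e' | e' | e'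
      · exact absurd e' hmx
      · exact absurd e' hmb
      · rw [e, e']; exact hM.cd.symm
      · exact absurd (e.trans e'.symm) hnm
  exact had (tri_uniq h this h1.symm h3.symm h2.symm h4.symm)

lemma M2.labeq (h : Ctx G 4 Φ) {x a b c d : V} (hM : M2 G x a b c d) :
    lab G Φ a c = lab G Φ b d := by
  by_contra hl
  have hkf := h.kfree le_rfl
  have hN := hM.n
  obtain ⟨B, hB⟩ := pairBad h hkf le_rfl (p := a) (p' := c) (q := b) (q' := d)
      ⟨hN.ac, hM.ac, x, hN.xa, hN.xc⟩ ⟨hN.bd, hM.bd, x, hN.xb, hN.xd⟩ hl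
      hN.ab hN.ad hN.bc.symm hN.cd
  have hxB : x ∉ B := hB.notp hN.xa hN.xc
  have key : ∀ n ∈ NC G B, (G.Adj a n ∧ G.Adj d n) ∨ (G.Adj c n ∧ G.Adj b n) := by
    intro n hn
    obtain ⟨hnB, hnd, hnp, hnq⟩ := hB.facts hn
    have e1 : ¬ (G.Adj a n ∧ G.Adj b n) := by
      rintro ⟨h1, h2⟩
      exact hxB (tri_uniq h hM.ab h1 hN.xa.symm h2 hN.xb.symm ▸ hnB)
    have e2 : ¬ (G.Adj c n ∧ G.Adj d n) := by
      rintro ⟨h1, h2⟩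
      exact hxB (tri_uniq h hM.cd h1 hN.xc.symm h2 hN.xd.symm ▸ hnB)
    tauto
  have nx : ∀ n ∈ NC G B, n ≠ x := by
    rintro n hn rfl
    exact hxB (hB.facts hn).1
  have t1 : ∀ n ∈ NC G B, ∀ m ∈ NC G B, n ≠ m → ¬ ((G.Adj a n ∧ G.Adj d n) ∧ (G.Adj a m ∧ G.Adj d m)) := by
    rintro n hn m hm hnm ⟨⟨h1, h2⟩, h3, h4⟩
    exact m2_two h hN.xa.symm hM.ab hN.xb hN.ad hnm h1 h3 h2 h4 (nx n hn) (nx m hm)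
      (hB.facts hn).2.1.2.2.1 (hB.facts hm).2.1.2.2.1
  have t2 : ∀ n ∈ NC G B, ∀ m ∈ NC G B, n ≠ m → ¬ ((G.Adj c n ∧ G.Adj b n) ∧ (G.Adj c m ∧ G.Adj b m)) := by
    rintro n hn m hm hnm ⟨⟨h1, h2⟩, h3, h4⟩
    exact m2_two h hN.xc.symm hM.cd hN.xd hN.bc.symm hnm h1 h3 h2 h4 (nx n hn) (nx m hm)
      (hB.facts hn).2.1.2.2.2 (hB.facts hm).2.1.2.2.2
  obtain ⟨n, hn, -⟩ := hB.three x x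
  obtain ⟨m, hm, hmn, -⟩ := hB.three n n
  obtain ⟨l, hl, hln, hlm⟩ := hB.three n m
  rcases key n hn with h1 | h1 <;> rcases key m hm with h2 | h2 <;> rcases key l hl with h3 | h3
  · exact t1 m hm n hn hmn ⟨h2, h1⟩
  · exact t1 m hm n hn hmn ⟨h2, h1⟩
  · exact t1 l hl n hn hln ⟨h3, h1⟩
  · exact t2 l hl m hm hlm ⟨h3, h2⟩
  · exact t1 l hl m hm hlm ⟨h3, h2⟩
  · exact t2 l hl n hn hln ⟨h3, h1⟩
  · exact t2 m hm n hn hmn ⟨h2, h1⟩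
  · exact t2 m hm n hn hmn ⟨h2, h1⟩

lemma M2.labne (h : Ctx G 4 Φ) {x a b c d : V} (hM : M2 G x a b c d) :
    lab G Φ b c ≠ lab G Φ b d := by
  intro hl
  have e1 := hM.labeq h
  have e2 := hM.s3.labeq h
  apply lab_nconst h hM.n (lab G Φ b c)
  · exact fun e => absurd hM.ab e
  · exact fun _ => by rw [e1, hl]
  · exact fun _ => e2
  · exact fun _ => rfl
  · exact fun _ => hl.symm
  · exact fun e => absurd hM.cd e

lemma M2.q4c (h : Ctx G 4 Φ) {x a b c d a' a'' : V} (hM : M2 G x a b c d)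
    (hA : M2 G a x b a' a'') (hl : lab G Φ x a' ≠ lab G Φ b d) :
    ∃ y z, M2 G a' a a'' y z ∧ G.Adj b y ∧ G.Adj d z ∧ c ≠ y ∧ c ≠ z := by
  have hkf := h.kfree le_rfl
  have hN := hM.n
  have hda' : d ≠ a' := by rintro rfl; exact hM.ad hA.n.xc
  have hda'' : d ≠ a'' := by rintro rfl; exact hM.ad hA.n.xd
  obtain ⟨B, hB⟩ := pairBad h hkf le_rfl (p := x) (p' := a') (q := b) (q' := d)
    ⟨hA.n.ac, hA.ac, a, hA.n.xa, hA.n.xc⟩ ⟨hN.bd, hM.bd, x, hN.xb, hN.xd⟩ hl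
    hN.xb.ne hN.xd.ne hA.n.bc.symm hda'.symm
  have haB : a ∉ B := hB.notp hA.n.xa hA.n.xc
  have ha''B : a'' ∉ B := hB.out haB ⟨hA.n.xa.ne, hA.n.xc.ne, hA.n.xb.ne, hN.ad⟩ hA.n.xd
  obtain ⟨y, z, hY⟩ := m2_of_tri h hA.n.xc.symm hA.cd hA.n.xd
  have hsub : ∀ n ∈ NC G B, n = c ∨ n = y ∨ n = z := by
    intro n hn
    obtain ⟨hnB, hnd, hnp, hnq⟩ := hB.facts hn
    rcases hnp with h1 | h1
    · rcases (hN.adj n).1 h1 with rfl | rfl | rfl | rfl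
      · exact absurd hnB haB
      · exact absurd rfl hnd.2.2.1
      · simp
      · exact absurd rfl hnd.2.2.2
    · rcases (hY.n.adj n).1 h1 with rfl | rfl | rfl | rfl
      · exact absurd hnB haB
      · exact absurd hnB ha''B
      · simp
      · simp
  obtain ⟨hcN, hyN, hzN, hcy, hcz, hyz⟩ := hB.NCsub hsub
  have fy := hB.facts hyN
  have fz := hB.facts hzN
  have two : ∀ w, a' ≠ w → ¬ (G.Adj w y ∧ G.Adj w z) := by
    rintro w hw ⟨h1, h2⟩
    exact hw (tri_uniq h hY.cd hY.n.xc.symm h1.symm hY.n.xd.symm h2.symm)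
  have tb := two b hA.n.bc.symm
  have td := two d hda'.symm
  rcases fy.2.2.2 with h1 | h1
  · rcases fz.2.2.2 with h2 | h2
    · exact absurd ⟨h1, h2⟩ tb
    · exact ⟨y, z, hY, h1, h2, hcy, hcz⟩
  · rcases fz.2.2.2 with h2 | h2
    · exact ⟨z, y, hY.s3, h2, h1, hcz, hcy⟩
    · exact absurd ⟨h1, h2⟩ td

lemma M2.final (h : Ctx G 4 Φ) {x a b c d a' a'' : V} (hM : M2 G x a b c d)
    (hA : M2 G a x b a' a'') (hl : lab G Φ x a' ≠ lab G Φ b d) : False := by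
  have hN := hM.n
  have n1 := hM.labne h
  have n2 := hA.s1.labne h
  have hl2 : lab G Φ x a'' ≠ lab G Φ b c := by
    revert hl n1 n2
    generalize lab G Φ x a' = i, lab G Φ x a'' = j, lab G Φ b c = k, lab G Φ b d = l
    cases i <;> cases j <;> cases k <;> cases l <;> simp
  obtain ⟨z1, z2, hZ, hz1, hz2, hd1, hd2⟩ := hM.s3.q4c h hA.s3 hl2
  obtain ⟨p, q, hb⟩ := m2_of_tri h hM.ab.symm hN.xb.symm hN.xa.symm
  have n3 := hb.labne h
  obtain ⟨r, s, hb', hl3⟩ : ∃ r s, M2 G b a x r s ∧ lab G Φ b a'' ≠ lab G Φ x s := by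
    by_cases e : lab G Φ b a'' = lab G Φ x p
    · exact ⟨p, q, hb, by rw [e]; exact n3⟩
    · exact ⟨q, p, hb.s3, e⟩
  obtain ⟨w1, w2, hW, hw1, hw2, -, -⟩ := hb'.q4c h hA.s1.s3 hl3
  have hw1z : w1 = z1 ∨ w1 = z2 := by
    rcases (hZ.n.adj w1).1 hW.n.xc with e | e | e | e
    · exact absurd e hW.n.ac.symm
    · exact absurd e hW.n.bc.symm
    · exact Or.inl e
    · exact Or.inr e
  rcases (hN.adj w1).1 hw1 with e | e | e | e
  · exact hW.n.ac e.symm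
  · exact hA.bd (e ▸ hW.n.xc).symm
  · rcases hw1z with e' | e'
    · exact hM.bc (by rw [← e, e']; exact hz1)
    · exact G.loopless.irrefl c (by rw [← e'.symm.trans e] at hz2 ⊢; exact (e'.symm.trans e ▸ hz2 : G.Adj c z2) |> fun h => by rw [← e'.symm.trans e] at h; exact h)
  · rcases hw1z with e' | e'
    · exact hd1 (e.symm.trans e')
    · exact hd2 (e.symm.trans e')

lemma no_four (h : Ctx G 4 Φ) (x : V) : False := by
  obtain ⟨a, ha⟩ : (nb G Finset.univ x).Nonempty := by
    rw [← Finset.card_pos, h.reg x]; norm_num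
  obtain ⟨b, c, d, hM⟩ := m2_ex h (mem_nb.1 ha).2
  obtain ⟨a', a'', hA⟩ := m2_of_tri h hM.n.xa.symm hM.ab hM.n.xb
  by_cases hl : lab G Φ x a' = lab G Φ b d
  · exact hM.s3.final h hA (by rw [hl]; exact (hM.labne h).symm)
  · exact hM.final h hA hl

end fourc

end part9

section part10

/-! ## Leaf components -/

lemma Conn.sub_closed {G : SimpleGraph V} {A S F : Finset V} (hA : Conn G A) (hAS : A ⊆ S)
    (hF : ∀ u ∈ F, ∀ w ∈ S, G.Adj u w → w ∈ F) {x : V} (hxA : x ∈ A) (hxF : x ∈ F) : A ⊆ F := by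
  have := hA.2 (A ∩ F) Finset.inter_subset_left ⟨x, Finset.mem_inter.2 ⟨hxA, hxF⟩⟩ (by
    intro u hu v hv huv
    rw [Finset.mem_inter] at *
    exact ⟨hv, hF u hu.2 v (hAS hv) huv⟩)
  rw [← this]
  exact Finset.inter_subset_right

lemma two_comp {G : SimpleGraph V} {S : Finset V} {v : V} (hv : v ∈ S) (hS : ¬ Conn G S) :
    ∃ E F, E ⊆ S ∧ F ⊆ S ∧ v ∈ E ∧ Conn G E ∧ Conn G F ∧ Disjoint E F ∧
      (∀ u ∈ E, ∀ w ∈ S, G.Adj u w → w ∈ E) ∧ (∀ u ∈ F, ∀ w ∈ S, G.Adj u w → w ∈ F) := by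
  obtain ⟨E, hE, hvE, hEc, hEcl⟩ := exists_comp (G := G) S hv
  have hne : E ≠ S := by rintro rfl; exact hS hEc
  obtain ⟨w, hwS, hwE⟩ := Finset.exists_of_ssubset (hE.ssubset_of_ne hne)
  obtain ⟨F, hF, hwF, hFc, hFcl⟩ := exists_comp (G := G) S hwS
  refine ⟨E, F, hE, hF, hvE, hEc, hFc, ?_, hEcl, hFcl⟩
  rw [Finset.disjoint_left]
  intro x hxE hxF
  exact hwE (hFc.sub_closed hF hEcl hxF hxE hwF)

structure Comp (G : SimpleGraph V) (B : Finset V) (z : V) (E : Finset V) : Prop where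
  zB : z ∈ B
  sub : E ⊆ B.erase z
  conn : Conn G E
  cl : ∀ u ∈ E, ∀ w ∈ B.erase z, G.Adj u w → w ∈ E
  neq : E ≠ B.erase z

lemma Comp.leaf {G : SimpleGraph V} {B : Finset V} (hB : Conn G B) (n : ℕ) :
    ∀ z E, E.card = n → Comp G B z E → ∃ z' E', Comp G B z' E' ∧ E' ⊆ E ∧ E' ⊆ NC G B := by
  induction n using Nat.strong_induction_on with
  | _ n ih =>
  intro z E hn hE
  by_cases hall : E ⊆ NC G B
  · exact ⟨z, E, hE, Finset.Subset.refl _, hall⟩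
  obtain ⟨e, heE, he⟩ := Finset.not_subset.1 hall
  have heB : e ∈ B := Finset.mem_of_mem_erase (hE.sub heE)
  have hec : ¬ Conn G (B.erase e) := fun h => he (mem_NC.2 ⟨heB, h⟩)
  have hez : e ≠ z := Finset.ne_of_mem_erase (hE.sub heE)
  have hzE : z ∉ E := fun h => Finset.notMem_erase z B (hE.sub h)
  have hA : Conn G (B \ E) := hB.sdiff_comp (conn_singleton G z) (by simpa using hE.zB)
    (by rw [Finset.sdiff_singleton_eq_erase]; exact hE.sub)
    (by rw [Finset.sdiff_singleton_eq_erase]; exact hE.cl)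
  have hAs : B \ E ⊆ B.erase e := by
    intro x hx
    rw [Finset.mem_sdiff] at hx
    exact Finset.mem_erase.2 ⟨by rintro rfl; exact hx.2 heE, hx.1⟩
  have hzA : z ∈ B \ E := Finset.mem_sdiff.2 ⟨hE.zB, hzE⟩
  obtain ⟨F0, F, hF0, hF, hzF0, hF0c, hFc, hd, hF0cl, hFcl⟩ :=
    two_comp (Finset.mem_erase.2 ⟨hez.symm, hE.zB⟩) hec
  have hAF0 : B \ E ⊆ F0 := hA.sub_closed hAs hF0cl hzA hzF0
  have hFE : F ⊆ E := by
    intro x hx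
    by_contra hxE
    exact Finset.disjoint_left.1 hd
      (hAF0 (Finset.mem_sdiff.2 ⟨Finset.mem_of_mem_erase (hF hx), hxE⟩)) hx
  have hzF : z ∉ F := fun h => hzE (hFE h)
  have heF : e ∉ F := fun h => Finset.notMem_erase e B (hF h)
  have hlt : F.card < E.card := Finset.card_lt_card
    (hFE.ssubset_of_ne (by rintro rfl; exact heF heE))
  obtain ⟨z', E', h1, h2, h3⟩ := ih F.card (hn ▸ hlt) e F rfl ⟨heB, hF, hFc, hFcl, by
    rintro rfl; exact hzF (Finset.mem_erase.2 ⟨hez.symm, hE.zB⟩)⟩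
  exact ⟨z', E', h1, h2.trans hFE, h3⟩

lemma two_leaves {G : SimpleGraph V} {B : Finset V} (hB : Conn G B) (h2 : 2 ≤ B.card)
    (hnc : ¬ B ⊆ NC G B) : ∃ z1 E1 z2 E2, Comp G B z1 E1 ∧ Comp G B z2 E2 ∧ E1 ⊆ NC G B ∧
      E2 ⊆ NC G B ∧ Disjoint E1 E2 := by
  obtain ⟨z, hz, hzn⟩ := Finset.not_subset.1 hnc
  have hzc : ¬ Conn G (B.erase z) := fun h => hzn (mem_NC.2 ⟨hz, h⟩)
  obtain ⟨v, hv⟩ : (B.erase z).Nonempty := by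
    rw [← Finset.card_pos, Finset.card_erase_of_mem hz]; omega
  obtain ⟨E, F, hE, hF, hvE, hEc, hFc, hd, hEcl, hFcl⟩ := two_comp hv hzc
  have hE' : Comp G B z E := ⟨hz, hE, hEc, hEcl, by
    rintro rfl
    obtain ⟨x, hx⟩ := hFc.1
    exact Finset.disjoint_left.1 hd (hF hx) hx⟩
  have hF' : Comp G B z F := ⟨hz, hF, hFc, hFcl, by
    rintro rfl
    exact Finset.disjoint_left.1 hd hvE (hE hvE)⟩
  obtain ⟨z1, E1, h1, h1s, h1n⟩ := Comp.leaf hB _ z E rfl hE'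
  obtain ⟨z2, E2, h2, h2s, h2n⟩ := Comp.leaf hB _ z F rfl hF'
  exact ⟨z1, E1, z2, E2, h1, h2, h1n, h2n, hd.mono h1s h2s⟩

/-! ## Structure of `PB` for `k ≥ 5` -/

section five
variable {G : SimpleGraph V} {k : ℕ}

def Clq (G : SimpleGraph V) (K : Finset V) : Prop := ∀ u ∈ K, ∀ v ∈ K, u ≠ v → G.Adj u v

lemma Clq.ins {K : Finset V} (h : Clq G K) {x : V} (hx : ∀ v ∈ K, G.Adj x v) :
    Clq G (insert x K) := by
  intro u hu v hv huv
  rw [Finset.mem_insert] at hu hv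
  rcases hu with rfl | hu <;> rcases hv with rfl | hv
  · exact absurd rfl huv
  · exact hx v hv
  · exact (hx u hu).symm
  · exact h u hu v hv huv

lemma Clq.mono {K L : Finset V} (h : Clq G K) (hL : L ⊆ K) : Clq G L :=
  fun u hu v hv => h u (hL hu) v (hL hv)

lemma pset1 (u v s t : V) : ({v, u, s, t} : Finset V) = {u, v, s, t} := by
  ext x; simp only [Finset.mem_insert, Finset.mem_singleton]; tauto
lemma pset2 (u v s t : V) : ({s, t, u, v} : Finset V) = {u, v, s, t} := by
  ext x; simp only [Finset.mem_insert, Finset.mem_singleton]; tauto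

lemma PB.sP {u v s t : V} {B : Finset V} (h : PB G k u v s t B) : PB G k v u s t B where
  disj b hb := by have := h.disj b hb; tauto
  closed b hb w hw := by have := h.closed b hb w hw; tauto
  conn := h.conn
  np b hb := by have := h.np b hb; tauto
  nq := h.nq
  ncp b hb := (h.ncp b hb).symm
  ncq := h.ncq
  ncdeg := h.ncdeg
  deg := by rw [pset1]; exact h.deg
  clique := h.clique
  ncard := h.ncard

lemma PB.sw {u v s t : V} {B : Finset V} (h : PB G k u v s t B) : PB G k s t u v B where
  disj b hb := by have := h.disj b hb; tauto
  closed b hb w hw := by have := h.closed b hb w hw; tauto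
  conn := h.conn
  np := h.nq
  nq := h.np
  ncp := h.ncq
  ncq := h.ncp
  ncdeg := h.ncdeg
  deg := by rw [pset2]; exact h.deg
  clique := h.clique
  ncard := h.ncard

lemma PB.sQ {u v s t : V} {B : Finset V} (h : PB G k u v s t B) : PB G k u v t s B :=
  h.sw.sP.sw

/-- two noncut vertices that are adjacent have the same closed neighbourhood -/
lemma PB.nbclique {u v s t : V} {B : Finset V} (h : PB G k u v s t B) (hk : 5 ≤ k) {b : V}
    (hb : b ∈ NC G B) : Clq G (insert b (nb G B b)) ∧ (insert b (nb G B b)).card = k - 1 ∧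
      insert b (nb G B b) ⊆ B := by
  refine ⟨nb_clique_insert (h.clique hk b hb), ?_, ?_⟩
  · rw [card_insert_nb, h.ncdeg b hb]; omega
  · exact Finset.insert_subset (mem_NC.1 hb).1 (Finset.filter_subset _ _)

lemma PB.nbeq {u v s t : V} {B K : Finset V} (h : PB G k u v s t B) (hk : 5 ≤ k) (hK : Clq G K)
    (hKB : K ⊆ B) (hKc : K.card = k - 1) {b : V} (hbK : b ∈ K)
    (hb : b ∈ NC G B) : nb G B b = K.erase b := by
  symm
  apply Finset.eq_of_subset_of_card_le
  · intro w hw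
    rw [Finset.mem_erase] at hw
    exact mem_nb.2 ⟨hKB hw.2, hK b hbK w hw.2 hw.1.symm⟩
  · rw [h.ncdeg b hb, Finset.card_erase_of_mem hbK, hKc]; omega

structure Leaf (G : SimpleGraph V) (k : ℕ) (u v s t : V) (B : Finset V) (z : V) (E : Finset V) :
    Prop where
  pb : PB G k u v s t B
  zB : z ∈ B
  EB : E ⊆ B
  zE : z ∉ E
  card : E.card = k - 2
  clq : Clq G E
  ez : ∀ e ∈ E, G.Adj e z
  nbE : ∀ e ∈ E, ∀ w ∈ B, G.Adj e w → w ∈ E ∨ w = z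
  nc : E ⊆ NC G B
  zo : ∃ w ∈ B, w ∉ E ∧ w ≠ z ∧ G.Adj z w

lemma PB.leaf {u v s t z : V} {B E : Finset V} (h : PB G k u v s t B) (hk : 5 ≤ k)
    (hC : Comp G B z E) (hE : E ⊆ NC G B) : Leaf G k u v s t B z E := by
  have hzE : z ∉ E := fun h => Finset.notMem_erase z B (hC.sub h)
  have hEB : E ⊆ B := hC.sub.trans (Finset.erase_subset _ _)
  obtain ⟨e, he, w, hw, hwE, hew⟩ := h.conn.exists_adj hEB hC.conn.1
    (by rintro rfl; exact hzE hC.zB)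
  have hwz : w = z := by
    by_contra hwz
    exact hwE (hC.cl e he w (Finset.mem_erase.2 ⟨hwz, hw⟩) hew)
  subst hwz
  obtain ⟨hK, hKc, hKB⟩ := h.nbclique hk (hE he)
  set K := insert e (nb G B e) with hKdef
  have heK : e ∈ K := Finset.mem_insert_self _ _
  have hwK : w ∈ K := Finset.mem_insert_of_mem (mem_nb.2 ⟨hw, hew⟩)
  have hKE : K.erase w ⊆ E := by
    intro x hx
    rw [Finset.mem_erase] at hx
    by_cases hxe : x = e
    · rw [hxe]; exact he
    · exact hC.cl e he x (Finset.mem_erase.2 ⟨hx.1, hKB hx.2⟩) (hK e heK x hx.2 (Ne.symm hxe))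
  have hEK : K.erase w = E := by
    apply hC.conn.2 _ hKE ⟨e, Finset.mem_erase.2 ⟨hew.ne, heK⟩⟩
    intro p hp q hq hpq
    have hpn := hE (hKE hp)
    rw [Finset.mem_erase] at hp
    have := h.nbeq hk hK hKB hKc hp.2 hpn
    have hq' : q ∈ nb G B p := mem_nb.2 ⟨hEB hq, hpq⟩
    rw [this, Finset.mem_erase] at hq'
    exact Finset.mem_erase.2 ⟨by rintro rfl; exact hzE hq, hq'.2⟩
  refine ⟨h, hw, hEB, hzE, ?_, ?_, ?_, ?_, hE, ?_⟩
  · rw [← hEK, Finset.card_erase_of_mem hwK, hKc]; omega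
  · exact hK.mono (by rw [← hEK]; exact Finset.erase_subset _ _)
  · intro x hx
    rw [← hEK, Finset.mem_erase] at hx
    exact hK x hx.2 w hwK hx.1
  · intro x hx y hy hxy
    by_cases hyw : y = w
    · exact Or.inr hyw
    · exact Or.inl (hC.cl x hx y (Finset.mem_erase.2 ⟨hyw, hy⟩) hxy)
  · have hA : Conn G (B \ E) := h.conn.sdiff_comp (conn_singleton G w) (by simpa using hC.zB)
      (by rw [Finset.sdiff_singleton_eq_erase]; exact hC.sub)
      (by rw [Finset.sdiff_singleton_eq_erase]; exact hC.cl)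
    obtain ⟨p, hp, q, hq, hqp, hpq⟩ := hA.exists_adj (T := {w}) (by
      simpa using ⟨hC.zB, hzE⟩) (by simp) (by
      intro heq
      apply hC.neq
      apply Finset.Subset.antisymm hC.sub
      intro x hx
      rw [Finset.mem_erase] at hx
      by_contra hxE
      have : x ∈ B \ E := Finset.mem_sdiff.2 ⟨hx.2, hxE⟩
      rw [← heq, Finset.mem_singleton] at this
      exact hx.1 this)
    rw [Finset.mem_singleton] at hp hqp
    subst hp
    rw [Finset.mem_sdiff] at hq
    exact ⟨q, hq.1, hq.2, hqp, hpq⟩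

lemma PB.two {u v s t : V} {B : Finset V} (h : PB G k u v s t B) (hk : 5 ≤ k) : 2 ≤ B.card := by
  have h1 := h.ncard
  have h2 : (NC G B).card ≤ B.card := Finset.card_le_card (fun x hx => (mem_NC.1 hx).1)
  omega

/-- Either `B` is a clique, or there is a leaf and there are many noncut vertices. -/
lemma PB.dich {u v s t : V} {B : Finset V} (h : PB G k u v s t B) (hk : 5 ≤ k) :
    (Clq G B ∧ B.card = k - 1 ∧ B ⊆ NC G B) ∨
    ((∃ z E, Leaf G k u v s t B z E) ∧ 2 * (k - 2) ≤ (NC G B).card) := by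
  by_cases hall : B ⊆ NC G B
  · left
    obtain ⟨b, hb⟩ := h.conn.1
    obtain ⟨hK, hKc, hKB⟩ := h.nbclique hk (hall hb)
    have : insert b (nb G B b) = B := by
      apply h.conn.2 _ hKB ⟨b, Finset.mem_insert_self _ _⟩
      intro p hp q hq hpq
      have := h.nbeq hk hK hKB hKc hp (hall (hKB hp))
      have hq' : q ∈ nb G B p := mem_nb.2 ⟨hq, hpq⟩
      rw [this, Finset.mem_erase] at hq'
      exact hq'.2
    rw [this] at hK hKc
    exact ⟨hK, hKc, hall⟩
  · right
    obtain ⟨z1, E1, z2, E2, h1, h2, h1n, h2n, hd⟩ := two_leaves h.conn (h.two hk) hall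
    have l1 := h.leaf hk h1 h1n
    have l2 := h.leaf hk h2 h2n
    refine ⟨⟨z1, E1, l1⟩, ?_⟩
    have := Finset.card_le_card (Finset.union_subset h1n h2n)
    rw [Finset.card_union_of_disjoint hd, l1.card, l2.card] at this
    omega

variable [Fintype V] {Φ : (V → Fin k) → Bool}

lemma Ctx.mono (h : Ctx G k Φ) (hkf : KFree G k) (hk : 4 ≤ k) {a b : V} (hab : D2 G a b) :
    ∃ c : V → Fin k, ProperOn G Finset.univ c ∧ c a = c b := by
  obtain ⟨c, hc, hS⟩ := lemmaI h hkf hk {a, b} (by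
    intro u hu v hv
    simp only [Finset.mem_insert, Finset.mem_singleton] at hu hv
    have := hab.2.1
    have : ¬ G.Adj b a := fun e => hab.2.1 e.symm
    rcases hu with rfl | rfl <;> rcases hv with rfl | rfl <;>
      first | assumption | exact G.loopless.irrefl _)
  exact ⟨c, hc, hS a (by simp) b (by simp)⟩

lemma Ctx.cne (h : Ctx G k Φ) {a b p q : V} (hab : D2 G a b) (hpq : D2 G p q)
    (hl : lab G Φ a b ≠ lab G Φ p q) {c : V → Fin k} (hc : ProperOn G Finset.univ c)
    (he : c p = c q) : c a ≠ c b := by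
  intro hh
  exact hl (by rw [h.col hab hc hh, h.col hpq hc he])

lemma Ctx.lab3 (h : Ctx G k Φ) (hkf : KFree G k) (hk : 4 ≤ k) {a b c : V}
    (hab : D2 G a b) (hac : D2 G a c) (hbc : ¬ G.Adj b c) : lab G Φ a b = lab G Φ a c := by
  apply h.lab_indep hkf hk {a, b, c} _ (by simp) (by simp) (by simp) (by simp) hab hac
  intro u hu v hv
  simp only [Finset.mem_insert, Finset.mem_singleton] at hu hv
  have := hab.2.1
  have := hac.2.1
  have : ¬ G.Adj b a := fun e => hab.2.1 e.symm
  have : ¬ G.Adj c a := fun e => hac.2.1 e.symm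
  have : ¬ G.Adj c b := fun e => hbc e.symm
  rcases hu with rfl | rfl | rfl <;> rcases hv with rfl | rfl | rfl <;>
    first | assumption | exact G.loopless.irrefl _

/-- colours used on a clique -/
lemma clq_inj {K : Finset V} (hK : Clq G K) {c : V → Fin k} (hc : ProperOn G Finset.univ c) :
    (K.image c).card = K.card := by
  apply Finset.card_image_of_injOn
  intro u hu v hv huv
  by_contra hne
  exact hc u (by simp) v (by simp) (hK u hu v hv hne) huv

lemma clq_avoid {K S : Finset V} (hK : Clq G K) {c : V → Fin k} (hc : ProperOn G Finset.univ c)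
    (hS : ∀ x ∈ S, ∀ e ∈ K, c e ≠ c x) : K.card + (S.image c).card ≤ k := by
  rw [← clq_inj hK hc, ← Finset.card_union_of_disjoint]
  · exact (Finset.card_le_univ _).trans (by simp)
  · rw [Finset.disjoint_left]
    intro i hi hi'
    rw [Finset.mem_image] at hi hi'
    obtain ⟨e, he, rfl⟩ := hi
    obtain ⟨x, hx, hxe⟩ := hi'
    exact hS x hx e he hxe.symm

lemma lemmaT (h : Ctx G k Φ) (hkf : KFree G k) (hk : 4 ≤ k) {K : Finset V} (hK : Clq G K)
    (hKc : K.card = k - 2) {a b c : V} (ha : ∀ e ∈ K, G.Adj e a) (hb : ∀ e ∈ K, G.Adj e b)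
    (hc : ∀ e ∈ K, G.Adj e c) (hab : a ≠ b) (hac : a ≠ c) (hbc : b ≠ c) : False := by
  obtain ⟨e, he⟩ : K.Nonempty := by rw [← Finset.card_pos]; omega
  have nadj : ∀ x y, (∀ e ∈ K, G.Adj e x) → (∀ e ∈ K, G.Adj e y) → x ≠ y → ¬ G.Adj x y := by
    intro x y hx hy hxy hadj
    have h1 : Clq G (insert x (insert y K)) := (hK.ins (fun v hv => (hy v hv).symm)).ins (by
      intro v hv
      rcases Finset.mem_insert.1 hv with rfl | hv
      · exact hadj
      · exact (hx v hv).symm)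
    have := hkf _ h1
    rw [Finset.card_insert_of_notMem, Finset.card_insert_of_notMem, hKc] at this
    · omega
    · exact fun hh => G.loopless.irrefl _ (hy y hh)
    · rw [Finset.mem_insert]
      rintro (rfl | hh)
      · exact hxy rfl
      · exact G.loopless.irrefl _ (hx x hh)
  have dab : D2 G a b := ⟨hab, nadj a b ha hb hab, e, ha e he, hb e he⟩
  have dac : D2 G a c := ⟨hac, nadj a c ha hc hac, e, ha e he, hc e he⟩
  have dbc : D2 G b c := ⟨hbc, nadj b c hb hc hbc, e, hb e he, hc e he⟩
  have l1 := h.lab3 hkf hk dab dac dbc.2.1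
  have l2 := h.lab3 hkf hk dab.symm dbc dac.2.1
  rw [lab_comm] at l2
  have all : ∀ f, ProperOn G Finset.univ f → Φ f = lab G Φ a b := by
    intro f hf
    by_cases e1 : f a = f b
    · exact (h.col dab hf e1).symm
    by_cases e2 : f a = f c
    · rw [l1]; exact (h.col dac hf e2).symm
    by_cases e3 : f b = f c
    · rw [l2]; exact (h.col dbc hf e3).symm
    exfalso
    have := clq_avoid (S := {a, b, c}) hK hf (by
      intro x hx e he
      simp only [Finset.mem_insert, Finset.mem_singleton] at hx
      apply hf e (by simp) x (by simp)
      rcases hx with rfl | rfl | rfl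
      · exact ha e he
      · exact hb e he
      · exact hc e he)
    rw [Finset.image_insert, Finset.image_insert, Finset.image_singleton,
      Finset.card_eq_three.2 ⟨f a, f b, f c, e1, e2, e3, rfl⟩, hKc] at this
    omega
  obtain ⟨f, hf, hft⟩ := h.ex true
  obtain ⟨g, hg, hgf⟩ := h.ex false
  have h1 := all f hf
  have h2 := all g hg
  rw [hft] at h1; rw [hgf] at h2
  exact Bool.noConfusion (h1.trans h2.symm)

/-- recolouring inside a clique -/
lemma cliqueRecolour (h : Ctx G k Φ) {E : Finset V} (hE : Clq G E) {f : V → Fin k}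
    (hf : ProperOn G Finset.univ f) {p p' s b b' : V} (hp : D2 G p p') (hfp : f p = f p')
    (hpE : p ∉ E) (hpE' : p' ∉ E) (hsE : s ∉ E) (hb : b ∈ E) (hb' : b' ∈ E) (hbb : b ≠ b')
    (hbs' : G.Adj b' s) (hbs : ¬ G.Adj b s) (hav : ∀ w, w ∉ E → G.Adj b w → f w ≠ f s) :
    D2 G s b ∧ lab G Φ s b = lab G Φ p p' := by
  have hk := h.hk
  have hD2 : D2 G s b := ⟨by rintro rfl; exact hsE hb, fun e => hbs e.symm, b', hbs',
    hE b' hb' b hb hbb.symm⟩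
  refine ⟨hD2, ?_⟩
  by_contra hl
  let D : Finset V := Finset.univ \ (E.erase b)
  let c0 := Function.update f b (f s)
  have hD : ∀ w, w ∈ D ↔ (w ∉ E ∨ w = b) := by
    intro w
    simp only [D, Finset.mem_sdiff, Finset.mem_univ, true_and, Finset.mem_erase]
    tauto
  have hc0 : ∀ w, w ≠ b → c0 w = f w := fun w hw => Function.update_of_ne hw _ _
  have hc0b : c0 b = f s := Function.update_self _ _ _
  have hne : ∀ w, w ∉ E → w ≠ b := by rintro w hw rfl; exact hw hb
  obtain ⟨B, hB⟩ := pre (by omega) h.reg D c0 (by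
    intro x hx y hy hxy
    rw [hD] at hx hy
    by_cases hxb : x = b
    · subst hxb
      have hyE : y ∉ E := by
        rcases hy with hy | hy
        · exact hy
        · exact absurd hy hxy.ne'
      rw [hc0b, hc0 y (hne y hyE)]
      exact (hav y hyE hxy).symm
    · by_cases hyb : y = b
      · subst hyb
        have hxE := hx.resolve_right hxb
        rw [hc0b, hc0 x hxb]
        exact hav x hxE hxy.symm
      · rw [hc0 x hxb, hc0 y hyb]
        exact hf x (by simp) y (by simp) hxy) (by
    rintro ⟨c, hc, hcD⟩
    apply hl
    have e1 : ∀ w, w ∉ E → c w = f w := fun w hw => by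
      rw [hcD w ((hD w).2 (Or.inl hw)), hc0 w (hne w hw)]
    rw [h.col hD2 hc (by rw [e1 s hsE, hcD b ((hD b).2 (Or.inr rfl)), hc0b]),
      h.col hp hc (by rw [e1 p hpE, e1 p' hpE', hfp])])
  obtain ⟨x, hx⟩ := hB.bad.conn.1
  have hxD := hB.disj x hx
  have hxE : x ∈ E := by
    by_contra hh; exact hxD ((hD x).2 (Or.inl hh))
  have hb'D : b' ∉ D := by
    rw [hD]; push Not; exact ⟨hb', hbb.symm⟩
  have hb'B : b' ∈ B := by
    by_cases hxb : x = b'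
    · rw [← hxb]; exact hx
    · exact hB.closed x hx b' (hE x hxE b' hb' hxb) hb'D
  have := hB.inj h.reg hb'B s ((hD s).2 (Or.inl hsE)) b ((hD b).2 (Or.inr rfl)) hbs'
    (hE b' hb' b hb hbb.symm) (by rw [hc0b, hc0 s (hne s hsE)])
  exact hne s hsE this

end five

end part10

section part11

section five
variable {G : SimpleGraph V} {k : ℕ}

lemma Leaf.sP {u v s t z : V} {B E : Finset V} (h : Leaf G k u v s t B z E) :
    Leaf G k v u s t B z E :=
  ⟨h.pb.sP, h.zB, h.EB, h.zE, h.card, h.clq, h.ez, h.nbE, h.nc, h.zo⟩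
lemma Leaf.sw {u v s t z : V} {B E : Finset V} (h : Leaf G k u v s t B z E) :
    Leaf G k s t u v B z E :=
  ⟨h.pb.sw, h.zB, h.EB, h.zE, h.card, h.clq, h.ez, h.nbE, h.nc, h.zo⟩
lemma Leaf.sQ {u v s t z : V} {B E : Finset V} (h : Leaf G k u v s t B z E) :
    Leaf G k u v t s B z E := h.sw.sP.sw

lemma PB.mem4 {u v s t : V} {B : Finset V} (h : PB G k u v s t B) {b : V} (hb : b ∈ B) :
    b ∉ ({u, v, s, t} : Finset V) := by
  have := h.disj b hb
  simp only [Finset.mem_insert, Finset.mem_singleton]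
  tauto

/-- a vertex of `B` adjacent to an outside vertex -/
lemma PB.outw {u v s t : V} {B : Finset V} (h : PB G k u v s t B) {x y : V} (hy : y ∉ B)
    (hyu : y ≠ u) (hyv : y ≠ v) (hys : y ≠ s) (hyt : y ≠ t) (hxy : G.Adj x y) : x ∉ B := by
  intro hx
  rcases h.closed x hx y hxy with e | e | e | e | e
  · exact hyu e
  · exact hyv e
  · exact hys e
  · exact hyt e
  · exact hy e

lemma Leaf.nbr {u v s t z : V} {B E : Finset V} (h : Leaf G k u v s t B z E) {e x : V}
    (he : e ∈ E) (hx : G.Adj e x) : x ∈ E ∨ x = z ∨ x = u ∨ x = v ∨ x = s ∨ x = t := by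
  rcases h.pb.closed e (h.EB he) x hx with e1 | e1 | e1 | e1 | e1
  · exact Or.inr (Or.inr (Or.inl e1))
  · exact Or.inr (Or.inr (Or.inr (Or.inl e1)))
  · exact Or.inr (Or.inr (Or.inr (Or.inr (Or.inl e1))))
  · exact Or.inr (Or.inr (Or.inr (Or.inr (Or.inr e1))))
  · rcases h.nbE e he x e1 hx with e2 | e2
    · exact Or.inl e2
    · exact Or.inr (Or.inl e2)

lemma Leaf.zdeg {u v s t z : V} {B E : Finset V} (h : Leaf G k u v s t B z E) (hk : 5 ≤ k) :
    k - 1 ≤ (nb G B z).card := by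
  obtain ⟨w, hw, hwE, hwz, hzw⟩ := h.zo
  have : insert w E ⊆ nb G B z := by
    intro x hx
    rcases Finset.mem_insert.1 hx with rfl | hx
    · exact mem_nb.2 ⟨hw, hzw⟩
    · exact mem_nb.2 ⟨h.EB hx, (h.ez x hx).symm⟩
  have := Finset.card_le_card this
  rw [Finset.card_insert_of_notMem hwE, h.card] at this
  omega

lemma Leaf.z1 {u v s t z : V} {B E : Finset V} (h : Leaf G k u v s t B z E) (hk : 5 ≤ k) {a b : V}
    (ha : a ∈ ({u, v, s, t} : Finset V)) (hb : b ∈ ({u, v, s, t} : Finset V)) (hza : G.Adj z a)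
    (hzb : G.Adj z b) : a = b := by
  have h1 := h.zdeg hk
  have h2 := h.pb.deg z h.zB
  have h3 : (nb G {u, v, s, t} z).card ≤ 1 := by omega
  exact Finset.card_le_one.1 h3 a (mem_nb.2 ⟨ha, hza⟩) b (mem_nb.2 ⟨hb, hzb⟩)

variable [Fintype V] {Φ : (V → Fin k) → Bool}

structure Dis (G : SimpleGraph V) (Φ : (V → Fin k) → Bool) (u v s t : V) : Prop where
  p : D2 G u v
  q : D2 G s t
  l : lab G Φ u v ≠ lab G Φ s t
  us : u ≠ s
  ut : u ≠ t
  vs : v ≠ s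
  vt : v ≠ t

lemma Dis.sP {u v s t : V} (d : Dis G Φ u v s t) : Dis G Φ v u s t :=
  ⟨d.p.symm, d.q, by rw [lab_comm]; exact d.l, d.vs, d.vt, d.us, d.ut⟩
lemma Dis.sw {u v s t : V} (d : Dis G Φ u v s t) : Dis G Φ s t u v :=
  ⟨d.q, d.p, d.l.symm, d.us.symm, d.vs.symm, d.ut.symm, d.vt.symm⟩
lemma Dis.sQ {u v s t : V} (d : Dis G Φ u v s t) : Dis G Φ u v t s := d.sw.sP.sw

lemma Dis.pb {u v s t : V} (d : Dis G Φ u v s t) (h : Ctx G k Φ) (hkf : KFree G k) (hk : 5 ≤ k) :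
    ∃ B, PB G k u v s t B := pairBad h hkf (by omega) d.p d.q d.l d.us d.ut d.vs d.vt

/-- `z` far from `s`,`t` -/
lemma Leaf.zq {u v s t z : V} {B E : Finset V} (l : Leaf G k u v s t B z E)
    (d : Dis G Φ u v s t) (h : Ctx G k Φ) (hkf : KFree G k) (hk : 5 ≤ k)
    (hzs : ¬ G.Adj z s) (hzt : ¬ G.Adj z t) {e : V} (he : e ∈ E) (hes : G.Adj e s) :
    D2 G z s ∧ lab G Φ z s = lab G Φ s t := by
  have hd : D2 G z s := ⟨(l.pb.disj z l.zB).2.2.1, hzs, e, l.ez e he, hes⟩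
  refine ⟨hd, ?_⟩
  rw [lab_comm]
  exact h.lab3 hkf (by omega) hd.symm d.q hzt

lemma Leaf.Qsw {u v s t z : V} {B E : Finset V} (l : Leaf G k u v s t B z E)
    (d : Dis G Φ u v s t) (h : Ctx G k Φ) (hkf : KFree G k) (hk : 5 ≤ k)
    (hzs : ¬ G.Adj z s) (hzt : ¬ G.Adj z t) {b b' w : V} (hb : b ∈ E) (hb' : b' ∈ E)
    (hbt : G.Adj b t) (hbs' : G.Adj b' s) (hw : w = u ∨ w = v) (hbw : G.Adj b w)
    {f : V → Fin k} (hf : ProperOn G Finset.univ f) (hfu : f u = f v) (hfs : f s ≠ f u) :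
    ∃ B', PB G k s b z t B' ∧ (∀ e ∈ E, e ∉ B') ∧ (∀ x ∈ NC G B', G.Adj x s ∨ x = w) := by
  obtain ⟨dzs, lzs⟩ := l.zq d h hkf hk hzs hzt hb' hbs'
  obtain ⟨dzt, lzt⟩ := l.sQ.zq d.sQ h hkf hk hzt hzs hb hbt
  rw [lab_comm t s] at lzt
  have hnE : ∀ x ∈ E, x ≠ u ∧ x ≠ v ∧ x ≠ s ∧ x ≠ t := fun x hx => l.pb.disj x (l.EB hx)
  have hbs : ¬ G.Adj b s := fun e => l.pb.nq b (l.EB hb) ⟨e, hbt⟩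
  have hbb : b ≠ b' := by rintro rfl; exact hbs hbs'
  have hwo : ∀ x, x = u ∨ x = v → G.Adj b x → x = w := by
    intro x hx hbx
    have := l.pb.np b (l.EB hb)
    rcases hw with rfl | rfl <;> rcases hx with rfl | rfl
    · rfl
    · exact absurd ⟨hbw, hbx⟩ this
    · exact absurd ⟨hbx, hbw⟩ this
    · rfl
  have hfw : f w = f u := by rcases hw with rfl | rfl; rfl; exact hfu.symm
  obtain ⟨dsb, lsb⟩ := cliqueRecolour h l.clq hf d.p hfu (fun hh => (hnE u hh).1 rfl)
    (fun hh => (hnE v hh).2.1 rfl) (fun hh => (hnE s hh).2.2.1 rfl) hb hb' hbb hbs' hbs (by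
    intro x hxE hbx
    rcases l.nbr hb hbx with e | e | e | e | e | e
    · exact absurd e hxE
    · rw [e]; exact h.cne dzs d.p (by rw [lzs]; exact d.l.symm) hf hfu
    · rw [hwo x (Or.inl e) hbx, hfw]; exact hfs.symm
    · rw [hwo x (Or.inr e) hbx, hfw]; exact hfs.symm
    · rw [e] at hbx; exact absurd hbx hbs
    · rw [e]; exact (h.cne d.q d.p d.l.symm hf hfu).symm)
  have hzE := l.zE
  have D' : Dis G Φ s b z t := ⟨dsb, dzt, by rw [lsb, lzt]; exact d.l, dzs.1.symm, d.q.1,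
    (by rintro rfl; exact hzE hb), (hnE b hb).2.2.2⟩
  obtain ⟨B', hB'⟩ := D'.pb h hkf hk
  have hEo : ∀ e ∈ E, e ∉ B' := by
    have h1 : b' ∉ B' := fun hh => hB'.np b' hh ⟨hbs', l.clq b' hb' b hb hbb.symm⟩
    intro e he
    by_cases heb : e = b'
    · rw [heb]; exact h1
    · exact hB'.outw h1 (hnE b' hb').2.2.1 hbb.symm (by rintro rfl; exact hzE hb')
        (hnE b' hb').2.2.2 (l.clq e he b' hb' heb)
  refine ⟨B', hB', hEo, ?_⟩
  intro x hx
  have hxB := (mem_NC.1 hx).1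
  rcases hB'.ncp x hx with e | e
  · exact Or.inl e
  · right
    have hdx := hB'.disj x hxB
    rcases l.nbr hb e.symm with e1 | e1 | e1 | e1 | e1 | e1
    · exact absurd hxB (hEo x e1)
    · exact absurd e1 hdx.2.2.1
    · exact hwo x (Or.inl e1) e.symm
    · exact hwo x (Or.inr e1) e.symm
    · exact absurd e1 hdx.1
    · exact absurd e1 hdx.2.2.2

lemma card_sub_nb (h : Ctx G k Φ) {S : Finset V} {s x y : V} (hS : ∀ a ∈ S, G.Adj a s)
    (hx : G.Adj x s) (hy : G.Adj y s) (hxy : x ≠ y) (hxS : x ∉ S) (hyS : y ∉ S) :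
    S.card + 2 ≤ k := by
  have : insert x (insert y S) ⊆ nb G Finset.univ s := by
    intro a ha
    simp only [Finset.mem_insert] at ha
    rw [mem_nb]
    refine ⟨by simp, ?_⟩
    rcases ha with rfl | rfl | ha
    · exact hx.symm
    · exact hy.symm
    · exact (hS a ha).symm
  have := Finset.card_le_card this
  rw [h.reg, Finset.card_insert_of_notMem (by
    rw [Finset.mem_insert]; rintro (e | e); exact hxy e; exact hxS e),
    Finset.card_insert_of_notMem hyS] at this
  omega

/-- case (1), Q-switch -/
lemma Leaf.case1 {u v s t z : V} {B E : Finset V} (l : Leaf G k u v s t B z E)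
    (d : Dis G Φ u v s t) (h : Ctx G k Φ) (hkf : KFree G k) (hk : 5 ≤ k)
    (hzu : ¬ G.Adj z u) (hzv : ¬ G.Adj z v)
    (hzs : ¬ G.Adj z s) (hzt : ¬ G.Adj z t) {b b' : V} (hb : b ∈ E) (hb' : b' ∈ E)
    (hbt : G.Adj b t) (hbs' : G.Adj b' s) : False := by
  obtain ⟨w, hw, hbw⟩ : ∃ w, (w = u ∨ w = v) ∧ G.Adj b w := by
    rcases l.pb.ncp b (l.nc hb) with e | e
    · exact ⟨u, Or.inl rfl, e⟩
    · exact ⟨v, Or.inr rfl, e⟩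
  obtain ⟨dzs, lzs⟩ := l.zq d h hkf hk hzs hzt hb' hbs'
  have hws : G.Adj w s := by
    by_contra hn
    rcases hw with rfl | rfl
    · obtain ⟨dzw, lzw⟩ := l.sw.zq d.sw h hkf hk hzu hzv hb hbw
      exact d.l (by rw [← lzw, ← lzs]; exact h.lab3 hkf (by omega) dzw dzs hn)
    · obtain ⟨dzw, lzw⟩ := l.sw.sQ.zq d.sw.sQ h hkf hk hzv hzu hb hbw
      exact d.l (by rw [lab_comm, ← lzw, ← lzs]; exact h.lab3 hkf (by omega) dzw dzs hn)
  obtain ⟨f, hf, hfu⟩ := h.mono hkf (by omega) d.p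
  have hfs : f s ≠ f u := by
    have := hf w (by simp) s (by simp) hws
    rcases hw with rfl | rfl
    · exact this.symm
    · rw [hfu]; exact this.symm
  obtain ⟨B', hB', hEo, hx⟩ := l.Qsw d h hkf hk hzs hzt hb hb' hbt hbs' hw hbw hf hfu hfs
  have hwB : w ∉ B' := fun hh => hB'.np w hh ⟨hws, hbw.symm⟩
  have hb4 := l.pb.disj b' (l.EB hb')
  have := card_sub_nb h (S := NC G B') (s := s) (x := b') (y := w) (by
    intro a ha
    rcases hx a ha with e | e
    · exact e
    · rw [e]; exact hws) hbs' hws (by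
      rcases hw with rfl | rfl
      · exact hb4.1
      · exact hb4.2.1) (fun hh => hEo b' hb' (mem_NC.1 hh).1) (fun hh => hwB (mem_NC.1 hh).1)
  have := hB'.ncard
  omega

end five

end part11

section part12

section five
variable {G : SimpleGraph V} {k : ℕ} [Fintype V] {Φ : (V → Fin k) → Bool}

lemma kfree_no (hkf : KFree G k) {K : Finset V} (hk : 5 ≤ k) (hK : Clq G K) (hc : K.card = k - 1)
    {s : V} (hs : ∀ x ∈ K, G.Adj x s) : False := by
  have := hkf _ (hK.ins (fun v hv => (hs v hv).symm))
  rw [Finset.card_insert_of_notMem (fun hh => G.loopless.irrefl _ (hs s hh))] at this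
  omega

/-- case (2), Q-switch with good colouring -/
lemma Leaf.case2a {u v s t z : V} {B E : Finset V} (l : Leaf G k u v s t B z E)
    (d : Dis G Φ u v s t) (h : Ctx G k Φ) (hkf : KFree G k) (hk : 5 ≤ k)
    (hzu : G.Adj z u) {b b' : V} (hb : b ∈ E) (hb' : b' ∈ E)
    (hbt : G.Adj b t) (hbs' : G.Adj b' s)
    {f : V → Fin k} (hf : ProperOn G Finset.univ f) (hfu : f u = f v) (hfs : f s ≠ f u) :
    False := by
  have hzv : ¬ G.Adj z v := fun e => d.p.1 (l.z1 hk (by simp) (by simp) hzu e)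
  have hzs : ¬ G.Adj z s := fun e => d.us (l.z1 hk (by simp) (by simp) hzu e)
  have hzt : ¬ G.Adj z t := fun e => d.ut (l.z1 hk (by simp) (by simp) hzu e)
  obtain ⟨w, hw, hbw⟩ : ∃ w, (w = u ∨ w = v) ∧ G.Adj b w := by
    rcases l.pb.ncp b (l.nc hb) with e | e
    · exact ⟨u, Or.inl rfl, e⟩
    · exact ⟨v, Or.inr rfl, e⟩
  obtain ⟨B', hB', hEo, hx⟩ := l.Qsw d h hkf hk hzs hzt hb hb' hbt hbs' hw hbw hf hfu hfs
  have hPadj : ∀ x y, (x = u ∨ x = v) → (y = u ∨ y = v) → ¬ G.Adj x y := by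
    intro x y hx hy hxy
    rcases hx with rfl | rfl <;> rcases hy with rfl | rfl
    · exact G.loopless.irrefl _ hxy
    · exact d.p.2.1 hxy
    · exact d.p.2.1 hxy.symm
    · exact G.loopless.irrefl _ hxy
  rcases hB'.dich hk with ⟨hC, hCc, hCn⟩ | ⟨_, hc⟩
  swap
  · have : NC G B' ⊆ insert w ((nb G Finset.univ s).erase b') := by
      intro x hxN
      rcases hx x hxN with e | e
      · apply Finset.mem_insert_of_mem
        rw [Finset.mem_erase, mem_nb]
        exact ⟨by rintro rfl; exact hEo x hb' (mem_NC.1 hxN).1, by simp, e.symm⟩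
      · rw [e]; exact Finset.mem_insert_self _ _
    have h1 := Finset.card_le_card this
    have h2 := Finset.card_insert_le w ((nb G Finset.univ s).erase b')
    rw [Finset.card_erase_of_mem (mem_nb.2 ⟨by simp, hbs'.symm⟩), h.reg] at h2
    omega
  by_cases hwB : w ∈ B'
  swap
  · exact kfree_no hkf hk hC hCc (s := s) (by
      intro x hxB
      rcases hx x (hCn hxB) with e | e
      · exact e
      · exact absurd (e ▸ hxB) hwB)
  have hwd := hB'.disj w hwB
  set Y := B'.erase w with hY
  have hYc : Y.card = k - 2 := by rw [hY, Finset.card_erase_of_mem hwB, hCc]; omega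
  have hYs : ∀ y ∈ Y, G.Adj y s := by
    intro y hy
    rw [hY, Finset.mem_erase] at hy
    exact (hx y (hCn hy.2)).resolve_right hy.1
  have hYw : ∀ y ∈ Y, G.Adj y w := by
    intro y hy
    rw [hY, Finset.mem_erase] at hy
    exact hC y hy.2 w hwB hy.1
  have hYB : ∀ y ∈ Y, y ∈ B' := fun y hy => Finset.mem_of_mem_erase hy
  -- a vertex adjacent to z
  have hznb : ∀ y ∈ Y, G.Adj y z → y ∈ B := by
    intro y hy hyz
    rcases l.pb.closed z l.zB y hyz.symm with e | e | e | e | e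
    · exact absurd (hYw y hy) (hPadj y w (Or.inl e) hw)
    · exact absurd (hYw y hy) (hPadj y w (Or.inr e) hw)
    · rw [e] at hyz; exact absurd hyz.symm hzs
    · rw [e] at hyz; exact absurd hyz.symm hzt
    · exact e
  obtain ⟨y, hy, hyt⟩ : ∃ y ∈ Y, ¬ G.Adj y t := by
    by_contra hcon
    push Not at hcon
    exact lemmaT h hkf (by omega) (hC.mono (Finset.erase_subset _ _)) hYc hYs hcon hYw d.q.1
      hwd.1.symm hwd.2.2.2.symm
  have hyz : G.Adj y z := (hB'.ncq y (hCn (hYB y hy))).resolve_right hyt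
  have hyB := hznb y hy hyz
  obtain ⟨y', hy', hne⟩ : ∃ y' ∈ Y, y' ≠ y := by
    have : 1 < Y.card := by omega
    exact Finset.exists_mem_ne this y
  have hyy : G.Adj y y' := hC y (hYB y hy) y' (hYB y' hy') hne.symm
  have hyE : ∀ x ∈ Y, x ∉ E := fun x hx hh => hEo x hh (hYB x hx)
  have hyz' : ¬ G.Adj y' z := by
    intro hh
    have hyB' := hznb y' hy' hh
    have : insert y (insert y' E) ⊆ nb G B z := by
      intro x hx
      simp only [Finset.mem_insert] at hx
      rw [mem_nb]
      rcases hx with rfl | rfl | hx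
      · exact ⟨hyB, hyz.symm⟩
      · exact ⟨hyB', hh.symm⟩
      · exact ⟨l.EB hx, (l.ez x hx).symm⟩
    have h1 := Finset.card_le_card this
    rw [Finset.card_insert_of_notMem (by
      rw [Finset.mem_insert]; rintro (e | e); exact hne e.symm; exact hyE y hy e),
      Finset.card_insert_of_notMem (hyE y' hy'), l.card] at h1
    have h2 := l.pb.deg z l.zB
    have h3 : 0 < (nb G {u, v, s, t} z).card := Finset.card_pos.2 ⟨u, mem_nb.2 ⟨by simp, hzu⟩⟩
    omega
  have hyt' : G.Adj y' t := (hB'.ncq y' (hCn (hYB y' hy'))).resolve_left hyz'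
  rcases l.pb.closed y hyB y' hyy with e | e | e | e | e
  · exact hPadj y' w (Or.inl e) hw (hYw y' hy')
  · exact hPadj y' w (Or.inr e) hw (hYw y' hy')
  · exact (hYs y' hy').ne e
  · exact hyt'.ne e
  · exact l.pb.nq y' e ⟨hYs y' hy', hyt'⟩

lemma Leaf.case2b {u v s t z : V} {B E : Finset V} (l : Leaf G k u v s t B z E)
    (d : Dis G Φ u v s t) (h : Ctx G k Φ) (hkf : KFree G k) (hk : 5 ≤ k)
    (hzu : G.Adj z u) (hs : ∀ e ∈ E, G.Adj e s) : False := by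
  have hzv : ¬ G.Adj z v := fun e => d.p.1 (l.z1 hk (by simp) (by simp) hzu e)
  have hzs : ¬ G.Adj z s := fun e => d.us (l.z1 hk (by simp) (by simp) hzu e)
  have hzt : ¬ G.Adj z t := fun e => d.ut (l.z1 hk (by simp) (by simp) hzu e)
  have hnE : ∀ x ∈ E, x ≠ u ∧ x ≠ v ∧ x ≠ s ∧ x ≠ t := fun x hx => l.pb.disj x (l.EB hx)
  have hz4 := l.pb.disj z l.zB
  obtain ⟨c, hc, hcu⟩ : ∃ c ∈ E, ¬ G.Adj c u := by
    by_contra hcon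
    push Not at hcon
    exact lemmaT h hkf (by omega) l.clq l.card l.ez hcon hs hz4.1 hz4.2.2.1 d.us
  obtain ⟨c', hc', hcv'⟩ : ∃ c ∈ E, ¬ G.Adj c v := by
    by_contra hcon
    push Not at hcon
    exact lemmaT h hkf (by omega) l.clq l.card l.ez hcon hs hz4.2.1 hz4.2.2.1 d.vs
  have hcv : G.Adj c v := (l.pb.ncp c (l.nc hc)).resolve_left hcu
  have hcu' : G.Adj c' u := (l.pb.ncp c' (l.nc hc')).resolve_right hcv'
  have hcc : c ≠ c' := by rintro rfl; exact hcu hcu'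
  obtain ⟨dzs, lzs⟩ := l.zq d h hkf hk hzs hzt hc (hs c hc)
  obtain ⟨f, hf, hfu⟩ := h.mono hkf (by omega) d.p
  have fzs : f z ≠ f s := h.cne dzs d.p (by rw [lzs]; exact d.l.symm) hf hfu
  have fzu : f z ≠ f u := hf z (by simp) u (by simp) hzu
  have hfs : f u = f s := by
    by_contra hne
    have := clq_avoid (S := {z, u, s}) l.clq hf (by
      intro x hx e he
      simp only [Finset.mem_insert, Finset.mem_singleton] at hx
      rcases hx with rfl | rfl | rfl
      · exact hf e (by simp) x (by simp) (l.ez e he)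
      · rcases l.pb.ncp e (l.nc he) with e1 | e1
        · exact hf e (by simp) x (by simp) e1
        · rw [hfu]; exact hf e (by simp) v (by simp) e1
      · exact hf e (by simp) x (by simp) (hs e he))
    rw [Finset.image_insert, Finset.image_insert, Finset.image_singleton,
      Finset.card_eq_three.2 ⟨f z, f u, f s, fzu, fzs, hne, rfl⟩, l.card] at this
    omega
  have dus : D2 G u s := ⟨d.us, fun e => hf u (by simp) s (by simp) e hfs, c', hcu', hs c' hc'⟩
  have dvs : D2 G v s := ⟨d.vs, fun e => hf v (by simp) s (by simp) e (by rw [← hfu, hfs]), c, hcv,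
    hs c hc⟩
  have lus : lab G Φ u s = lab G Φ u v := by rw [h.col dus hf hfs, h.col d.p hf hfu]
  have lvs : lab G Φ v s = lab G Φ u v := by
    rw [h.col dvs hf (by rw [← hfu, hfs]), h.col d.p hf hfu]
  obtain ⟨g, hg, hgs⟩ := h.mono hkf (by omega) d.q
  have gus : g u ≠ g s := h.cne dus d.q (by rw [lus]; exact d.l) hg hgs
  have guv : g u ≠ g v := h.cne d.p d.q d.l hg hgs
  obtain ⟨duc, luc⟩ := cliqueRecolour h l.clq hg d.q hgs (fun hh => (hnE s hh).2.2.1 rfl)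
    (fun hh => (hnE t hh).2.2.2 rfl) (fun hh => (hnE u hh).1 rfl) hc hc' hcc hcu' hcu (by
    intro x hxE hcx
    rcases l.nbr hc hcx with e | e | e | e | e | e
    · exact absurd e hxE
    · rw [e]; exact hg z (by simp) u (by simp) hzu
    · rw [e] at hcx; exact absurd hcx hcu
    · rw [e]; exact guv.symm
    · rw [e]; exact gus.symm
    · rw [e] at hcx; exact absurd ⟨hs c hc, hcx⟩ (l.pb.nq c (l.EB hc)))
  have D' : Dis G Φ v s u c := ⟨dvs, duc, by rw [lvs, luc]; exact d.l, d.p.1.symm,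
    (hnE c hc).2.1.symm, d.us.symm, (hnE c hc).2.2.1.symm⟩
  obtain ⟨B', hB'⟩ := D'.pb h hkf hk
  have h1 : c' ∉ B' := fun hh => hB'.nq c' hh ⟨hcu', l.clq c' hc' c hc hcc.symm⟩
  have hEo : ∀ e ∈ E, e ∉ B' := by
    intro e he
    by_cases heb : e = c'
    · rw [heb]; exact h1
    · exact hB'.outw h1 (hnE c' hc').2.1 (hnE c' hc').2.2.1 (hnE c' hc').1 hcc.symm
        (l.clq e he c' hc' heb)
  have hzo : z ∉ B' := fun hh => hB'.nq z hh ⟨hzu, (l.ez c hc).symm⟩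
  have := card_sub_nb h (S := NC G B') (s := u) (x := c') (y := z) (by
    intro x hx
    have hxB := (mem_NC.1 hx).1
    have hdx := hB'.disj x hxB
    rcases hB'.ncq x hx with e | e
    · exact e
    · exfalso
      rcases l.nbr hc e.symm with e1 | e1 | e1 | e1 | e1 | e1
      · exact hEo x e1 hxB
      · exact hzo (e1 ▸ hxB)
      · exact hdx.2.2.1 e1
      · exact hdx.1 e1
      · exact hdx.2.1 e1
      · rw [e1] at e; exact l.pb.nq c (l.EB hc) ⟨hs c hc, e.symm⟩) hcu' hzu
    (by rintro rfl; exact l.zE hc') (fun hh => h1 (mem_NC.1 hh).1) (fun hh => hzo (mem_NC.1 hh).1)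
  have := hB'.ncard
  omega

lemma Leaf.sw_or {u v s t z : V} {B E : Finset V} (l : Leaf G k u v s t B z E) :
    (∃ b ∈ E, ∃ b' ∈ E, G.Adj b t ∧ G.Adj b' s) ∨ (∀ e ∈ E, G.Adj e s) ∨ (∀ e ∈ E, G.Adj e t) := by
  by_cases h1 : ∀ e ∈ E, G.Adj e s
  · exact Or.inr (Or.inl h1)
  by_cases h2 : ∀ e ∈ E, G.Adj e t
  · exact Or.inr (Or.inr h2)
  push Not at h1 h2
  obtain ⟨b, hb, hbs⟩ := h1
  obtain ⟨b', hb', hbt'⟩ := h2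
  exact Or.inl ⟨b, hb, b', hb', (l.pb.ncq b (l.nc hb)).resolve_left hbs,
    (l.pb.ncq b' (l.nc hb')).resolve_right hbt'⟩

lemma Leaf.case2 {u v s t z : V} {B E : Finset V} (l : Leaf G k u v s t B z E)
    (d : Dis G Φ u v s t) (h : Ctx G k Φ) (hkf : KFree G k) (hk : 5 ≤ k)
    (hzu : G.Adj z u) : False := by
  rcases l.sw_or with ⟨b, hb, b', hb', hbt, hbs'⟩ | hs | ht
  · obtain ⟨f, hf, hfu⟩ := h.mono hkf (by omega) d.p
    by_cases hfs : f s = f u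
    · exact l.sQ.case2a d.sQ h hkf hk hzu hb' hb hbs' hbt hf hfu (by
        rw [← hfs]; exact (h.cne d.q d.p d.l.symm hf hfu).symm)
    · exact l.case2a d h hkf hk hzu hb hb' hbt hbs' hf hfu hfs
  · exact l.case2b d h hkf hk hzu hs
  · exact l.sQ.case2b d.sQ h hkf hk hzu ht

lemma no_leaf {u v s t z : V} {B E : Finset V} (l : Leaf G k u v s t B z E)
    (d : Dis G Φ u v s t) (h : Ctx G k Φ) (hkf : KFree G k) (hk : 5 ≤ k) : False := by
  by_cases hzu : G.Adj z u
  · exact l.case2 d h hkf hk hzu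
  by_cases hzv : G.Adj z v
  · exact l.sP.case2 d.sP h hkf hk hzv
  by_cases hzs : G.Adj z s
  · exact l.sw.case2 d.sw h hkf hk hzs
  by_cases hzt : G.Adj z t
  · exact l.sw.sP.case2 d.sw.sP h hkf hk hzt
  have hz4 := l.pb.disj z l.zB
  rcases l.sw_or with ⟨b, hb, b', hb', hbt, hbs'⟩ | hs | hs
  · exact l.case1 d h hkf hk hzu hzv hzs hzt hb hb' hbt hbs'
  · rcases l.sw.sw_or with ⟨b, hb, b', hb', hbt, hbs'⟩ | hp | hp
    · exact l.sw.case1 d.sw h hkf hk hzs hzt hzu hzv hb hb' hbt hbs'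
    · exact lemmaT h hkf (by omega) l.clq l.card l.ez hp hs hz4.1 hz4.2.2.1 d.us
    · exact lemmaT h hkf (by omega) l.clq l.card l.ez hp hs hz4.2.1 hz4.2.2.1 d.vs
  · rcases l.sw.sw_or with ⟨b, hb, b', hb', hbt, hbs'⟩ | hp | hp
    · exact l.sw.case1 d.sw h hkf hk hzs hzt hzu hzv hb hb' hbt hbs'
    · exact lemmaT h hkf (by omega) l.clq l.card l.ez hp hs hz4.1 hz4.2.2.2 d.ut
    · exact lemmaT h hkf (by omega) l.clq l.card l.ez hp hs hz4.2.1 hz4.2.2.2 d.vt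

/-- the clique obstruction -/
structure CB (G : SimpleGraph V) (k : ℕ) (u v s t : V) (C : Finset V) : Prop where
  pb : PB G k u v s t C
  clq : Clq G C
  card : C.card = k - 1
  p : ∀ e ∈ C, G.Adj e u ∨ G.Adj e v
  q : ∀ e ∈ C, G.Adj e s ∨ G.Adj e t

lemma Dis.cb {u v s t : V} (d : Dis G Φ u v s t) (h : Ctx G k Φ) (hkf : KFree G k) (hk : 5 ≤ k) :
    ∃ C, CB G k u v s t C := by
  obtain ⟨B, hB⟩ := d.pb h hkf hk
  rcases hB.dich hk with ⟨hC, hCc, hCn⟩ | ⟨⟨z, E, l⟩, _⟩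
  · exact ⟨B, hB, hC, hCc, fun e he => hB.ncp e (hCn he), fun e he => hB.ncq e (hCn he)⟩
  · exact (no_leaf l d h hkf hk).elim

lemma CB.sP {u v s t : V} {C : Finset V} (h : CB G k u v s t C) : CB G k v u s t C :=
  ⟨h.pb.sP, h.clq, h.card, fun e he => (h.p e he).symm, h.q⟩
lemma CB.sw {u v s t : V} {C : Finset V} (h : CB G k u v s t C) : CB G k s t u v C :=
  ⟨h.pb.sw, h.clq, h.card, h.q, h.p⟩
lemma CB.sQ {u v s t : V} {C : Finset V} (h : CB G k u v s t C) : CB G k u v t s C :=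
  h.sw.sP.sw

end five

end part12

section part13

section five
variable {G : SimpleGraph V} {k : ℕ} [Fintype V] {Φ : (V → Fin k) → Bool}

lemma CB.notall {u v s t : V} {C : Finset V} (c : CB G k u v s t C) (d : Dis G Φ u v s t)
    (h : Ctx G k Φ) (h1 : ∀ e ∈ C, G.Adj e u) (h2 : ∀ e ∈ C, G.Adj e s) : False := by
  have := (h.c3 u s).2 C (by
    intro x hx
    have := c.pb.disj x hx
    simp only [Finset.mem_sdiff, Finset.mem_univ, Finset.mem_insert, Finset.mem_singleton, true_and]
    tauto) c.pb.conn.1 (by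
    intro x hx w hw hxw
    simp only [Finset.mem_sdiff, Finset.mem_univ, Finset.mem_insert, Finset.mem_singleton,
      true_and] at hw
    push Not at hw
    rcases c.pb.closed x hx w hxw with e | e | e | e | e
    · exact absurd e hw.1
    · rw [e] at hxw; exact absurd ⟨h1 x hx, hxw⟩ (c.pb.np x hx)
    · exact absurd e hw.2
    · rw [e] at hxw; exact absurd ⟨h2 x hx, hxw⟩ (c.pb.nq x hx)
    · exact e)
  have hv : v ∈ C := by
    rw [this]
    simp only [Finset.mem_sdiff, Finset.mem_univ, Finset.mem_insert, Finset.mem_singleton, true_and]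
    push Not
    exact ⟨d.p.1.symm, d.vs⟩
  exact (c.pb.disj v hv).2.1 rfl

lemma CB.A1 {u v s t : V} {C : Finset V} (c : CB G k u v s t C) (d : Dis G Φ u v s t)
    (h : Ctx G k Φ) {f : V → Fin k} (hf : ProperOn G Finset.univ f) (hfu : f u = f v)
    (hfs : f s ≠ f u) {b b' : V} (hb : b ∈ C) (hb' : b' ∈ C) (hbt : G.Adj b t)
    (hbs' : G.Adj b' s) : D2 G s b ∧ lab G Φ s b = lab G Φ u v := by
  have hbs : ¬ G.Adj b s := fun e => c.pb.nq b hb ⟨e, hbt⟩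
  have hnE : ∀ x ∈ C, x ≠ u ∧ x ≠ v ∧ x ≠ s ∧ x ≠ t := fun x hx => c.pb.disj x hx
  refine cliqueRecolour h c.clq hf d.p hfu (fun hh => (hnE u hh).1 rfl)
    (fun hh => (hnE v hh).2.1 rfl) (fun hh => (hnE s hh).2.2.1 rfl) hb hb'
    (by rintro rfl; exact hbs hbs') hbs' hbs ?_
  intro x hxE hbx
  rcases c.pb.closed b hb x hbx with e | e | e | e | e
  · rw [e]; exact hfs.symm
  · rw [e, ← hfu]; exact hfs.symm
  · rw [e] at hbx; exact absurd hbx hbs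
  · rw [e]; exact (h.cne d.q d.p d.l.symm hf hfu).symm
  · exact absurd e hxE

/-- all attached to `u`, both `s`,`t` attached. -/
lemma CB.caseB {u v s t : V} {C : Finset V} (c : CB G k u v s t C) (d : Dis G Φ u v s t)
    (h : Ctx G k Φ) (hkf : KFree G k) (hk : 5 ≤ k) (hu : ∀ e ∈ C, G.Adj e u)
    {b b' : V} (hb : b ∈ C) (hb' : b' ∈ C) (hbt : G.Adj b t)
    (hbs' : G.Adj b' s) : False := by
  obtain ⟨g, hg, hgs⟩ := h.mono hkf (by omega) d.q
  have hnE : ∀ x ∈ C, x ≠ u ∧ x ≠ v ∧ x ≠ s ∧ x ≠ t := fun x hx => c.pb.disj x hx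
  have gus : g u = g s := by
    by_contra hne
    have := clq_avoid (S := {u, s}) c.clq hg (by
      intro x hx e he
      simp only [Finset.mem_insert, Finset.mem_singleton] at hx
      rcases hx with rfl | rfl
      · exact hg e (by simp) x (by simp) (hu e he)
      · rcases c.q e he with e1 | e1
        · exact hg e (by simp) x (by simp) e1
        · rw [hgs]; exact hg e (by simp) t (by simp) e1)
    rw [Finset.image_insert, Finset.image_singleton, Finset.card_pair hne, c.card] at this
    omega
  have dus : D2 G u s := ⟨d.us, fun e => hg u (by simp) s (by simp) e gus, b', hu b' hb', hbs'⟩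
  have dut : D2 G u t := ⟨d.ut, fun e => hg u (by simp) t (by simp) e (by rw [gus, hgs]), b,
    hu b hb, hbt⟩
  have lus : lab G Φ u s = lab G Φ s t := by rw [h.col dus hg gus, h.col d.q hg hgs]
  have lut : lab G Φ u t = lab G Φ s t := by
    rw [h.col dut hg (by rw [gus, hgs]), h.col d.q hg hgs]
  have hvs : G.Adj v s := by
    by_contra hn
    exact d.l ((h.lab3 hkf (by omega) d.p dus hn).trans lus)
  obtain ⟨f, hf, hfu⟩ := h.mono hkf (by omega) d.p
  obtain ⟨dsb, lsb⟩ := c.A1 d h hf hfu (by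
    rw [hfu]; exact (hf v (by simp) s (by simp) hvs).symm) hb hb' hbt hbs'
  have D' : Dis G Φ s b u t := ⟨dsb, dut, by rw [lsb, lut]; exact d.l, d.us.symm, d.q.1,
    (hnE b hb).1, (hnE b hb).2.2.2⟩
  obtain ⟨C', c'⟩ := D'.cb h hkf hk
  have hbb : b' ≠ b := by rintro rfl; exact c.pb.nq b' hb ⟨hbs', hbt⟩
  have h1 : b' ∉ C' := fun hh => c'.pb.np b' hh ⟨hbs', c.clq b' hb' b hb hbb⟩
  have hEo : ∀ e ∈ C, e ∉ C' := by
    intro e he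
    by_cases heb : e = b'
    · rw [heb]; exact h1
    · exact c'.pb.outw h1 (hnE b' hb').2.2.1 hbb (hnE b' hb').1 (hnE b' hb').2.2.2
        (c.clq e he b' hb' heb)
  apply kfree_no hkf hk c'.clq c'.card (s := s)
  intro x hx
  have hdx := c'.pb.disj x hx
  rcases c'.p x hx with e | e
  · exact e
  · exfalso
    rcases c.pb.closed b hb x e.symm with e1 | e1 | e1 | e1 | e1
    · exact hdx.2.2.1 e1
    · rw [e1] at e; exact c.pb.np b hb ⟨hu b hb, e.symm⟩
    · exact hdx.1 e1
    · exact hdx.2.2.2 e1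
    · exact hEo x e1 hx

lemma CB.A2 {u v s t b c e y : V} {C C' : Finset V} (cc : CB G k u v s t C)
    (cc' : CB G k s b u c C') (d : Dis G Φ u v s t) (h : Ctx G k Φ) (hkf : KFree G k) (hk : 5 ≤ k)
    (hC : ∀ x ∈ C, x ≠ b → x ≠ c → G.Adj x s ∧ G.Adj x u)
    (hC' : ∀ x ∈ C', x ≠ v → x ≠ t → G.Adj x s ∧ G.Adj x u) (he : e ∈ C) (heb : e ≠ b) (hec : e ≠ c)
    (hy : y ∈ C') (hyv : y ≠ v) (hyt : y ≠ t) (dey : D2 G e y) (hl : lab G Φ u v ≠ lab G Φ e y) :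
    False := by
  have he4 := cc.pb.disj e he
  have hy4 := cc'.pb.disj y hy
  have D' : Dis G Φ u v e y := ⟨d.p, dey, hl, he4.1.symm, hy4.2.2.1.symm, he4.2.1.symm, hyv.symm⟩
  obtain ⟨C2, c2⟩ := D'.cb h hkf hk
  have hs2 : s ∉ C2 := fun hh => c2.pb.nq s hh ⟨(hC e he heb hec).1.symm, (hC' y hy hyv hyt).1.symm⟩
  have hx : ∀ x ∈ C2, ¬ G.Adj x s := fun x hx hxs =>
    c2.pb.outw hs2 d.us.symm d.vs.symm he4.2.2.1.symm hy4.1.symm hxs hx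
  have hsub : C2 ⊆ {b, c, t} := by
    intro x hxC
    have hxs := hx x hxC
    have hx4 := c2.pb.disj x hxC
    simp only [Finset.mem_insert, Finset.mem_singleton]
    rcases c2.q x hxC with e1 | e1
    · rcases cc.pb.closed e he x e1.symm with e2 | e2 | e2 | e2 | e2
      · exact absurd e2 hx4.1
      · exact absurd e2 hx4.2.1
      · exact absurd (e2 ▸ hxC) hs2
      · exact Or.inr (Or.inr e2)
      · by_contra hcon
        push Not at hcon
        exact hxs (hC x e2 hcon.1 hcon.2.1).1
    · rcases cc'.pb.closed y hy x e1.symm with e2 | e2 | e2 | e2 | e2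
      · exact absurd (e2 ▸ hxC) hs2
      · exact Or.inl e2
      · exact absurd e2 hx4.1
      · exact Or.inr (Or.inl e2)
      · by_contra hcon
        push Not at hcon
        exact hxs (hC' x e2 hx4.2.1 hcon.2.2).1
  have h1 := Finset.card_le_card hsub
  have h2 := Finset.card_le_three (a := b) (b := c) (c := t)
  rw [c2.card] at h1
  omega

lemma CB.caseA {u v s t : V} {C : Finset V} (cc : CB G k u v s t C) (d : Dis G Φ u v s t)
    (h : Ctx G k Φ) (hkf : KFree G k) (hk : 5 ≤ k)
    (hu : ∃ e ∈ C, G.Adj e u) (hv : ∃ e ∈ C, G.Adj e v) (hs : ∃ e ∈ C, G.Adj e s)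
    (ht : ∃ e ∈ C, G.Adj e t)
    {f : V → Fin k} (hf : ProperOn G Finset.univ f) (hfu : f u = f v) (hfs : f s ≠ f u)
    {g : V → Fin k} (hg : ProperOn G Finset.univ g) (hgs : g s = g t) (hgu : g u ≠ g s) : False := by
  have hnE : ∀ x ∈ C, x ≠ u ∧ x ≠ v ∧ x ≠ s ∧ x ≠ t := fun x hx => cc.pb.disj x hx
  -- choice of `b`, `c`, `e`
  obtain ⟨b, hb, c, hc, e, he, hbc, heb, hec, hbt, hcv, hes⟩ : ∃ b ∈ C, ∃ c ∈ C, ∃ e ∈ C, b ≠ c ∧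
      e ≠ b ∧ e ≠ c ∧ G.Adj b t ∧ G.Adj c v ∧ (G.Adj e s ∨ G.Adj e u) := by
    obtain ⟨b, hb, c, hc, hbc, hbt, hcv⟩ : ∃ b ∈ C, ∃ c ∈ C, b ≠ c ∧ G.Adj b t ∧ G.Adj c v := by
      by_contra hcon
      push Not at hcon
      obtain ⟨b, hb, hbt⟩ := ht
      obtain ⟨c, hc, hcv⟩ := hv
      have hbc : b = c := by
        by_contra hne
        exact hcon b hb c hc hne hbt hcv
      subst hbc
      refine lemmaT h hkf (by omega) (K := C.erase b) (cc.clq.mono (Finset.erase_subset _ _))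
        (by rw [Finset.card_erase_of_mem hb, cc.card]; omega) (a := u) (b := s) (c := b) ?_ ?_ ?_
        d.us (hnE b hb).1.symm (hnE b hb).2.2.1.symm
      · intro e he
        rw [Finset.mem_erase] at he
        exact (cc.p e he.2).resolve_right (hcon b hb e he.2 he.1.symm hbt)
      · intro e he
        rw [Finset.mem_erase] at he
        exact (cc.q e he.2).resolve_right (fun hh => hcon e he.2 b hb he.1 hh hcv)
      · intro e he
        rw [Finset.mem_erase] at he
        exact cc.clq e he.2 b hb he.1
    by_cases hex : ∃ e ∈ C, e ≠ b ∧ e ≠ c ∧ (G.Adj e s ∨ G.Adj e u)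
    · obtain ⟨e, he, heb, hec, hes⟩ := hex
      exact ⟨b, hb, c, hc, e, he, hbc, heb, hec, hbt, hcv, hes⟩
    push Not at hex
    have hcs : G.Adj c s := by
      obtain ⟨e, he, hes⟩ := hs
      by_cases hec : e = c
      · rw [← hec]; exact hes
      · by_cases heb : e = b
        · rw [heb] at hes; exact absurd ⟨hes, hbt⟩ (cc.pb.nq b hb)
        · exact absurd hes (hex e he heb hec).1
    have h2 : 1 < ((C.erase b).erase c).card := by
      rw [Finset.card_erase_of_mem (Finset.mem_erase.2 ⟨hbc.symm, hc⟩),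
        Finset.card_erase_of_mem hb, cc.card]
      omega
    obtain ⟨b1, hb1, c1, hc1, hne⟩ := Finset.one_lt_card.1 h2
    simp only [Finset.mem_erase] at hb1 hc1
    exact ⟨b1, hb1.2.2, c1, hc1.2.2, c, hc, hne, hb1.1.symm, hc1.1.symm,
      (cc.q b1 hb1.2.2).resolve_left (hex b1 hb1.2.2 hb1.2.1 hb1.1).1,
      (cc.p c1 hc1.2.2).resolve_left (hex c1 hc1.2.2 hc1.2.1 hc1.1).2, Or.inl hcs⟩
  obtain ⟨u', hu', huu⟩ := hu
  obtain ⟨s', hs', hss⟩ := hs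
  obtain ⟨dsb, lsb⟩ := cc.A1 d h hf hfu hfs hb hs' hbt hss
  obtain ⟨duc, luc⟩ := cc.sw.A1 d.sw h hg hgs hgu hc hu' hcv huu
  have D' : Dis G Φ s b u c := ⟨dsb, duc, by rw [lsb, luc]; exact d.l, d.us.symm,
    (hnE c hc).2.2.1.symm, (hnE b hb).1, hbc⟩
  obtain ⟨C', cc'⟩ := D'.cb h hkf hk
  have heo : e ∉ C' := by
    intro hh
    rcases hes with e1 | e1
    · exact cc'.pb.np e hh ⟨e1, cc.clq e he b hb heb⟩
    · exact cc'.pb.nq e hh ⟨e1, cc.clq e he c hc hec⟩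
  have hEo : ∀ x ∈ C, x ∉ C' := by
    intro x hx
    by_cases hxb : x = b
    · rw [hxb]; exact fun hh => (cc'.pb.disj b hh).2.1 rfl
    by_cases hxc : x = c
    · rw [hxc]; exact fun hh => (cc'.pb.disj c hh).2.2.2 rfl
    by_cases hxe : x = e
    · rw [hxe]; exact heo
    · exact cc'.pb.outw heo (hnE e he).2.2.1 heb (hnE e he).1 hec (cc.clq x hx e he hxe)
  have hC' : ∀ x ∈ C', x ≠ v → x ≠ t → G.Adj x s ∧ G.Adj x u := by
    intro x hx hxv hxt
    have hx4 := cc'.pb.disj x hx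
    have : ∀ e ∈ C, ¬ G.Adj x e := by
      intro e he hxe
      rcases cc.pb.closed e he x hxe.symm with e1 | e1 | e1 | e1 | e1
      · exact hx4.2.2.1 e1
      · exact hxv e1
      · exact hx4.1 e1
      · exact hxt e1
      · exact hEo x e1 hx
    exact ⟨(cc'.p x hx).resolve_right (this b hb), (cc'.q x hx).resolve_right (this c hc)⟩
  have hvt : v ∈ C' ∧ t ∈ C' := by
    by_cases hv' : v ∈ C'
    · refine ⟨hv', ?_⟩
      by_contra ht'
      refine lemmaT h hkf (by omega) (K := C'.erase v) (cc'.clq.mono (Finset.erase_subset _ _))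
        (by rw [Finset.card_erase_of_mem hv', cc'.card]; omega) (a := u) (b := s) (c := v) ?_ ?_ ?_
        d.us d.p.1 d.vs.symm
      · intro x hx
        rw [Finset.mem_erase] at hx
        exact (hC' x hx.2 hx.1 (by rintro rfl; exact ht' hx.2)).2
      · intro x hx
        rw [Finset.mem_erase] at hx
        exact (hC' x hx.2 hx.1 (by rintro rfl; exact ht' hx.2)).1
      · intro x hx
        rw [Finset.mem_erase] at hx
        exact cc'.clq x hx.2 v hv' hx.1
    · exfalso
      by_cases ht' : t ∈ C'
      · refine lemmaT h hkf (by omega) (K := C'.erase t) (cc'.clq.mono (Finset.erase_subset _ _))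
          (by rw [Finset.card_erase_of_mem ht', cc'.card]; omega) (a := u) (b := s) (c := t) ?_ ?_ ?_
          d.us d.ut d.q.1
        · intro x hx
          rw [Finset.mem_erase] at hx
          exact (hC' x hx.2 (by rintro rfl; exact hv' hx.2) hx.1).2
        · intro x hx
          rw [Finset.mem_erase] at hx
          exact (hC' x hx.2 (by rintro rfl; exact hv' hx.2) hx.1).1
        · intro x hx
          rw [Finset.mem_erase] at hx
          exact cc'.clq x hx.2 t ht' hx.1
      · exact kfree_no hkf hk cc'.clq cc'.card (s := s) (fun x hx =>
          (hC' x hx (by rintro rfl; exact hv' hx) (by rintro rfl; exact ht' hx)).1)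
  obtain ⟨hv', ht'⟩ := hvt
  have hno : ∀ x ∈ C, x ≠ b → x ≠ c → ∀ y ∈ C', ¬ G.Adj x y := by
    intro x hx hxb hxc y hy hxy
    exact cc'.pb.outw (hEo x hx) (hnE x hx).2.2.1 hxb (hnE x hx).1 hxc hxy.symm hy
  have hC : ∀ x ∈ C, x ≠ b → x ≠ c → G.Adj x s ∧ G.Adj x u := fun x hx hxb hxc =>
    ⟨(cc.q x hx).resolve_right (hno x hx hxb hxc t ht'),
      (cc.p x hx).resolve_right (hno x hx hxb hxc v hv')⟩
  obtain ⟨y, hy⟩ : ((C'.erase v).erase t).Nonempty := by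
    rw [← Finset.card_pos, Finset.card_erase_of_mem (Finset.mem_erase.2 ⟨d.vt.symm, ht'⟩),
        Finset.card_erase_of_mem hv', cc'.card]
    omega
  simp only [Finset.mem_erase] at hy
  have dey : D2 G e y := ⟨by rintro rfl; exact heo hy.2.2, hno e he heb hec y hy.2.2, u,
    (hC e he heb hec).2.symm, (hC' y hy.2.2 hy.2.1 hy.1).2.symm⟩
  by_cases hl : lab G Φ u v = lab G Φ e y
  · exact cc.sw.A2 cc'.sw d.sw h hkf hk (fun x hx h1 h2 => (hC x hx h2 h1).symm)
      (fun x hx h1 h2 => (hC' x hx h2 h1).symm) he hec heb hy.2.2 hy.1 hy.2.1 dey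
      (by rw [← hl]; exact d.l.symm)
  · exact cc.A2 cc' d h hkf hk hC hC' he heb hec hy.2.2 hy.2.1 hy.1 dey hl

lemma Dis.false {u v s t : V} (d : Dis G Φ u v s t) (h : Ctx G k Φ) (hkf : KFree G k)
    (hk : 5 ≤ k) : False := by
  obtain ⟨C, c⟩ := d.cb h hkf hk
  have key : ∀ u v s t : V, Dis G Φ u v s t → CB G k u v s t C → ¬ ∀ e ∈ C, G.Adj e u := by
    intro u v s t d c hu
    by_cases h1 : ∀ e ∈ C, G.Adj e s
    · exact c.notall d h hu h1
    by_cases h2 : ∀ e ∈ C, G.Adj e t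
    · exact c.sQ.notall d.sQ h hu h2
    push Not at h1 h2
    obtain ⟨b, hb, hbs⟩ := h1
    obtain ⟨b', hb', hbt'⟩ := h2
    exact c.caseB d h hkf hk hu hb hb' ((c.q b hb).resolve_left hbs)
      ((c.q b' hb').resolve_right hbt')
  have ku := key u v s t d c
  have kv := key v u s t d.sP c.sP
  have ks := key s t u v d.sw c.sw
  have kt := key t s u v d.sw.sP c.sw.sP
  push Not at ku kv ks kt
  obtain ⟨a1, ha1, ha1'⟩ := ku
  obtain ⟨a2, ha2, ha2'⟩ := kv
  obtain ⟨a3, ha3, ha3'⟩ := ks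
  obtain ⟨a4, ha4, ha4'⟩ := kt
  have eu : ∃ e ∈ C, G.Adj e u := ⟨a2, ha2, (c.p a2 ha2).resolve_right ha2'⟩
  have ev : ∃ e ∈ C, G.Adj e v := ⟨a1, ha1, (c.p a1 ha1).resolve_left ha1'⟩
  have es : ∃ e ∈ C, G.Adj e s := ⟨a4, ha4, (c.q a4 ha4).resolve_right ha4'⟩
  have et : ∃ e ∈ C, G.Adj e t := ⟨a3, ha3, (c.q a3 ha3).resolve_left ha3'⟩
  obtain ⟨f, hf, hfu⟩ := h.mono hkf (by omega) d.p
  obtain ⟨g, hg, hgs⟩ := h.mono hkf (by omega) d.q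
  have fst : f s ≠ f t := h.cne d.q d.p d.l.symm hf hfu
  have guv : g u ≠ g v := h.cne d.p d.q d.l hg hgs
  by_cases h1 : f s = f u
  · have h1' : f t ≠ f u := by rw [← h1]; exact fst.symm
    by_cases h2 : g u = g t
    · exact c.sQ.sP.caseA d.sQ.sP h hkf hk ev eu et es hf hfu.symm (by rw [← hfu]; exact h1') hg
        hgs.symm (by rw [← h2]; exact guv.symm)
    · exact c.sQ.caseA d.sQ h hkf hk eu ev et es hf hfu h1' hg hgs.symm h2
  · by_cases h2 : g u = g s
    · exact c.sP.caseA d.sP h hkf hk ev eu es et hf hfu.symm (by rw [← hfu]; exact h1) hg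
        hgs (by rw [← h2]; exact guv.symm)
    · exact c.caseA d h hkf hk eu ev es et hf hfu h1 hg hgs h2

lemma no_five (h : Ctx G k Φ) (hk : 5 ≤ k) (x : V) : False := by
  have hkf := h.kfree (by omega)
  obtain ⟨u, v, hxu, hxv, huv, hnuv, hl, _⟩ := h.nbhd x true
  obtain ⟨s, t, hus, hut, hst, hnst, hl', _⟩ := h.nbhd u false
  have d : Dis G Φ u v s t := ⟨⟨huv, hnuv, x, hxu, hxv⟩, ⟨hst, hnst, u, hus, hut⟩,
    by rw [hl, hl']; decide, hus.ne, hut.ne, by rintro rfl; exact hnuv hus,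
    by rintro rfl; exact hnuv hut⟩
  exact d.false h hkf hk

end five

end part13

section part14

/-! ## Cubic graphs with a triangle -/

structure Tri (G : SimpleGraph V) (a b c a' b' c' : V) : Prop where
  ab : G.Adj a b
  bc : G.Adj b c
  ca : G.Adj c a
  aa : G.Adj a a'
  bb : G.Adj b b'
  cc : G.Adj c c'
  ab' : a' ≠ b'
  bc' : b' ≠ c'
  ca' : c' ≠ a'
  a1 : a' ≠ b
  a2 : a' ≠ c
  b1 : b' ≠ c
  b2 : b' ≠ a
  c1 : c' ≠ a
  c2 : c' ≠ b
  Na : ∀ x, G.Adj a x → x = b ∨ x = c ∨ x = a'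
  Nb : ∀ x, G.Adj b x → x = c ∨ x = a ∨ x = b'
  Nc : ∀ x, G.Adj c x → x = a ∨ x = b ∨ x = c'

section tri
variable {G : SimpleGraph V} {a b c a' b' c' : V}

lemma Tri.rot (t : Tri G a b c a' b' c') : Tri G b c a b' c' a' :=
  ⟨t.bc, t.ca, t.ab, t.bb, t.cc, t.aa, t.bc', t.ca', t.ab', t.b1, t.b2, t.c1, t.c2, t.a1, t.a2,
    t.Nb, t.Nc, t.Na⟩

variable [Fintype V] {Φ : (V → Fin 3) → Bool}

lemma third3 : ∀ x y : Fin 3, x ≠ y → ∃ z, z ≠ x ∧ z ≠ y ∧ ∀ w, w = x ∨ w = y ∨ w = z := by decide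

/-- a colouring with exactly two of the outer vertices of the same colour extends -/
lemma Tri.ext (t : Tri G a b c a' b' c') {g : V → Fin 3}
    (hg : ProperOn G (Finset.univ \ {a, b, c}) g) (h1 : g b' = g c') (h2 : g a' ≠ g b')
    (z : Fin 3) (y : Fin 3) (hz1 : z ≠ g b') (hy1 : y ≠ g b') (hzy : y ≠ z) :
    ∃ f, ProperOn G Finset.univ f ∧ f a = g b' ∧ f b = y ∧ f c = z ∧
      f a' = g a' ∧ f b' = g b' ∧ f c' = g c' := by
  let f : V → Fin 3 := fun v => if v = a then g b' else if v = b then y else if v = c then z else g v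
  have fa : f a = g b' := by simp [f]
  have fb : f b = y := by simp [f, t.ab.ne']
  have fc : f c = z := by simp [f, t.ca.ne, t.bc.ne']
  have fo : ∀ v, v ≠ a → v ≠ b → v ≠ c → f v = g v := by
    intro v h1 h2 h3; simp [f, h1, h2, h3]
  have fa' := fo a' t.aa.ne' t.a1 t.a2
  have fb' := fo b' t.b2 t.bb.ne' t.b1
  have fc' := fo c' t.c1 t.c2 t.cc.ne'
  refine ⟨f, ?_, fa, fb, fc, fa', fb', fc'⟩
  have key : ∀ u v, G.Adj u v → u = a ∨ u = b ∨ u = c → f u ≠ f v := by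
    intro u v huv hu
    rcases hu with rfl | rfl | rfl
    · rcases t.Na v huv with rfl | rfl | rfl
      · rw [fa, fb]; exact hy1.symm
      · rw [fa, fc]; exact hz1.symm
      · rw [fa, fa']; exact h2.symm
    · rcases t.Nb v huv with rfl | rfl | rfl
      · rw [fb, fc]; exact hzy
      · rw [fa, fb]; exact hy1
      · rw [fb, fb']; exact hy1
    · rcases t.Nc v huv with rfl | rfl | rfl
      · rw [fa, fc]; exact hz1
      · rw [fb, fc]; exact hzy.symm
      · rw [fc, fc', ← h1]; exact hz1
  intro u _ v _ huv
  by_cases hu : u = a ∨ u = b ∨ u = c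
  · exact key u v huv hu
  by_cases hv : v = a ∨ v = b ∨ v = c
  · exact (key v u huv.symm hv).symm
  · push Not at hu hv
    rw [fo u hu.1 hu.2.1 hu.2.2, fo v hv.1 hv.2.1 hv.2.2]
    refine hg u ?_ v ?_ huv
    · simp [hu]
    · simp [hv]

lemma Tri.no21 (t : Tri G a b c a' b' c') (h : Ctx G 3 Φ) {g : V → Fin 3}
    (hg : ProperOn G (Finset.univ \ {a, b, c}) g) (h1 : g b' = g c') (h2 : g a' ≠ g b') : False := by
  obtain ⟨z, hz1, hz2, hz3⟩ := third3 _ _ h2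
  obtain ⟨f1, hf1, f1a, f1b, f1c, f1a', f1b', f1c'⟩ := t.ext hg h1 h2 (g a') z h2 hz2 hz1
  obtain ⟨f2, hf2, f2a, f2b, f2c, f2a', f2b', f2c'⟩ := t.ext hg h1 h2 z (g a') hz2 h2 hz1.symm
  have dab : D2 G a b' := ⟨t.b2.symm, fun e => by
    rcases t.Na _ e with e | e | e
    · exact t.bb.ne' e
    · exact t.b1 e
    · exact t.ab' e.symm, b, t.ab.symm, t.bb⟩
  have hΦ : Φ f1 = Φ f2 := by
    rw [← h.col dab hf1 (by rw [f1a, f1b']), ← h.col dab hf2 (by rw [f2a, f2b'])]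
  have d1 : D2 G a' b := ⟨t.a1, fun e => by
    rcases t.Nb _ e.symm with e | e | e
    · exact t.a2 e
    · exact t.aa.ne' e
    · exact t.ab' e, a, t.aa, t.ab⟩
  have d2 : D2 G a' c := ⟨t.a2, fun e => by
    rcases t.Nc _ e.symm with e | e | e
    · exact t.aa.ne' e
    · exact t.a1 e
    · exact t.ca' e.symm, a, t.aa, t.ca.symm⟩
  have l2 : lab G Φ a' b = lab G Φ a' c := by
    rw [h.col d1 hf2 (by rw [f2a', f2b]), h.col d2 hf1 (by rw [f1a', f1c]), hΦ]
  have all : ∀ f, ProperOn G Finset.univ f → Φ f = lab G Φ a' b := by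
    intro f hf
    by_cases e1 : f a' = f b
    · exact (h.col d1 hf e1).symm
    · rw [l2]
      refine (h.col d2 hf ?_).symm
      have e2 := hf b (by simp) c (by simp) t.bc
      have e3 := hf a (by simp) b (by simp) t.ab
      have e4 := hf c (by simp) a (by simp) t.ca
      have e5 := hf a (by simp) a' (by simp) t.aa
      revert e1 e2 e3 e4 e5
      generalize f a = p; generalize f b = q; generalize f c = r; generalize f a' = s
      revert p q r s
      decide
  obtain ⟨f, hf, hft⟩ := h.ex true
  obtain ⟨g, hg, hgf⟩ := h.ex false
  have h1 := all f hf
  have h2 := all g hg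
  rw [hft] at h1; rw [hgf] at h2
  exact Bool.noConfusion (h1.trans h2.symm)

lemma Tri.set1 : (Finset.univ \ {b, c, a} : Finset V) = Finset.univ \ {a, b, c} := by
  ext x; simp only [Finset.mem_sdiff, Finset.mem_univ, Finset.mem_insert, Finset.mem_singleton,
    true_and]; tauto

lemma fin3_cases : ∀ x y z : Fin 3, (y = z ∧ x ≠ y) ∨ (z = x ∧ y ≠ z) ∨ (x = y ∧ z ≠ x) ∨
    (x = y ∧ y = z) ∨ (x ≠ y ∧ y ≠ z ∧ z ≠ x) := by decide

/-- the outer vertices are always all equal or all different -/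
lemma Tri.alt (t : Tri G a b c a' b' c') (h : Ctx G 3 Φ) {g : V → Fin 3}
    (hg : ProperOn G (Finset.univ \ {a, b, c}) g) :
    (g a' = g b' ∧ g b' = g c') ∨ (g a' ≠ g b' ∧ g b' ≠ g c' ∧ g c' ≠ g a') := by
  rcases fin3_cases (g a') (g b') (g c') with e | e | e | e | e
  · exact (t.no21 h hg e.1 e.2).elim
  · exact (t.rot.no21 h (by rw [Tri.set1]; exact hg) e.1 e.2).elim
  · exact (t.rot.rot.no21 h (by rw [Tri.set1, Tri.set1]; exact hg) e.1 e.2).elim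
  · exact Or.inl e
  · exact Or.inr e

lemma Tri.noteq (t : Tri G a b c a' b' c') {g : V → Fin 3}
    (hg : ProperOn G Finset.univ g) : ¬ (g a' = g b' ∧ g b' = g c') := by
  intro h
  have e1 := hg a (by simp) b (by simp) t.ab
  have e2 := hg b (by simp) c (by simp) t.bc
  have e3 := hg c (by simp) a (by simp) t.ca
  have e4 := hg a (by simp) a' (by simp) t.aa
  have e5 := hg b (by simp) b' (by simp) t.bb
  have e6 := hg c (by simp) c' (by simp) t.cc
  rw [← h.2, ← h.1] at e6
  rw [← h.1] at e5
  revert e1 e2 e3 e4 e5 e6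
  generalize g a = p; generalize g b = q; generalize g c = r; generalize g a' = s
  revert p q r s
  decide

lemma step_dist : ∀ x y z x' y' i j : Fin 3, x ≠ y → y ≠ z → z ≠ x →
    (x' = x ∨ ((x = i ∨ x = j) ∧ (x' = i ∨ x' = j))) →
    (y' = y ∨ ((y = i ∨ y = j) ∧ (y' = i ∨ y' = j))) →
    (x' = z ∨ ((z = i ∨ z = j) ∧ (x' = i ∨ x' = j))) → x' = y' → False := by decide

lemma Tri.dist (t : Tri G a b c a' b' c') (h : Ctx G 3 Φ) {f g : V → Fin 3}
    (hf : ProperOn G Finset.univ f) (hfg : KE G (Finset.univ \ {a, b, c}) f g) :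
    g a' ≠ g b' ∧ g b' ≠ g c' ∧ g c' ≠ g a' := by
  have ma : a' ∈ (Finset.univ \ {a, b, c} : Finset V) := by
    simp [t.aa.ne', t.a1, t.a2]
  have mb : b' ∈ (Finset.univ \ {a, b, c} : Finset V) := by
    simp [t.bb.ne', t.b1, t.b2]
  have mc : c' ∈ (Finset.univ \ {a, b, c} : Finset V) := by
    simp [t.cc.ne', t.c1, t.c2]
  induction hfg with
  | refl => exact (t.alt h (hf.mono (Finset.subset_univ _))).resolve_left (t.noteq hf)
  | tail _ hs ih =>
    obtain ⟨_, hp, i, j, hij⟩ := hs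
    refine (t.alt h hp).resolve_left ?_
    rintro ⟨e1, e2⟩
    refine step_dist _ _ _ _ _ i j ih.1 ih.2.1 ih.2.2 (hij a' ma) (hij b' mb) ?_ e1
    rw [e1, e2]
    exact hij c' mc

lemma Tri.adj (t : Tri G a b c a' b' c') (h : Ctx G 3 Φ) : G.Adj a' b' := by
  by_contra hn
  let L : V → Finset (Fin 3) := fun v => if G.Adj v a' ∨ G.Adj v b' then Finset.univ.erase 0 else
    Finset.univ
  obtain ⟨col, hcol, hL⟩ := greedy (G := G) (Finset.univ \ {a, b, c, a', b'}) L (by norm_num) (by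
    intro T hT hne
    have hT' : ∀ x ∈ T, x ≠ a ∧ x ≠ b ∧ x ≠ c ∧ x ≠ a' ∧ x ≠ b' := by
      intro x hx
      have := hT hx
      simpa only [Finset.mem_sdiff, Finset.mem_univ, Finset.mem_insert, Finset.mem_singleton,
        true_and, not_or] using this
    obtain ⟨u, hu, v, hv, hvT, huv⟩ := (h.c3 a' b').exists_adj (T := T) (by
      intro x hx
      simp [hT' x hx]) hne (by
      rintro rfl
      refine (hT' a ?_).1 rfl
      simp [t.aa.ne, t.b2.symm])
    simp only [Finset.mem_sdiff, Finset.mem_univ, Finset.mem_insert, Finset.mem_singleton,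
        true_and, not_or] at hv
    refine ⟨u, hu, ?_⟩
    have hv1 : v ∈ nb G Finset.univ u := mem_nb.2 ⟨by simp, huv⟩
    by_cases hu' : G.Adj u a' ∨ G.Adj u b'
    · have hLu : (L u).card = 2 := by simp [L, hu']
      obtain ⟨w, hw, huw⟩ : ∃ w, (w = a' ∨ w = b') ∧ G.Adj u w := by
        rcases hu' with e | e
        · exact ⟨_, Or.inl rfl, e⟩
        · exact ⟨_, Or.inr rfl, e⟩
      have hwT : w ∉ T := by
        intro hh
        have := hT' w hh
        rcases hw with e | e
        · exact this.2.2.2.1 e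
        · exact this.2.2.2.2 e
      have hwv : w ≠ v := by
        rintro rfl
        rcases hw with e | e
        · exact hv.1 e
        · exact hv.2 e
      have hsub : nb G T u ⊆ ((nb G Finset.univ u).erase v).erase w := by
        intro x hx
        rw [mem_nb] at hx
        simp only [Finset.mem_erase, mem_nb]
        exact ⟨by rintro rfl; exact hwT hx.1, by rintro rfl; exact hvT hx.1, by simp, hx.2⟩
      have := Finset.card_le_card hsub
      rw [Finset.card_erase_of_mem (Finset.mem_erase.2 ⟨hwv, mem_nb.2 ⟨by simp, huw⟩⟩),
        Finset.card_erase_of_mem hv1, h.reg] at this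
      omega
    · have hLu : (L u).card = 3 := by simp [L, hu']
      have hsub : nb G T u ⊆ (nb G Finset.univ u).erase v := by
        intro x hx
        rw [mem_nb] at hx
        simp only [Finset.mem_erase, mem_nb]
        exact ⟨by rintro rfl; exact hvT hx.1, by simp, hx.2⟩
      have := Finset.card_le_card hsub
      rw [Finset.card_erase_of_mem hv1, h.reg] at this
      omega)
  let g : V → Fin 3 := fun v => if v = a' ∨ v = b' then 0 else col v
  have ga : g a' = 0 := by simp [g]
  have gb : g b' = 0 := by simp [g]
  have go : ∀ v, ¬ (v = a' ∨ v = b') → g v = col v := fun v hv => by simp only [g, if_neg hv]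
  have g0 : ∀ v, v = a' ∨ v = b' → g v = 0 := fun v hv => by simp only [g, if_pos hv]
  have hm : ∀ v ∈ (Finset.univ \ {a, b, c} : Finset V), ¬ (v = a' ∨ v = b') →
      v ∈ (Finset.univ \ {a, b, c, a', b'} : Finset V) := by
    intro v hv hv'
    simp only [Finset.mem_sdiff, Finset.mem_univ, Finset.mem_insert, Finset.mem_singleton,
        true_and, not_or] at *
    tauto
  have hgF : ProperOn G (Finset.univ \ {a, b, c}) g := by
    have key : ∀ u v, (u = a' ∨ u = b') → v ∈ (Finset.univ \ {a, b, c} : Finset V) → G.Adj u v →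
        g u ≠ g v := by
      intro u v hu hv huv
      have hv' : ¬ (v = a' ∨ v = b') := by
        intro hv'
        rcases hu with rfl | rfl <;> rcases hv' with rfl | rfl
        · exact G.loopless.irrefl _ huv
        · exact hn huv
        · exact hn huv.symm
        · exact G.loopless.irrefl _ huv
      have hLv := hL v (hm v hv hv')
      rw [g0 u hu, go v hv']
      have : G.Adj v a' ∨ G.Adj v b' := by
        rcases hu with rfl | rfl
        · exact Or.inl huv.symm
        · exact Or.inr huv.symm
      simp only [L, if_pos this, Finset.mem_erase] at hLv
      exact hLv.1.symm
    intro u hu v hv huv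
    by_cases hu' : u = a' ∨ u = b'
    · exact key u v hu' hv huv
    by_cases hv' : v = a' ∨ v = b'
    · exact (key v u hv' hu huv.symm).symm
    rw [go u hu', go v hv']
    exact hcol u (hm u hu hu') v (hm v hv hv') huv
  obtain ⟨f, hf, _⟩ := h.ex true
  have hKE : KE G (Finset.univ \ {a, b, c}) f g := by
    refine KE_of_degenerate ?_ f g (hf.mono (Finset.subset_univ _)) hgF
    intro T hT hne
    have hconn : Conn G (Finset.univ \ {a, a}) := h.c3 a a
    have hT' : ∀ x ∈ T, x ≠ a ∧ x ≠ b ∧ x ≠ c := by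
      intro x hx
      have := hT hx
      simpa only [Finset.mem_sdiff, Finset.mem_univ, Finset.mem_insert, Finset.mem_singleton,
        true_and, not_or] using this
    obtain ⟨u, hu, v, hv, hvT, huv⟩ := hconn.exists_adj (T := T) (by
      intro x hx
      simp [hT' x hx]) hne (by
      rintro rfl
      exact (hT' b (by simp [t.ab.ne'])).2.1 rfl)
    refine ⟨u, hu, ?_⟩
    rw [← h.reg u]
    apply Finset.card_lt_card
    refine (nb_mono (Finset.subset_univ T) u).ssubset_of_ne ?_
    intro heq
    have : v ∈ nb G T u := by rw [heq]; exact mem_nb.2 ⟨by simp, huv⟩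
    exact hvT (mem_nb.1 this).1
  exact (t.dist h hf hKE).1 (by rw [ga, gb])

lemma third_nb (h : Ctx G 3 Φ) {x y z : V} (hxy : G.Adj x y) (hxz : G.Adj x z) (hyz : y ≠ z) :
    ∃ w, G.Adj x w ∧ w ≠ y ∧ w ≠ z ∧ ∀ v, G.Adj x v → v = y ∨ v = z ∨ v = w := by
  have h1 : (((nb G Finset.univ x).erase y).erase z).card = 1 := by
    rw [Finset.card_erase_of_mem (Finset.mem_erase.2 ⟨hyz.symm, mem_nb.2 ⟨by simp, hxz⟩⟩),
      Finset.card_erase_of_mem (mem_nb.2 ⟨by simp, hxy⟩), h.reg]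
  obtain ⟨w, hw⟩ := Finset.card_eq_one.1 h1
  have hmem : ∀ v, (v ≠ z ∧ v ≠ y ∧ G.Adj x v) ↔ v = w := by
    intro v
    rw [← Finset.mem_singleton, ← hw]
    simp [mem_nb]
  have hww := (hmem w).2 rfl
  refine ⟨w, hww.2.2, hww.2.1, hww.1, fun v hv => ?_⟩
  by_cases h1 : v = y
  · exact Or.inl h1
  by_cases h2 : v = z
  · exact Or.inr (Or.inl h2)
  · exact Or.inr (Or.inr ((hmem v).1 ⟨h2, h1, hv⟩))

/-- in a triangle two vertices don't have the same outer neighbour -/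
lemma tri_ne (h : Ctx G 3 Φ) {a b c x c' : V} (ab : G.Adj a b) (bc : G.Adj b c) (ca : G.Adj c a)
    (ax : G.Adj a x) (bx : G.Adj b x) (hxc : x ≠ c) (cc : G.Adj c c') (c1 : c' ≠ a) (c2 : c' ≠ b)
    (Na : ∀ v, G.Adj a v → v = b ∨ v = c ∨ v = x) (Nb : ∀ v, G.Adj b v → v = c ∨ v = a ∨ v = x) :
    False := by
  have := (h.c3 c x).2 {a, b} (by
    intro y hy
    simp only [Finset.mem_sdiff, Finset.mem_univ, Finset.mem_insert, Finset.mem_singleton,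
        true_and, not_or] at *
    rcases hy with rfl | rfl
    · exact ⟨ca.ne', ax.ne⟩
    · exact ⟨bc.ne, bx.ne⟩) (by simp) (by
    intro y hy w hw hyw
    simp only [Finset.mem_sdiff, Finset.mem_univ, Finset.mem_insert, Finset.mem_singleton,
        true_and, not_or] at *
    rcases hy with rfl | rfl
    · have := Na w hyw; tauto
    · have := Nb w hyw; tauto)
  have hc : c' = x := by
    by_contra hne
    have hm : c' ∈ (Finset.univ \ {c, x} : Finset V) := by simp [cc.ne', hne]
    rw [← this] at hm
    simp only [Finset.mem_insert, Finset.mem_singleton] at hm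
    rcases hm with e | e
    · exact c1 e
    · exact c2 e
  subst hc
  obtain ⟨f, hf, _⟩ := h.ex true
  have e1 := hf a (by simp) b (by simp) ab
  have e2 := hf b (by simp) c (by simp) bc
  have e3 := hf c (by simp) a (by simp) ca
  have e4 := hf a (by simp) c' (by simp) ax
  have e5 := hf b (by simp) c' (by simp) bx
  have e6 := hf c (by simp) c' (by simp) cc
  revert e1 e2 e3 e4 e5 e6
  generalize f a = p; generalize f b = q; generalize f c = r; generalize f c' = s
  revert p q r s
  decide

lemma tri_prism (h : Ctx G 3 Φ) (ab : G.Adj a b) (bc : G.Adj b c) (ca : G.Adj c a) :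
    Nonempty (G ≃g TriangularPrism) := by
  obtain ⟨a', aa, a1, a2, Na⟩ := third_nb h ab ca.symm bc.ne
  obtain ⟨b', bb, b1, b2, Nb⟩ := third_nb h bc ab.symm ca.ne
  obtain ⟨c', cc, c1, c2, Nc⟩ := third_nb h ca bc.symm ab.ne
  have ab' : a' ≠ b' := by
    rintro rfl
    exact tri_ne h ab bc ca aa bb a2 cc c1 c2 Na Nb
  have bc' : b' ≠ c' := by
    rintro rfl
    exact tri_ne h bc ca ab bb cc b2 aa a1 a2 Nb Nc
  have ca' : c' ≠ a' := by
    rintro rfl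
    exact tri_ne h ca ab bc cc aa c2 bb b1 b2 Nc Na
  have t : Tri G a b c a' b' c' := ⟨ab, bc, ca, aa, bb, cc, ab', bc', ca', a1, a2, b1, b2, c1, c2,
    Na, Nb, Nc⟩
  have ab2 := t.adj h
  have bc2 := t.rot.adj h
  have ca2 := t.rot.rot.adj h
  have Na' : ∀ x, G.Adj a' x → x = b' ∨ x = c' ∨ x = a := by
    obtain ⟨w, hw, hw1, hw2, hw3⟩ := third_nb h ab2 ca2.symm bc'
    rcases hw3 a aa.symm with e | e | e
    · exact absurd e b2.symm
    · exact absurd e c1.symm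
    · subst e; exact hw3
  have Nb' : ∀ x, G.Adj b' x → x = c' ∨ x = a' ∨ x = b := by
    obtain ⟨w, hw, hw1, hw2, hw3⟩ := third_nb h bc2 ab2.symm ca'
    rcases hw3 b bb.symm with e | e | e
    · exact absurd e c2.symm
    · exact absurd e a1.symm
    · subst e; exact hw3
  have Nc' : ∀ x, G.Adj c' x → x = a' ∨ x = b' ∨ x = c := by
    obtain ⟨w, hw, hw1, hw2, hw3⟩ := third_nb h ca2 bc2.symm ab'
    rcases hw3 c cc.symm with e | e | e
    · exact absurd e a2.symm
    · exact absurd e b1.symm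
    · subst e; exact hw3
  have hall : ∀ x, x = a ∨ x = b ∨ x = c ∨ x = a' ∨ x = b' ∨ x = c' := by
    intro x
    by_cases hxa : x = a
    · exact Or.inl hxa
    have := (h.c3 a a).2 {b, c, a', b', c'} (by
      intro y hy
      simp only [Finset.mem_sdiff, Finset.mem_univ, Finset.mem_insert, Finset.mem_singleton,
        true_and, not_or] at *
      rcases hy with rfl | rfl | rfl | rfl | rfl
      · exact ⟨ab.ne', ab.ne'⟩
      · exact ⟨ca.ne, ca.ne⟩
      · exact ⟨aa.ne', aa.ne'⟩
      · exact ⟨b2, b2⟩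
      · exact ⟨c1, c1⟩) (by simp) (by
      intro y hy w hw hyw
      simp only [Finset.mem_sdiff, Finset.mem_univ, Finset.mem_insert, Finset.mem_singleton,
        true_and, not_or] at *
      rcases hy with rfl | rfl | rfl | rfl | rfl
      · have := Nb w hyw; tauto
      · have := Nc w hyw; tauto
      · have := Na' w hyw; tauto
      · have := Nb' w hyw; tauto
      · have := Nc' w hyw; tauto)
    have hm : x ∈ (Finset.univ \ {a, a} : Finset V) := by simp [hxa]
    rw [← this] at hm
    simp only [Finset.mem_insert, Finset.mem_singleton] at hm
    exact Or.inr hm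
  let φ : Fin 3 × Fin 2 → V := fun p => ![![a, b, c] p.1, ![a', b', c'] p.1] p.2
  have hinj : Function.Injective φ := by
    rintro ⟨i, j⟩ ⟨i', j'⟩ hh
    have := ab.ne; have := bc.ne; have := ca.ne; have := aa.ne; have := bb.ne; have := cc.ne
    fin_cases i <;> fin_cases j <;> fin_cases i' <;> fin_cases j' <;> simp [φ] at hh ⊢ <;>
      simp_all
  have hsur : Function.Surjective φ := by
    intro x
    rcases hall x with rfl | rfl | rfl | rfl | rfl | rfl
    · exact ⟨(0, 0), rfl⟩
    · exact ⟨(1, 0), rfl⟩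
    · exact ⟨(2, 0), rfl⟩
    · exact ⟨(0, 1), rfl⟩
    · exact ⟨(1, 1), rfl⟩
    · exact ⟨(2, 1), rfl⟩
  let eqv : Fin 3 × Fin 2 ≃ V := Equiv.ofBijective φ ⟨hinj, hsur⟩
  have n1 : ¬ G.Adj a b' := fun e => by
    rcases Na _ e with e | e | e
    exacts [bb.ne' e, b1 e, ab' e.symm]
  have n2 : ¬ G.Adj a c' := fun e => by have := Na _ e; have := cc.ne; simp_all
  have n3 : ¬ G.Adj b c' := fun e => by
    rcases Nb _ e with e | e | e
    exacts [cc.ne' e, c1 e, bc' e.symm]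
  have n4 : ¬ G.Adj b a' := fun e => by have := Nb _ e; have := aa.ne; simp_all
  have n5 : ¬ G.Adj c a' := fun e => by
    rcases Nc _ e with e | e | e
    exacts [aa.ne' e, a1 e, ca' e.symm]
  have n6 : ¬ G.Adj c b' := fun e => by have := Nc _ e; have := bb.ne; simp_all
  have hadj : ∀ p q, G.Adj (φ p) (φ q) ↔ TriangularPrism.Adj p q := by
    rintro ⟨i, j⟩ ⟨i', j'⟩
    simp only [TriangularPrism, SimpleGraph.boxProd_adj, SimpleGraph.top_adj]
    fin_cases i <;> fin_cases j <;> fin_cases i' <;> fin_cases j' <;>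
      simp [φ, ab, bc, ca, aa, bb, cc, ab2, bc2, ca2, ab.symm, bc.symm, ca.symm, aa.symm, bb.symm,
        cc.symm, ab2.symm, bc2.symm, ca2.symm, n1, n2, n3, n4, n5, n6, G.adj_comm a' b, G.adj_comm a' c,
        G.adj_comm b' a, G.adj_comm b' c, G.adj_comm c' a, G.adj_comm c' b]
  exact ⟨(RelIso.mk eqv (fun {p q} => hadj p q) : TriangularPrism ≃g G).symm⟩

end tri

end part14

section part15

/-! ## Cubic triangle-free graphs -/

section cubic
variable {G : SimpleGraph V}

/-- The obstruction to giving the three neighbours of `x` the same colour. -/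
structure TB (G : SimpleGraph V) (x u v w : V) (L : V → Finset (Fin 3)) (B : Finset V) : Prop where
  disj : ∀ b ∈ B, b ≠ u ∧ b ≠ v ∧ b ≠ w ∧ b ≠ x
  closed : ∀ b ∈ B, ∀ y, G.Adj b y → y = u ∨ y = v ∨ y = w ∨ y ∈ B
  att : ∀ b ∈ NC G B, G.Adj u b ∨ G.Adj v b ∨ G.Adj w b
  deg : ∀ b ∈ NC G B, (nb G B b).card = 2
  bad : Bad G B L
  one : ∀ b ∈ NC G B, 1 ∈ L b
  two : ∀ b ∈ NC G B, 2 ∈ L b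

lemma TB.leaf {x u v w z : V} {L : V → Finset (Fin 3)} {B E : Finset V} (h : TB G x u v w L B)
    (htf : ∀ a b c, G.Adj a b → G.Adj b c → G.Adj c a → False)
    (hC : Comp G B z E) (hE : E ⊆ NC G B) : 4 ≤ E.card := by
  by_contra hlt
  have hzE : z ∉ E := fun hz => by simpa using hC.sub hz
  have hEB : E ⊆ B := hC.sub.trans (Finset.erase_subset _ _)
  have hcl : ∀ e ∈ E, ∀ y ∈ B, G.Adj e y → y = z ∨ y ∈ E := by
    intro e he y hy hey
    by_cases hyz : y = z
    · exact Or.inl hyz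
    · exact Or.inr (hC.cl e he y (Finset.mem_erase.2 ⟨hyz, hy⟩) hey)
  have hsub : ∀ e ∈ E, nb G B e ⊆ (insert z E).erase e := by
    intro e he y hy
    rw [mem_nb] at hy
    have := hcl e he y hy.1 hy.2
    simp only [Finset.mem_erase, Finset.mem_insert]
    exact ⟨hy.2.ne', this⟩
  have hE2 : 2 ≤ E.card := by
    obtain ⟨e, he⟩ := hC.conn.1
    have h1 := Finset.card_le_card (hsub e he)
    rw [h.deg e (hE he), Finset.card_erase_of_mem (by simp [he]), Finset.card_insert_of_notMem hzE] at h1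
    omega
  have hnon : ∀ e ∈ E, ¬ G.Adj e z → E.card = 3 ∧ ∀ y ∈ E, y ≠ e → G.Adj e y := by
    intro e he hez
    have h1 : nb G B e ⊆ E.erase e := by
      intro y hy
      have h2 := hsub e he hy
      simp only [Finset.mem_erase, Finset.mem_insert] at h2 ⊢
      refine ⟨h2.1, h2.2.resolve_left ?_⟩
      rintro rfl
      exact hez (mem_nb.1 hy).2
    have h2 := Finset.card_le_card h1
    have hd := h.deg e (hE he)
    rw [Finset.card_erase_of_mem he] at h2
    refine ⟨by omega, fun y hy hye => ?_⟩
    have h3 := Finset.eq_of_subset_of_card_le h1 (by rw [Finset.card_erase_of_mem he]; omega)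
    have : y ∈ nb G B e := by rw [h3]; simp [hy, hye]
    exact (mem_nb.1 this).2
  have hnn : ∀ e ∈ E, ∀ e' ∈ E, e ≠ e' → ¬ G.Adj e z → ¬ G.Adj e' z → False := by
    intro e he e' he' hne hez hez'
    obtain ⟨h3, h4⟩ := hnon e he hez
    obtain ⟨_, h5⟩ := hnon e' he' hez'
    have : ((E.erase e).erase e').Nonempty := by
      rw [← Finset.card_pos, Finset.card_erase_of_mem (by simp [he', hne.symm]),
        Finset.card_erase_of_mem he]; omega
    obtain ⟨t, ht⟩ := this
    simp only [Finset.mem_erase] at ht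
    exact htf e e' t (h4 e' he' hne.symm) (h5 t ht.2.2 ht.1) (h4 t ht.2.2 ht.2.1).symm
  have hz2 : 2 ≤ (nb G E z).card := by
    by_cases hall : ∀ e ∈ E, G.Adj e z
    · have : nb G E z = E := by
        ext y; rw [mem_nb]; exact ⟨fun h => h.1, fun h => ⟨h, (hall y h).symm⟩⟩
      rw [this]; exact hE2
    · push Not at hall
      obtain ⟨e, he, hez⟩ := hall
      have h3 := (hnon e he hez).1
      have : E.erase e ⊆ nb G E z := by
        intro y hy
        rw [Finset.mem_erase] at hy
        rw [mem_nb]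
        refine ⟨hy.2, ?_⟩
        by_contra hyz
        exact hnn y hy.2 e he hy.1 (fun e => hyz e.symm) hez
      have := Finset.card_le_card this
      rw [Finset.card_erase_of_mem he] at this
      omega
  have hconn : Conn G (B \ E) := h.bad.conn.sdiff_comp (conn_singleton G z) (by simpa using hC.zB)
    (by rw [Finset.sdiff_singleton_eq_erase]; exact hC.sub)
    (by rw [Finset.sdiff_singleton_eq_erase]; exact hC.cl)
  let L' : V → Finset (Fin 3) := fun y => if y = z then (L z).erase 1 else L y
  have hnbz : (nb G (B \ E) z).card + (nb G E z).card = (nb G B z).card := by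
    rw [← Finset.card_union_of_disjoint]
    · congr 1
      ext y
      simp only [Finset.mem_union, mem_nb, Finset.mem_sdiff]
      constructor
      · rintro (⟨⟨h1, -⟩, h2⟩ | ⟨h1, h2⟩)
        exacts [⟨h1, h2⟩, ⟨hEB h1, h2⟩]
      · rintro ⟨h1, h2⟩
        by_cases hy : y ∈ E
        exacts [Or.inr ⟨hy, h2⟩, Or.inl ⟨⟨h1, hy⟩, h2⟩]
    · rw [Finset.disjoint_left]
      intro y hy hy'
      rw [mem_nb, Finset.mem_sdiff] at hy
      exact hy.1.2 (mem_nb.1 hy').1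
  have hzcard : (nb G (B \ E) z).card < (L' z).card := by
    have h1 := h.bad.deg z hC.zB
    have h2 := Finset.pred_card_le_card_erase (s := L z) (a := 1)
    simp only [L', if_pos]
    omega
  obtain ⟨c, hc, hcL⟩ := lcol_of_slack (L := L') h.bad.pos hconn (by
    intro y hy
    by_cases hyz : y = z
    · rw [hyz]; exact hzcard.le
    · simp only [L', if_neg hyz]
      exact (Finset.card_le_card (nb_mono Finset.sdiff_subset y)).trans
        (h.bad.deg y (Finset.mem_sdiff.1 hy).1))
    ⟨z, Finset.mem_sdiff.2 ⟨hC.zB, hzE⟩, hzcard⟩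
  let g : V → Fin 3 := fun y => if y ∈ E then (if G.Adj y z then 1 else 2) else c y
  have hcz : c z ≠ 1 := by
    have := hcL z (Finset.mem_sdiff.2 ⟨hC.zB, hzE⟩)
    simp only [L', if_pos] at this
    exact (Finset.mem_erase.1 this).1
  have hmix : ∀ e ∈ E, ∀ y ∈ B, y ∉ E → G.Adj e y → g e ≠ g y := by
    intro e he y hy hyE hey
    have := (hcl e he y hy hey).resolve_right hyE
    subst this
    simp only [g, he, hey, hyE, if_true, if_false]
    exact hcz.symm
  refine h.bad.ncol ⟨g, ?_, ?_⟩
  · intro a ha b hb hab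
    by_cases haE : a ∈ E <;> by_cases hbE : b ∈ E
    · by_cases h1 : G.Adj a z <;> by_cases h2 : G.Adj b z
      · exact absurd (htf a b z hab h2 h1.symm) id
      · simp [g, haE, hbE, h1, h2]
      · simp [g, haE, hbE, h1, h2]
      · exact absurd (hnn a haE b hbE hab.ne h1 h2) id
    · exact hmix a haE b hb hbE hab
    · exact (hmix b hbE a ha haE hab.symm).symm
    · simp only [g, if_neg haE, if_neg hbE]
      exact hc a (Finset.mem_sdiff.2 ⟨ha, haE⟩) b (Finset.mem_sdiff.2 ⟨hb, hbE⟩) hab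
  · intro y hy
    by_cases hyE : y ∈ E
    · simp only [g, if_pos hyE]
      split_ifs
      exacts [h.one y (hE hyE), h.two y (hE hyE)]
    · simp only [g, if_neg hyE]
      have := hcL y (Finset.mem_sdiff.2 ⟨hy, hyE⟩)
      simp only [L'] at this
      split_ifs at this with hyz
      · rw [hyz] at this ⊢; exact Finset.mem_of_mem_erase this
      · exact this

lemma other {B : Finset V} {v y : V} (h : (nb G B v).card = 2) (hy : y ∈ nb G B v) :
    ∃ m, m ≠ y ∧ m ∈ B ∧ G.Adj v m ∧ ∀ t ∈ B, G.Adj v t → t = y ∨ t = m := by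
  have h1 : ((nb G B v).erase y).card = 1 := by rw [Finset.card_erase_of_mem hy, h]
  obtain ⟨m, hm⟩ := Finset.card_eq_one.1 h1
  have h2 : m ∈ (nb G B v).erase y := by rw [hm]; simp
  rw [Finset.mem_erase, mem_nb] at h2
  refine ⟨m, h2.1, h2.2.1, h2.2.2, fun t ht hvt => ?_⟩
  by_cases hty : t = y
  · exact Or.inl hty
  · right
    have : t ∈ (nb G B v).erase y := Finset.mem_erase.2 ⟨hty, mem_nb.2 ⟨ht, hvt⟩⟩
    rw [hm] at this
    simpa using this

/-- A connected 2-regular triangle-free graph on six vertices is bipartite. -/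
lemma six_cycle {B : Finset V} (hB : Conn G B)
    (htf : ∀ a b c, G.Adj a b → G.Adj b c → G.Adj c a → False)
    (h2 : ∀ b ∈ B, (nb G B b).card = 2) (h6 : B.card = 6) :
    ∃ P : V → Prop, ∀ a ∈ B, ∀ b ∈ B, G.Adj a b → (P a ↔ ¬ P b) := by
  obtain ⟨b, hb⟩ := hB.1
  have : (nb G B b).Nonempty := by rw [← Finset.card_pos, h2 b hb]; norm_num
  obtain ⟨n1, hn1⟩ := this
  obtain ⟨n2, n21, hn2, bn2, Nb⟩ := other (h2 b hb) hn1
  rw [mem_nb] at hn1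
  obtain ⟨hn1, bn1⟩ := hn1
  obtain ⟨m1, m1b, hm1, nm1, Nn1⟩ := other (h2 n1 hn1) (mem_nb.2 ⟨hb, bn1.symm⟩)
  obtain ⟨m2, m2b, hm2, nm2, Nn2⟩ := other (h2 n2 hn2) (mem_nb.2 ⟨hb, bn2.symm⟩)
  obtain ⟨p, pn1, hp, mp1, Nm1⟩ := other (h2 m1 hm1) (mem_nb.2 ⟨hn1, nm1.symm⟩)
  obtain ⟨q, qn2, hq, mq2, Nm2⟩ := other (h2 m2 hm2) (mem_nb.2 ⟨hn2, nm2.symm⟩)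
  have nn : ¬ G.Adj n1 n2 := fun e => htf b n1 n2 bn1 e bn2.symm
  have small : ∀ T : Finset V, T ⊆ B → b ∈ T → T.card < 6 →
      (∀ u ∈ T, ∀ v ∈ B, G.Adj u v → v ∈ T) → False := by
    intro T hT hbT hc hcl
    have := hB.2 T hT ⟨b, hbT⟩ hcl
    rw [this] at hc; omega
  have hm12 : m1 ≠ m2 := by
    rintro rfl
    have hp2 : p = n2 := by
      rcases Nm1 n2 hn2 nm2.symm with e | e
      · exact absurd e n21
      · exact e.symm
    subst hp2
    refine small {b, n1, p, m1} ?_ (by simp) (lt_of_le_of_lt Finset.card_le_four (by norm_num)) ?_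
    · intro t ht; simp only [Finset.mem_insert, Finset.mem_singleton] at ht
      rcases ht with rfl | rfl | rfl | rfl <;> assumption
    · intro s hs t ht hst
      simp only [Finset.mem_insert, Finset.mem_singleton] at hs ⊢
      rcases hs with rfl | rfl | rfl | rfl
      · rcases Nb t ht hst with e | e <;> simp [e]
      · rcases Nn1 t ht hst with e | e <;> simp [e]
      · rcases Nn2 t ht hst with e | e <;> simp [e]
      · rcases Nm1 t ht hst with e | e <;> simp [e]
  have hpm2 : p ≠ m2 := by
    rintro rfl
    have hq : q = m1 := by
      rcases Nm2 m1 hm1 mp1.symm with e | e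
      · subst e; exact absurd nm1 nn
      · exact e.symm
    subst hq
    refine small {b, n1, n2, q, p} ?_ (by simp) (lt_of_le_of_lt Finset.card_le_five (by norm_num)) ?_
    · intro t ht; simp only [Finset.mem_insert, Finset.mem_singleton] at ht
      rcases ht with rfl | rfl | rfl | rfl | rfl <;> assumption
    · intro s hs t ht hst
      simp only [Finset.mem_insert, Finset.mem_singleton] at hs ⊢
      rcases hs with rfl | rfl | rfl | rfl | rfl
      · rcases Nb t ht hst with e | e <;> simp [e]
      · rcases Nn1 t ht hst with e | e <;> simp [e]
      · rcases Nn2 t ht hst with e | e <;> simp [e]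
      · rcases Nm1 t ht hst with e | e <;> simp [e]
      · rcases Nm2 t ht hst with e | e <;> simp [e]
  have m1n2 : m1 ≠ n2 := by rintro rfl; exact nn nm1
  have m2n1 : m2 ≠ n1 := by rintro rfl; exact nn nm2.symm
  have bm1 : ¬ G.Adj b m1 := fun e => by
    rcases Nb m1 hm1 e with e | e
    · exact nm1.ne' e
    · exact m1n2 e
  have bm2 : ¬ G.Adj b m2 := fun e => by
    rcases Nb m2 hm2 e with e | e
    · exact m2n1 e
    · exact nm2.ne' e
  have pb : p ≠ b := by rintro rfl; exact bm1 mp1.symm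
  have pn2 : p ≠ n2 := by
    rintro rfl
    rcases Nn2 m1 hm1 mp1.symm with e | e
    exacts [m1b e, hm12 e]
  have mm : ¬ G.Adj m1 m2 := fun e => by
    rcases Nm1 m2 hm2 e with e | e
    exacts [m2n1 e, hpm2 e.symm]
  have n1p : ¬ G.Adj n1 p := fun e => htf n1 m1 p nm1 mp1 e.symm
  have n2p : ¬ G.Adj n2 p := fun e => by
    rcases Nn2 p hp e with e | e
    exacts [pb e, hpm2 e]
  have hBeq : B = {b, n1, n2, m1, m2, p} := by
    symm
    apply Finset.eq_of_subset_of_card_le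
    · intro t ht; simp only [Finset.mem_insert, Finset.mem_singleton] at ht
      rcases ht with rfl | rfl | rfl | rfl | rfl | rfl <;> assumption
    · rw [h6]
      have := bn1.ne; have := bn2.ne; have := nm1.ne; have := nm2.ne; have := mp1.ne
      rw [Finset.card_insert_of_notMem, Finset.card_insert_of_notMem, Finset.card_insert_of_notMem,
        Finset.card_insert_of_notMem, Finset.card_insert_of_notMem, Finset.card_singleton]
      all_goals simp only [Finset.mem_insert, Finset.mem_singleton, not_or]
      · exact hpm2.symm
      · exact ⟨hm12, mp1.ne⟩
      · exact ⟨m1n2.symm, nm2.ne, pn2.symm⟩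
      · exact ⟨n21.symm, nm1.ne, m2n1.symm, pn1.symm⟩
      · exact ⟨bn1.ne, bn2.ne, m1b.symm, m2b.symm, pb.symm⟩
  refine ⟨fun t => t = b ∨ t = m1 ∨ t = m2, ?_⟩
  have hloop : ∀ t, ¬ G.Adj t t := fun t => G.loopless.irrefl t
  have e1 : ¬ (n1 = b ∨ n1 = m1 ∨ n1 = m2) := by
    rintro (e | e | e)
    exacts [bn1.ne' e, nm1.ne e, m2n1 e.symm]
  have e2 : ¬ (n2 = b ∨ n2 = m1 ∨ n2 = m2) := by
    rintro (e | e | e)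
    exacts [bn2.ne' e, m1n2 e.symm, nm2.ne e]
  have e3 : ¬ (p = b ∨ p = m1 ∨ p = m2) := by
    rintro (e | e | e)
    exacts [pb e, mp1.ne' e, hpm2 e]
  intro s hs t ht hst
  rw [hBeq] at hs ht
  simp only [Finset.mem_insert, Finset.mem_singleton] at hs ht
  have key : ∀ s t, G.Adj s t → (s = b ∨ s = m1 ∨ s = m2) → ¬ (t = b ∨ t = m1 ∨ t = m2) := by
    rintro s t hst (rfl | rfl | rfl) (rfl | rfl | rfl)
    exacts [hloop _ hst, bm1 hst, bm2 hst, bm1 hst.symm, hloop _ hst, mm hst, bm2 hst.symm,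
      mm hst.symm, hloop _ hst]
  have key2 : ∀ s t, G.Adj s t → (s = n1 ∨ s = n2 ∨ s = p) → ¬ (t = n1 ∨ t = n2 ∨ t = p) := by
    rintro s t hst (rfl | rfl | rfl) (rfl | rfl | rfl)
    exacts [hloop _ hst, nn hst, n1p hst, nn hst.symm, hloop _ hst, n2p hst, n1p hst.symm,
      n2p hst.symm, hloop _ hst]
  constructor
  · exact key s t hst
  · intro hnt
    have ht' : t = n1 ∨ t = n2 ∨ t = p := by clear key key2 e1 e2 e3; tauto
    have hs' := key2 t s hst.symm ht'
    clear key key2 e1 e2 e3 hnt ht' ht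
    tauto

variable [Fintype V] {Φ : (V → Fin 3) → Bool}

lemma TB.full {x u v w : V} {L : V → Finset (Fin 3)} {B : Finset V} (h : TB G x u v w L B)
    (hc3 : Conn G (Finset.univ \ {v, w})) (huv : u ≠ v) (huw : u ≠ w) (hxv : x ≠ v) (hxw : x ≠ w)
    (hNx : ∀ y, G.Adj x y → y = u ∨ y = v ∨ y = w)
    (hu : ∀ y, G.Adj u y → y ∈ insert x B) : ∀ y, y = u ∨ y = v ∨ y = w ∨ y = x ∨ y ∈ B := by
  have h1 : insert u (insert x B) = Finset.univ \ {v, w} := by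
    apply hc3.2
    · intro y hy
      simp only [Finset.mem_insert, Finset.mem_sdiff, Finset.mem_univ, true_and,
        Finset.mem_singleton, not_or] at hy ⊢
      rcases hy with rfl | rfl | hy
      · exact ⟨huv, huw⟩
      · exact ⟨hxv, hxw⟩
      · exact ⟨(h.disj y hy).2.1, (h.disj y hy).2.2.1⟩
    · exact ⟨u, by simp⟩
    · intro s hs t ht hst
      simp only [Finset.mem_insert, Finset.mem_sdiff, Finset.mem_univ, true_and,
        Finset.mem_singleton, not_or] at hs ht ⊢
      rcases hs with rfl | rfl | hs
      · have := hu t hst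
        rw [Finset.mem_insert] at this
        exact Or.inr this
      · rcases hNx t hst with e | e | e
        exacts [Or.inl e, absurd e ht.1, absurd e ht.2]
      · rcases h.closed s hs t hst with e | e | e | e
        exacts [Or.inl e, absurd e ht.1, absurd e ht.2, Or.inr (Or.inr e)]
  intro y
  by_cases hv : y = v
  · exact Or.inr (Or.inl hv)
  by_cases hw : y = w
  · exact Or.inr (Or.inr (Or.inl hw))
  have : y ∈ insert u (insert x B) := by rw [h1]; simp [hv, hw]
  simp only [Finset.mem_insert] at this
  rcases this with e | e | e
  exacts [Or.inl e, Or.inr (Or.inr (Or.inr (Or.inl e))), Or.inr (Or.inr (Or.inr (Or.inr e)))]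

lemma no_three (h : Ctx G 3 Φ) (htf : ∀ a b c, G.Adj a b → G.Adj b c → G.Adj c a → False)
    (x : V) : False := by
  obtain ⟨u, v, w, huv, huw, hvw, hN⟩ := Finset.card_eq_three.1 (h.reg x)
  have hNx : ∀ y, G.Adj x y ↔ y = u ∨ y = v ∨ y = w := by
    intro y
    have : y ∈ nb G Finset.univ x ↔ G.Adj x y := by simp [mem_nb]
    rw [← this, hN]; simp
  have xu : G.Adj x u := (hNx u).2 (by simp)
  have xv : G.Adj x v := (hNx v).2 (by simp)
  have xw : G.Adj x w := (hNx w).2 (by simp)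
  have hind : ∀ a ∈ ({u, v, w} : Finset V), ∀ b ∈ ({u, v, w} : Finset V), ¬ G.Adj a b := by
    intro a ha b hb hab
    exact htf x a b ((hNx a).2 (by simpa using ha)) hab ((hNx b).2 (by simpa using hb)).symm
  have hno : ¬ ∃ c, ProperOn G Finset.univ c ∧ ∀ y ∈ ({u, v, w} : Finset V), c y = (fun _ => (0 : Fin 3)) y := by
    rintro ⟨c, hc, hc0⟩
    have hi : ∀ i, i = Φ c := by
      intro i
      obtain ⟨a, b, ha, hb, hab, hnab, hl, -⟩ := h.nbhd x i
      rw [← hl]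
      apply h.col ⟨hab, hnab, x, ha, hb⟩ hc
      rw [hc0 a (by simpa using (hNx a).1 ha), hc0 b (by simpa using (hNx b).1 hb)]
    have := (hi true).trans (hi false).symm
    simp at this
  obtain ⟨B, hB⟩ := pre (by norm_num) h.reg {u, v, w} (fun _ => 0)
    (fun a ha b hb hab => absurd hab (hind a ha b hb)) hno
  have hnbD : ∀ b ∈ B, (nb G {u, v, w} b).card ≤ 1 := by
    intro b hb
    rw [Finset.card_le_one]
    intro s hs t ht
    rw [mem_nb] at hs ht
    exact hB.inj h.reg hb s hs.1 t ht.1 hs.2 ht.2 rfl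
  have hdeg3 : ∀ b ∈ NC G B, (nb G B b).card < 3 := by
    intro b hb
    by_contra hcon
    have hcl := hB.clique hb (by omega)
    obtain ⟨s, hs, t, ht, hst⟩ := Finset.one_lt_card.1 (show 1 < (nb G B b).card by omega)
    exact htf b s t (mem_nb.1 hs).2 (hcl s hs t ht hst) (mem_nb.1 ht).2.symm
  have hNCB : ∀ b ∈ NC G B, b ∈ B := fun b hb => (mem_NC.1 hb).1
  have hL : ∀ i : Fin 3, i ≠ 0 → ∀ b, i ∈ preL G {u, v, w} (fun _ => (0 : Fin 3)) b := by
    intro i hi b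
    rw [hB.mem_L]
    intro _ _ _ e
    exact hi e.symm
  have hT : TB G x u v w (preL G {u, v, w} (fun _ => (0 : Fin 3))) B := by
    refine ⟨?_, ?_, ?_, ?_, hB.bad, fun b _ => hL 1 (by decide) b, fun b _ => hL 2 (by decide) b⟩
    · intro b hb
      have := hB.disj b hb
      simp only [Finset.mem_insert, Finset.mem_singleton, not_or] at this
      refine ⟨this.1, this.2.1, this.2.2, ?_⟩
      rintro rfl
      exact huv (hB.inj h.reg hb u (by simp) v (by simp) xu xv rfl)
    · intro b hb y hby
      have := hB.closed b hb y hby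
      simp only [Finset.mem_insert, Finset.mem_singleton, not_or] at this
      by_cases h1 : y = u
      · exact Or.inl h1
      by_cases h2 : y = v
      · exact Or.inr (Or.inl h2)
      by_cases h3 : y = w
      · exact Or.inr (Or.inr (Or.inl h3))
      exact Or.inr (Or.inr (Or.inr (this ⟨h1, h2, h3⟩)))
    · intro b hb
      have h1 := hB.deg h.reg (hNCB b hb)
      have h2 := hdeg3 b hb
      have : (nb G {u, v, w} b).Nonempty := by rw [← Finset.card_pos]; omega
      obtain ⟨d, hd⟩ := this
      rw [mem_nb] at hd
      simp only [Finset.mem_insert, Finset.mem_singleton] at hd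
      obtain ⟨rfl | rfl | rfl, hd⟩ := hd
      exacts [Or.inl hd.symm, Or.inr (Or.inl hd.symm), Or.inr (Or.inr hd.symm)]
    · intro b hb
      have h1 := hB.deg h.reg (hNCB b hb)
      have h2 := hdeg3 b hb
      have h3 := hnbD b (hNCB b hb)
      omega
  have hcard : ∀ d, G.Adj x d → ((nb G Finset.univ d).erase x).card = 2 := by
    intro d hd
    rw [Finset.card_erase_of_mem (mem_nb.2 ⟨by simp, hd.symm⟩), h.reg]
  have hNCsub : NC G B ⊆ (nb G B u ∪ nb G B v) ∪ nb G B w := by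
    intro b hb
    simp only [Finset.mem_union, mem_nb]
    have hbB := hNCB b hb
    rcases hT.att b hb with e | e | e
    exacts [Or.inl (Or.inl ⟨hbB, e⟩), Or.inl (Or.inr ⟨hbB, e⟩), Or.inr ⟨hbB, e⟩]
  have hNCcard : (NC G B).card ≤ (nb G B u).card + (nb G B v).card + (nb G B w).card :=
    (Finset.card_le_card hNCsub).trans ((Finset.card_union_le _ _).trans
      (Nat.add_le_add_right (Finset.card_union_le _ _) _))
  have hxB : x ∉ B := fun hx => (hT.disj x hx).2.2.2 rfl
  have hsub2 : ∀ d, nb G B d ⊆ (nb G Finset.univ d).erase x := by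
    intro d y hy
    rw [mem_nb] at hy
    rw [Finset.mem_erase, mem_nb]
    exact ⟨fun e => hxB (e ▸ hy.1), by simp, hy.2⟩
  have hle2 : ∀ d, G.Adj x d → (nb G B d).card ≤ 2 := fun d hd =>
    (Finset.card_le_card (hsub2 d)).trans (hcard d hd).le
  have h2u := hle2 u xu
  have h2v := hle2 v xv
  have h2w := hle2 w xw
  by_cases hall : B ⊆ NC G B
  swap
  · have hB2 : 2 ≤ B.card := by
      by_contra hlt
      apply hall
      have : B.card = 1 := by
        have := Finset.card_pos.2 hB.bad.conn.1; omega
      obtain ⟨b, rfl⟩ := Finset.card_eq_one.1 this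
      have h0 : nb G {b} b = ∅ := by
        ext y; simp only [mem_nb, Finset.mem_singleton]
        constructor
        · rintro ⟨rfl, e⟩; exact absurd e (G.loopless.irrefl _)
        · intro e; simp at e
      have h1 := hB.deg h.reg (Finset.mem_singleton_self b)
      rw [h0] at h1
      have h2 := hnbD b (by simp)
      simp at h1
      omega
    obtain ⟨z1, E1, z2, E2, hC1, hC2, hE1, hE2, hdis⟩ := two_leaves hB.bad.conn hB2 hall
    have h1 := hT.leaf htf hC1 hE1
    have h2 := hT.leaf htf hC2 hE2
    have h3 : (E1 ∪ E2).card ≤ (NC G B).card := Finset.card_le_card (Finset.union_subset hE1 hE2)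
    rw [Finset.card_union_of_disjoint hdis] at h3
    omega
  have hBNC : NC G B = B := Finset.Subset.antisymm hNCB hall
  rw [hBNC] at hNCcard
  have hB4 : 4 ≤ B.card := by
    obtain ⟨b, hb⟩ := hB.bad.conn.1
    obtain ⟨s, t, hst, hnb⟩ := Finset.card_eq_two.1 (hT.deg b (hall hb))
    have hs : s ∈ nb G B b := by rw [hnb]; simp
    have ht : t ∈ nb G B b := by rw [hnb]; simp
    rw [mem_nb] at hs ht
    obtain ⟨m, hm1, hm2, hm3, -⟩ := other (hT.deg s (hall hs.1)) (mem_nb.2 ⟨hb, hs.2.symm⟩)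
    have hmt : m ≠ t := by
      rintro rfl
      exact htf b s m hs.2 hm3 ht.2.symm
    have hsub : ({m, b, s, t} : Finset V) ⊆ B := by
      intro y hy
      simp only [Finset.mem_insert, Finset.mem_singleton] at hy
      rcases hy with rfl | rfl | rfl | rfl
      exacts [hm2, hb, hs.1, ht.1]
    have := Finset.card_le_card hsub
    rw [Finset.card_insert_of_notMem, Finset.card_insert_of_notMem, Finset.card_insert_of_notMem,
      Finset.card_singleton] at this
    · exact this
    · simpa using hst
    · simp [hs.2.ne, ht.2.ne]
    · simp [hm1, hm3.ne', hmt]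
  -- some neighbour of `x` has all its other neighbours in `B`
  have hfulld : ∀ d, G.Adj x d → 2 ≤ (nb G B d).card → ∀ y, G.Adj d y → y ∈ insert x B := by
    intro d hd h2 y hy
    have heq := Finset.eq_of_subset_of_card_le (hsub2 d) (by rw [hcard d hd]; exact h2)
    by_cases hyx : y = x
    · simp [hyx]
    · have : y ∈ (nb G Finset.univ d).erase x := Finset.mem_erase.2 ⟨hyx, mem_nb.2 ⟨by simp, hy⟩⟩
      rw [← heq, mem_nb] at this
      exact Finset.mem_insert_of_mem this.1
  have hcover : ∀ y, y = u ∨ y = v ∨ y = w ∨ y = x ∨ y ∈ B := by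
    have T2 : TB G x v u w (preL G {u, v, w} (fun _ => (0 : Fin 3))) B :=
      ⟨fun b hb => by have := hT.disj b hb; tauto, fun b hb y hy => by
        have := hT.closed b hb y hy; tauto, fun b hb => by have := hT.att b hb; tauto,
        hT.deg, hT.bad, hT.one, hT.two⟩
    have T3 : TB G x w u v (preL G {u, v, w} (fun _ => (0 : Fin 3))) B :=
      ⟨fun b hb => by have := hT.disj b hb; tauto, fun b hb y hy => by
        have := hT.closed b hb y hy; tauto, fun b hb => by have := hT.att b hb; tauto,
        hT.deg, hT.bad, hT.one, hT.two⟩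
    have hor : 2 ≤ (nb G B u).card ∨ 2 ≤ (nb G B v).card ∨ 2 ≤ (nb G B w).card := by omega
    rcases hor with e | e | e
    · exact hT.full (h.c3 v w) huv huw xv.ne xw.ne (fun y hy => (hNx y).1 hy) (hfulld u xu e)
    · intro y
      have := T2.full (h.c3 u w) huv.symm hvw xu.ne xw.ne (fun y hy => by
        have := (hNx y).1 hy; tauto) (hfulld v xv e) y
      tauto
    · intro y
      have := T3.full (h.c3 u v) huw.symm hvw.symm xu.ne xv.ne (fun y hy => by
        have := (hNx y).1 hy; tauto) (hfulld w xw e) y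
      tauto
  have heq2 : ∀ d, d ∈ ({u, v, w} : Finset V) → (nb G B d).card = 2 := by
    intro d hd
    have hxd : G.Adj x d := (hNx d).2 (by simpa using hd)
    rw [← hcard d hxd]
    congr 1
    apply Finset.Subset.antisymm (hsub2 d)
    intro y hy
    rw [Finset.mem_erase, mem_nb] at hy
    rw [mem_nb]
    refine ⟨?_, hy.2.2⟩
    have hyD : y ∉ ({u, v, w} : Finset V) := fun hyD => hind d hd y hyD hy.2.2
    simp only [Finset.mem_insert, Finset.mem_singleton, not_or] at hyD
    rcases hcover y with e | e | e | e | e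
    exacts [absurd e hyD.1, absurd e hyD.2.1, absurd e hyD.2.2, absurd e hy.1, e]
  have hdisj : ∀ d ∈ ({u, v, w} : Finset V), ∀ d' ∈ ({u, v, w} : Finset V), d ≠ d' →
      Disjoint (nb G B d) (nb G B d') := by
    intro d hd d' hd' hne
    rw [Finset.disjoint_left]
    intro y hy hy'
    rw [mem_nb] at hy hy'
    exact hne (hB.inj h.reg hy.1 d hd d' hd' hy.2.symm hy'.2.symm rfl)
  have h6 : B.card = 6 := by
    have hsub : (nb G B u ∪ nb G B v) ∪ nb G B w ⊆ B := by
      intro y hy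
      simp only [Finset.mem_union, mem_nb] at hy
      rcases hy with (e | e) | e <;> exact e.1
    have h1 := Finset.card_le_card hsub
    rw [Finset.card_union_of_disjoint, Finset.card_union_of_disjoint, heq2 u (by simp),
      heq2 v (by simp), heq2 w (by simp)] at h1
    · omega
    · exact hdisj u (by simp) v (by simp) huv
    · rw [Finset.disjoint_union_left]
      exact ⟨hdisj u (by simp) w (by simp) huw, hdisj v (by simp) w (by simp) hvw⟩
  obtain ⟨P, hP⟩ := six_cycle hB.bad.conn htf (fun b hb => hT.deg b (hall hb)) h6
  refine hB.bad.ncol ⟨fun y => if P y then 1 else 2, ?_, ?_⟩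
  · intro a ha b hb hab
    have := hP a ha b hb hab
    by_cases h1 : P a
    · simp [h1, this.1 h1]
    · have h2 : P b := by
        by_contra h2; exact h1 (this.2 h2)
      simp [h1, h2]
  · intro y hy
    dsimp only
    split_ifs
    exacts [hL 1 (by decide) y, hL 2 (by decide) y]

end cubic

end part15

section part16

/-! ## Gluing along separators -/

structure Split (G : SimpleGraph V) (S T : Finset V) : Prop where
  cov : ∀ v, v ∈ S ∨ v ∈ T
  no : ∀ u ∈ S, ∀ v ∈ T, u ∉ T → v ∉ S → ¬ G.Adj u v

lemma Split.symm {G : SimpleGraph V} {S T : Finset V} (h : Split G S T) : Split G T S :=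
  ⟨fun v => (h.cov v).symm, fun u hu v hv h1 h2 e => h.no v hv u hu h2 h1 e.symm⟩

section glue
variable [Fintype V] {G : SimpleGraph V} {k : ℕ} {S T : Finset V}

lemma Split.proper (h : Split G S T) {c : V → Fin k} (hS : ProperOn G S c) (hT : ProperOn G T c) :
    ProperOn G Finset.univ c := by
  intro u _ v _ huv
  by_cases h1 : u ∈ S <;> by_cases h2 : v ∈ S
  · exact hS u h1 v h2 huv
  · by_cases h3 : u ∈ T
    · exact hT u h3 v ((h.cov v).resolve_left h2) huv
    · exact absurd huv (h.no u h1 v ((h.cov v).resolve_left h2) h3 h2)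
  · by_cases h3 : v ∈ T
    · exact hT u ((h.cov u).resolve_left h1) v h3 huv
    · exact absurd huv.symm (h.no v h2 u ((h.cov u).resolve_left h1) h3 h1)
  · exact hT u ((h.cov u).resolve_left h1) v ((h.cov v).resolve_left h2) huv

lemma Split.proper_perm (h : Split G S T) {c : V → Fin k} (hc : ProperOn G Finset.univ c)
    (π : Equiv.Perm (Fin k)) (hπ : ∀ t ∈ S, t ∈ T → π (c t) = c t) :
    ProperOn G Finset.univ (fun v => if v ∈ S then c v else π (c v)) := by
  apply h.proper
  · intro u hu v hv huv
    simp only [if_pos hu, if_pos hv]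
    exact hc u (by simp) v (by simp) huv
  · have : ∀ u ∈ T, (if u ∈ S then c u else π (c u)) = π (c u) := by
      intro u hu
      split_ifs with h1
      · exact (hπ u h1 hu).symm
      · rfl
    intro u hu v hv huv
    dsimp only
    rw [this u hu, this v hv]
    exact fun e => hc u (by simp) v (by simp) huv (π.injective e)

/-- Permuting the colours on one side of a separator, fixing the colours of the separator. -/
lemma Split.perm (h : Split G S T) {c : V → Fin k} (hc : ProperOn G Finset.univ c) (n : ℕ) :
    ∀ π : Equiv.Perm (Fin k), π.support.card = n → (∀ t ∈ S, t ∈ T → π (c t) = c t) →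
    KE G Finset.univ c (fun v => if v ∈ S then c v else π (c v)) := by
  induction n using Nat.strong_induction_on with
  | _ n ih =>
  intro π hn hπ
  by_cases h1 : π = 1
  · subst h1
    exact KE.of_eqOn hc (fun v _ => by simp)
  · have : ∃ a, π a ≠ a := by
      by_contra hcon
      push Not at hcon
      exact h1 (Equiv.ext hcon)
    obtain ⟨a, ha⟩ := this
    have hlt := Equiv.Perm.card_support_swap_mul ha
    have hJ : ∀ t ∈ S, t ∈ T → (Equiv.swap a (π a) * π) (c t) = c t := by
      intro t ht ht'
      rw [Equiv.Perm.mul_apply, hπ t ht ht']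
      apply Equiv.swap_apply_of_ne_of_ne
      · intro e; rw [← e] at ha; exact ha (hπ t ht ht')
      · intro e
        have := hπ t ht ht'
        rw [e] at this
        exact ha (π.injective this)
    refine (ih _ (hn ▸ hlt) _ rfl hJ).trans (KS.ke ⟨h.proper_perm hc _ hJ, h.proper_perm hc _ hπ,
      a, π a, fun v _ => ?_⟩)
    dsimp only
    split_ifs with hv
    · exact Or.inl rfl
    · rw [Equiv.Perm.mul_apply]
      by_cases e1 : π (c v) = a
      · right; rw [e1]; simp
      by_cases e2 : π (c v) = π a
      · right; rw [e2]; simp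
      · left; rw [Equiv.swap_apply_of_ne_of_ne e1 e2]

/-- A step on one side extends to a step of the whole graph. -/
lemma Split.step (h : Split G S T)
    (hK : ∀ u ∈ S, ∀ v ∈ S, u ∈ T → v ∈ T → u ≠ v → G.Adj u v)
    {c c' f : V → Fin k} (hcc : KS G S c c') (hf : ProperOn G Finset.univ f)
    (hfc : ∀ v ∈ S, f v = c v) :
    ∃ (f' : V → Fin k) (π : Equiv.Perm (Fin k)), KE G Finset.univ f f' ∧ (∀ v ∈ S, f' v = c' v) ∧
      ∀ v ∈ T, f' v = π (f v) := by
  obtain ⟨hc, hc', a, b, hab⟩ := hcc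
  by_cases hch : ∃ t ∈ S, t ∈ T ∧ c' t ≠ c t
  · obtain ⟨t, htS, htT, hct⟩ := hch
    have ht := (hab t htS).resolve_left hct
    have hTeq : ∀ v ∈ T, v ∈ S → c' v = Equiv.swap a b (f v) := by
      intro v hv hvS
      rw [hfc v hvS]
      by_cases hvt : v = t
      · subst hvt
        obtain ⟨e1 | e1, e2 | e2⟩ := ht
        · rw [e1, e2] at hct; exact absurd rfl hct
        · rw [e1, e2, Equiv.swap_apply_left]
        · rw [e1, e2, Equiv.swap_apply_right]
        · rw [e1, e2] at hct; exact absurd rfl hct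
      · have hadj := hK v hvS t htS hv htT hvt
        have n1 := hc v hvS t htS hadj
        have n2 := hc' v hvS t htS hadj
        have hv' := hab v hvS
        by_cases ea : c v = a
        · rw [ea, Equiv.swap_apply_left]
          rw [ea] at hv' n1
          have ctb : c t = b := ht.1.resolve_left (fun e => n1 e.symm)
          rw [ctb] at hct n1
          have c'ta : c' t = a := ht.2.resolve_right hct
          rw [c'ta] at n2
          rcases hv' with e | ⟨-, e⟩
          · exact absurd e n2
          · exact e.resolve_left n2
        · by_cases eb : c v = b
          · rw [eb, Equiv.swap_apply_right]
            rw [eb] at hv' n1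
            have cta : c t = a := ht.1.resolve_right (fun e => n1 e.symm)
            rw [cta] at hct n1
            have c'tb : c' t = b := ht.2.resolve_left hct
            rw [c'tb] at n2
            rcases hv' with e | ⟨-, e⟩
            · exact absurd e n2
            · exact e.resolve_right n2
          · rw [Equiv.swap_apply_of_ne_of_ne ea eb]
            rcases hv' with e | ⟨e, -⟩
            · exact e
            · exact absurd e (by simp [ea, eb])
    have hT2 : ∀ v ∈ T, (if v ∈ S then c' v else Equiv.swap a b (f v)) = Equiv.swap a b (f v) := by
      intro v hv
      split_ifs with hvS
      · exact hTeq v hv hvS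
      · rfl
    refine ⟨fun v => if v ∈ S then c' v else Equiv.swap a b (f v), Equiv.swap a b, ?_, ?_, hT2⟩
    · refine KS.ke ⟨hf, h.proper ?_ ?_, a, b, fun v _ => ?_⟩
      · exact hc'.congr (fun v hv => by simp [hv])
      · intro u hu v hv huv
        dsimp only
        rw [hT2 u hu, hT2 v hv]
        exact fun e => hf u (by simp) v (by simp) huv ((Equiv.swap a b).injective e)
      · by_cases hv : v ∈ S
        · simp only [if_pos hv]
          rw [hfc v hv]
          exact hab v hv
        · simp only [if_neg hv]
          by_cases ea : f v = a
          · right; rw [ea]; simp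
          by_cases eb : f v = b
          · right; rw [eb]; simp
          · left; rw [Equiv.swap_apply_of_ne_of_ne ea eb]
    · intro v hv; simp [hv]
  · push Not at hch
    have hT2 : ∀ v ∈ T, (if v ∈ S then c' v else f v) = f v := by
      intro v hv
      split_ifs with hvS
      · rw [hch v hvS hv, hfc v hvS]
      · rfl
    refine ⟨fun v => if v ∈ S then c' v else f v, 1, ?_, ?_, fun v hv => by simp [hT2 v hv]⟩
    · refine KS.ke ⟨hf, h.proper ?_ ?_, a, b, fun v _ => ?_⟩
      · exact hc'.congr (fun v hv => by simp [hv])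
      · exact (hf.mono (Finset.subset_univ T)).congr hT2
      · by_cases hv : v ∈ S
        · simp only [if_pos hv]
          rw [hfc v hv]
          exact hab v hv
        · simp only [if_neg hv]
          exact Or.inl trivial
    · intro v hv; simp [hv]

lemma Split.chain (h : Split G S T)
    (hK : ∀ u ∈ S, ∀ v ∈ S, u ∈ T → v ∈ T → u ≠ v → G.Adj u v)
    {f c' : V → Fin k} (hf : ProperOn G Finset.univ f) (hcc : KE G S f c') :
    ∃ (f' : V → Fin k) (π : Equiv.Perm (Fin k)), KE G Finset.univ f f' ∧ (∀ v ∈ S, f' v = c' v) ∧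
      ∀ v ∈ T, f' v = π (f v) := by
  induction hcc with
  | refl => exact ⟨f, 1, KE.refl _, fun _ _ => rfl, fun _ _ => rfl⟩
  | tail _ hs ih =>
    obtain ⟨f1, π1, h1, h2, h3⟩ := ih
    obtain ⟨f2, π2, h4, h5, h6⟩ := h.step hK hs (h1.proper hf) h2
    refine ⟨f2, π2 * π1, h1.trans h4, h5, fun v hv => ?_⟩
    rw [h6 v hv, h3 v hv, Equiv.Perm.mul_apply]

/-- Kempe classes of a graph with a clique separator. -/
lemma Split.amalgam (h : Split G S T)
    (hK : ∀ u ∈ S, ∀ v ∈ S, u ∈ T → v ∈ T → u ≠ v → G.Adj u v)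
    (hS : ∀ c c' : V → Fin k, ProperOn G S c → ProperOn G S c' → KE G S c c')
    (hT : ∀ c c' : V → Fin k, ProperOn G T c → ProperOn G T c' → KE G T c c') :
    ∀ c c' : V → Fin k, ProperOn G Finset.univ c → ProperOn G Finset.univ c' →
      KE G Finset.univ c c' := by
  intro c c' hc hc'
  obtain ⟨f, -, h1, h2, -⟩ := h.chain hK hc (hS c c' (hc.mono (Finset.subset_univ _))
    (hc'.mono (Finset.subset_univ _)))
  have hf := h1.proper hc
  obtain ⟨g, π, h3, h4, h5⟩ := h.symm.chain (fun u hu v hv hu' hv' => hK u hu' v hv' hu hv) hf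
    (hT f c' (hf.mono (Finset.subset_univ _)) (hc'.mono (Finset.subset_univ _)))
  have h6 := h.symm.perm hc' _ π rfl (by
    intro t ht ht'
    have e1 := h4 t ht
    have e2 := h5 t ht'
    rw [h2 t ht'] at e2
    exact e2.symm.trans e1)
  refine (h1.trans h3).trans ((KE.of_eqOn (h3.proper hf) ?_).trans h6.symm)
  intro v _
  split_ifs with hv
  · exact (h4 v hv).symm
  · have hvS := (h.cov v).resolve_right hv
    rw [h5 v hvS, h2 v hvS]

end glue

end part16

section part17

/-! ## Separators of size at most two -/

section cuts
variable [Fintype V] {G : SimpleGraph V} {k : ℕ}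

lemma not_conn {S : Finset V} (hne : S.Nonempty) (h : ¬ Conn G S) :
    ∃ T ⊆ S, T.Nonempty ∧ (∀ u ∈ T, ∀ v ∈ S, G.Adj u v → v ∈ T) ∧ T ≠ S := by
  by_contra hcon
  push Not at hcon
  exact h ⟨hne, fun T hT hTne hcl => hcon T hT hTne hcl⟩

/-- One side of a cut vertex. -/
lemma cut_side (hconn : Conn G Finset.univ) (hdeg : ∀ v, (nb G Finset.univ v).card ≤ k)
    {x : V} {A B : Finset V} (hxA : x ∉ A) (hAB : ∀ v ∈ A, v ∉ B)
    (hcl : ∀ u ∈ A, ∀ v, v ≠ x → G.Adj u v → v ∈ A)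
    (hB : ∃ b ∈ B, G.Adj x b) (hxB : x ∉ B) :
    ∀ c c' : V → Fin k, ProperOn G (insert x A) c → ProperOn G (insert x A) c' →
      KE G (insert x A) c c' := by
  apply KE_of_degenerate
  apply deg_slack (f := fun _ => k)
  · refine ⟨by simp, fun T hT hne hTcl => ?_⟩
    by_contra hTne
    by_cases hxT : x ∈ T
    · have hne' : ((insert x A) \ T).Nonempty := by
        rw [Finset.sdiff_nonempty]
        exact fun h => hTne (Finset.Subset.antisymm hT h)
      have := hconn.2 ((insert x A) \ T) (Finset.subset_univ _) hne' (by
        intro u hu v _ huv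
        rw [Finset.mem_sdiff, Finset.mem_insert] at hu
        have hux : u ≠ x := fun e => hu.2 (e ▸ hxT)
        have huA := hu.1.resolve_left hux
        have hvT : v ∉ T := fun hv => hu.2 (hTcl v hv u (Finset.mem_insert_of_mem huA) huv.symm)
        have hvx : v ≠ x := fun e => hvT (e ▸ hxT)
        rw [Finset.mem_sdiff]
        exact ⟨Finset.mem_insert_of_mem (hcl u huA v hvx huv), hvT⟩)
      have hx : x ∈ (insert x A) \ T := by rw [this]; simp
      exact (Finset.mem_sdiff.1 hx).2 hxT
    · have hTA : T ⊆ A := fun v hv => (Finset.mem_insert.1 (hT hv)).resolve_left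
        (fun e => hxT (e ▸ hv))
      have := hconn.2 T (Finset.subset_univ _) hne (by
        intro u hu v _ huv
        by_cases hvx : v = x
        · exact hTcl u hu v (by simp [hvx]) huv
        · exact hTcl u hu v (Finset.mem_insert_of_mem (hcl u (hTA hu) v hvx huv)) huv)
      exact hxT (by rw [this]; simp)
  · intro v _
    exact (Finset.card_le_card (nb_mono (Finset.subset_univ _) v)).trans (hdeg v)
  · refine ⟨x, by simp, ?_⟩
    obtain ⟨b, hb, hxb⟩ := hB
    refine lt_of_lt_of_le (Finset.card_lt_card ?_) (hdeg x)
    refine ⟨nb_mono (Finset.subset_univ _) x, fun hsub => ?_⟩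
    have := hsub (mem_nb.2 ⟨Finset.mem_univ b, hxb⟩)
    rw [mem_nb, Finset.mem_insert] at this
    rcases this.1 with e | e
    · exact hxb.ne' e
    · exact hAB b e hb

lemma cut_vertex (hconn : Conn G Finset.univ) (hdeg : ∀ v, (nb G Finset.univ v).card ≤ k)
    {x : V} (hne : (Finset.univ.erase x).Nonempty) (hx : ¬ Conn G (Finset.univ.erase x)) :
    ∀ c c' : V → Fin k, ProperOn G Finset.univ c → ProperOn G Finset.univ c' →
      KE G Finset.univ c c' := by
  obtain ⟨A, hA, hAne, hAcl, hAneq⟩ := not_conn hne hx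
  have hxA : x ∉ A := fun h => by simpa using hA h
  let B : Finset V := (Finset.univ.erase x) \ A
  have hB : ∀ v, v ∈ B ↔ v ≠ x ∧ v ∉ A := by intro v; simp [B]
  have hBne : B.Nonempty := by
    rw [Finset.sdiff_nonempty]
    exact fun h => hAneq (Finset.Subset.antisymm hA h)
  have clA : ∀ u ∈ A, ∀ v, v ≠ x → G.Adj u v → v ∈ A := fun u hu v hv huv =>
    hAcl u hu v (by simp [hv]) huv
  have clB : ∀ u ∈ B, ∀ v, v ≠ x → G.Adj u v → v ∈ B := by
    intro u hu v hv huv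
    rw [hB] at hu ⊢
    exact ⟨hv, fun hvA => hu.2 (clA v hvA u hu.1 huv.symm)⟩
  have key : ∀ C : Finset V, C.Nonempty → x ∉ C → (∀ u ∈ C, ∀ v, v ≠ x → G.Adj u v → v ∈ C) →
      ∃ b ∈ C, G.Adj x b := by
    intro C hC hxC hcl
    by_contra hcon
    push Not at hcon
    have := hconn.2 C (Finset.subset_univ _) hC (fun u hu v _ huv => hcl u hu v (by
      rintro rfl
      exact hcon u hu huv.symm) huv)
    exact hxC (by rw [this]; simp)
  have hxB : x ∉ B := by rw [hB]; simp
  have hdis : ∀ v ∈ A, v ∉ B := fun v hv hvB => ((hB v).1 hvB).2 hv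
  have h1 := cut_side (k := k) hconn hdeg hxA hdis clA (key B hBne hxB clB) hxB
  have h2 := cut_side (k := k) hconn hdeg hxB (fun v hv hvA => hdis v hvA hv) clB (key A hAne hxA clA) hxA
  have hs : Split G (insert x A) (insert x B) := by
    constructor
    · intro v
      by_cases h : v = x
      · simp [h]
      by_cases h' : v ∈ A
      · simp [h']
      · right; exact Finset.mem_insert_of_mem ((hB v).2 ⟨h, h'⟩)
    · intro u hu v hv hu' hv' huv
      rw [Finset.mem_insert, not_or] at hu' hv'
      rw [Finset.mem_insert] at hu hv
      exact hv'.2 (clA u (hu.resolve_left hu'.1) v hv'.1 huv)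
  refine hs.amalgam ?_ h1 h2
  intro u hu v hv hu' hv' huv
  have e : ∀ u, u ∈ insert x A → u ∈ insert x B → u = x := by
    intro u h1 h2
    rw [Finset.mem_insert] at h1 h2
    by_contra hux
    exact hdis u (h1.resolve_left hux) (h2.resolve_left hux)
  exact absurd ((e u hu hu').trans (e v hv hv').symm) huv

/-- `{x, y}` separates `A` from `B`. -/
structure Cut (G : SimpleGraph V) (x y : V) (A B : Finset V) : Prop where
  xy : x ≠ y
  xA : x ∉ A
  yA : y ∉ A
  xB : x ∉ B
  yB : y ∉ B
  cov : ∀ v, v = x ∨ v = y ∨ v ∈ A ∨ v ∈ B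
  disj : ∀ v ∈ A, v ∉ B
  no : ∀ u ∈ A, ∀ v ∈ B, ¬ G.Adj u v
  nxA : ∃ a ∈ A, G.Adj x a
  nyA : ∃ a ∈ A, G.Adj y a
  nxB : ∃ a ∈ B, G.Adj x a
  nyB : ∃ a ∈ B, G.Adj y a

lemma Cut.side {x y : V} {A B : Finset V} (h : Cut G x y A B) : Cut G x y B A :=
  ⟨h.xy, h.xB, h.yB, h.xA, h.yA, fun v => by have := h.cov v; tauto, fun v hv hv' => h.disj v hv' hv,
    fun u hu v hv e => h.no v hv u hu e.symm, h.nxB, h.nyB, h.nxA, h.nyA⟩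

lemma Cut.flip {x y : V} {A B : Finset V} (h : Cut G x y A B) : Cut G y x A B :=
  ⟨h.xy.symm, h.yA, h.xA, h.yB, h.xB, fun v => by have := h.cov v; tauto, h.disj,
    h.no, h.nyA, h.nxA, h.nyB, h.nxB⟩

lemma cut_exists (hne : 2 < Fintype.card V) (h2 : ∀ v, Conn G (Finset.univ.erase v)) {x y : V} (hxy : x ≠ y)
    (h : ¬ Conn G (Finset.univ \ {x, y})) : ∃ A B, Cut G x y A B := by
  have hne : ((Finset.univ : Finset V) \ {x, y}).Nonempty := by
    rw [← Finset.card_pos]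
    have := Finset.le_card_sdiff ({x, y} : Finset V) Finset.univ
    rw [Finset.card_pair hxy, Finset.card_univ] at this
    omega
  obtain ⟨A, hA, hAne, hAcl, hAneq⟩ := not_conn hne h
  let B : Finset V := (Finset.univ \ {x, y}) \ A
  have hB : ∀ v, v ∈ B ↔ (v ≠ x ∧ v ≠ y) ∧ v ∉ A := by intro v; simp [B]
  have hBne : B.Nonempty := by
    rw [Finset.sdiff_nonempty]
    exact fun h => hAneq (Finset.Subset.antisymm hA h)
  have hA' : ∀ v ∈ A, v ≠ x ∧ v ≠ y := fun v hv => by simpa using hA hv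
  have clA : ∀ u ∈ A, ∀ v, v ≠ x → v ≠ y → G.Adj u v → v ∈ A := fun u hu v hv hv' huv =>
    hAcl u hu v (by simp [hv, hv']) huv
  have clB : ∀ u ∈ B, ∀ v, v ≠ x → v ≠ y → G.Adj u v → v ∈ B := by
    intro u hu v hv hv' huv
    rw [hB] at hu ⊢
    exact ⟨⟨hv, hv'⟩, fun hvA => hu.2 (clA v hvA u hu.1.1 hu.1.2 huv.symm)⟩
  have key : ∀ (p q : V) (C : Finset V), p ≠ q → C.Nonempty → p ∉ C → q ∉ C →
      (∀ u ∈ C, ∀ v, v ≠ p → v ≠ q → G.Adj u v → v ∈ C) → ∃ a ∈ C, G.Adj p a := by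
    intro p q C hpq hC hp hq hcl
    by_contra hcon
    push Not at hcon
    have := (h2 q).2 C (fun v hv => Finset.mem_erase.2 ⟨fun e => hq (e ▸ hv), by simp⟩) hC (by
      intro u hu v hv huv
      refine hcl u hu v ?_ (Finset.mem_erase.1 hv).1 huv
      rintro rfl
      exact hcon u hu huv.symm)
    exact hp (by rw [this]; simp [hpq])
  have xA : x ∉ A := fun h => (hA' x h).1 rfl
  have yA : y ∉ A := fun h => (hA' y h).2 rfl
  have xB : x ∉ B := by rw [hB]; simp
  have yB : y ∉ B := by rw [hB]; simp
  refine ⟨A, B, hxy, xA, yA, xB, yB, ?_, ?_, ?_, key x y A hxy hAne xA yA clA,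
    key y x A hxy.symm hAne yA xA (fun u hu v h1 h2 => clA u hu v h2 h1), key x y B hxy hBne xB yB clB,
    key y x B hxy.symm hBne yB xB (fun u hu v h1 h2 => clB u hu v h2 h1)⟩
  · intro v
    by_cases h1 : v = x
    · exact Or.inl h1
    by_cases h2 : v = y
    · exact Or.inr (Or.inl h2)
    by_cases h3 : v ∈ A
    · exact Or.inr (Or.inr (Or.inl h3))
    · exact Or.inr (Or.inr (Or.inr ((hB v).2 ⟨⟨h1, h2⟩, h3⟩)))
  · exact fun v hv hvB => ((hB v).1 hvB).2 hv
  · intro u hu v hv huv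
    have hv' := (hB v).1 hv
    exact hv'.2 (clA u hu v hv'.1.1 hv'.1.2 huv)

/-- The graph with the edge `xy` added. -/
def addE (G : SimpleGraph V) (x y : V) (hxy : x ≠ y) : SimpleGraph V where
  Adj u v := G.Adj u v ∨ (u = x ∧ v = y) ∨ (u = y ∧ v = x)
  symm := ⟨by
    rintro u v (h | ⟨h1, h2⟩ | ⟨h1, h2⟩)
    · exact Or.inl h.symm
    · exact Or.inr (Or.inr ⟨h2, h1⟩)
    · exact Or.inr (Or.inl ⟨h2, h1⟩)⟩
  loopless := ⟨by
    rintro u (h | ⟨h1, h2⟩ | ⟨h1, h2⟩)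
    · exact G.loopless.irrefl _ h
    · exact hxy (h1.symm.trans h2)
    · exact hxy (h2.symm.trans h1)⟩

lemma Cut.deg {x y : V} {A B : Finset V} (h : Cut G x y A B)
    (hdeg : ∀ v, (nb G Finset.univ v).card ≤ k) : (nb G A x).card + (nb G B x).card ≤ k := by
  rw [← Finset.card_union_of_disjoint]
  · exact (Finset.card_le_card (Finset.union_subset (nb_mono (Finset.subset_univ _) x)
      (nb_mono (Finset.subset_univ _) x))).trans (hdeg x)
  · rw [Finset.disjoint_left]
    exact fun v h1 h2 => h.disj v (mem_nb.1 h1).1 (mem_nb.1 h2).1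

lemma Cut.posB {x y : V} {A B : Finset V} (h : Cut G x y A B) : 1 ≤ (nb G B x).card := by
  obtain ⟨b, hb, hxb⟩ := h.nxB
  exact Finset.card_pos.2 ⟨b, mem_nb.2 ⟨hb, hxb⟩⟩

lemma Cut.nbx {x y : V} {A B : Finset V} (h : Cut G x y A B) :
    (nb (addE G x y h.xy) (insert x (insert y A)) x).card ≤ (nb G A x).card + 1 := by
  refine le_trans (Finset.card_le_card (t := insert y (nb G A x)) ?_) (Finset.card_insert_le _ _)
  intro v hv
  rw [mem_nb] at hv
  simp only [Finset.mem_insert, mem_nb] at hv ⊢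
  have hvx := hv.2.ne'
  by_cases hvy : v = y
  · exact Or.inl hvy
  · right
    refine ⟨(hv.1.resolve_left hvx).resolve_left hvy, ?_⟩
    rcases hv.2 with e | ⟨-, e⟩ | ⟨-, e⟩
    · exact e
    · exact absurd e hvy
    · exact absurd e hvx

lemma addE_comm (x y : V) (hxy : x ≠ y) : addE G x y hxy = addE G y x hxy.symm := by
  ext u v
  simp only [addE]
  tauto

lemma Cut.one {x y : V} {A B : Finset V} (h : Cut G x y A B) (hconn : Conn G Finset.univ)
    (hdeg : ∀ v, (nb G Finset.univ v).card ≤ k)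
    (hs : (nb G A x).card + 1 < k ∨ (nb G A y).card + 1 < k) :
    ∀ c c' : V → Fin k, ProperOn (addE G x y h.xy) (insert x (insert y A)) c →
      ProperOn (addE G x y h.xy) (insert x (insert y A)) c' →
      KE (addE G x y h.xy) (insert x (insert y A)) c c' := by
  have nby : (nb (addE G x y h.xy) (insert x (insert y A)) y).card ≤ (nb G A y).card + 1 := by
    have := h.flip.nbx
    rwa [Finset.insert_comm, ← addE_comm] at this
  have nbx := h.nbx
  have dx := h.deg hdeg
  have dy := h.flip.deg hdeg
  have px := h.posB
  have py := h.flip.posB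
  have cl : ∀ u ∈ A, ∀ v, G.Adj u v → v ∈ insert x (insert y A) := by
    intro u hu v huv
    simp only [Finset.mem_insert]
    rcases h.cov v with e | e | e | e
    · exact Or.inl e
    · exact Or.inr (Or.inl e)
    · exact Or.inr (Or.inr e)
    · exact absurd huv (h.no u hu v e)
  have adjxy : (addE G x y h.xy).Adj x y := Or.inr (Or.inl ⟨rfl, rfl⟩)
  apply KE_of_degenerate
  apply deg_slack (f := fun _ => k)
  · refine ⟨by simp, fun T hT hne hTcl => ?_⟩
    by_contra hTne
    by_cases hxT : x ∈ T ∨ y ∈ T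
    · have hboth : x ∈ T ∧ y ∈ T := by
        rcases hxT with e | e
        · exact ⟨e, hTcl x e y (by simp) adjxy⟩
        · exact ⟨hTcl y e x (by simp) adjxy.symm, e⟩
      have hne' : ((insert x (insert y A)) \ T).Nonempty := by
        rw [Finset.sdiff_nonempty]
        exact fun h => hTne (Finset.Subset.antisymm hT h)
      have := hconn.2 ((insert x (insert y A)) \ T) (Finset.subset_univ _) hne' (by
        intro u hu v _ huv
        rw [Finset.mem_sdiff] at hu
        have hux : u ≠ x := fun e => hu.2 (e ▸ hboth.1)
        have huy : u ≠ y := fun e => hu.2 (e ▸ hboth.2)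
        have huA : u ∈ A := by
          have := hu.1
          simp only [Finset.mem_insert] at this
          exact (this.resolve_left hux).resolve_left huy
        rw [Finset.mem_sdiff]
        exact ⟨cl u huA v huv, fun hv => hu.2 (hTcl v hv u hu.1 (Or.inl huv.symm))⟩)
      have hx : x ∈ (insert x (insert y A)) \ T := by rw [this]; simp
      exact (Finset.mem_sdiff.1 hx).2 hboth.1
    · rw [not_or] at hxT
      have hTA : T ⊆ A := by
        intro v hv
        have := hT hv
        simp only [Finset.mem_insert] at this
        exact (this.resolve_left (fun e => hxT.1 (e ▸ hv))).resolve_left (fun e => hxT.2 (e ▸ hv))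
      have := hconn.2 T (Finset.subset_univ _) hne (by
        intro u hu v _ huv
        exact hTcl u hu v (cl u (hTA hu) v huv) (Or.inl huv))
      exact hxT.1 (by rw [this]; simp)
  · intro v hv
    simp only [Finset.mem_insert] at hv
    by_cases hvx : v = x
    · subst hvx; omega
    by_cases hvy : v = y
    · subst hvy; omega
    refine (Finset.card_le_card ?_).trans (hdeg v)
    intro w hw
    rw [mem_nb] at hw ⊢
    refine ⟨by simp, ?_⟩
    rcases hw.2 with e | ⟨e, -⟩ | ⟨e, -⟩
    · exact e
    · exact absurd e hvx
    · exact absurd e hvy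
  · rcases hs with e | e
    · exact ⟨x, by simp, by omega⟩
    · exact ⟨y, by simp, by omega⟩

lemma Cut.split {x y : V} {A B : Finset V} (h : Cut G x y A B) :
    Split (addE G x y h.xy) (insert x (insert y A)) (insert x (insert y B)) := by
  constructor
  · intro v
    have := h.cov v
    simp only [Finset.mem_insert]
    tauto
  · intro u hu v hv hu' hv' huv
    simp only [Finset.mem_insert, not_or] at hu hv hu' hv'
    have h1 := (hu.resolve_left hu'.1).resolve_left hu'.2.1
    have h2 := (hv.resolve_left hv'.1).resolve_left hv'.2.1
    rcases huv with e | ⟨e, -⟩ | ⟨e, -⟩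
    · exact h.no u h1 v h2 e
    · exact hu'.1 e
    · exact hu'.2.1 e

lemma Cut.split' {x y : V} {A B : Finset V} (h : Cut G x y A B) :
    Split G (insert x (insert y A)) (insert x (insert y B)) :=
  ⟨h.split.cov, fun u hu v hv h1 h2 e => h.split.no u hu v hv h1 h2 (Or.inl e)⟩

lemma Cut.inter {x y : V} {A B : Finset V} (h : Cut G x y A B) {u : V}
    (h1 : u ∈ insert x (insert y A)) (h2 : u ∈ insert x (insert y B)) : u = x ∨ u = y := by
  simp only [Finset.mem_insert] at h1 h2
  have := h.disj u
  tauto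

lemma addE_proper {x y : V} (hxy : x ≠ y) {c : V → Fin k} (hc : ProperOn G Finset.univ c)
    (h : c x ≠ c y) : ProperOn (addE G x y hxy) Finset.univ c := by
  rintro u - v - (e | ⟨rfl, rfl⟩ | ⟨rfl, rfl⟩)
  · exact hc u (by simp) v (by simp) e
  · exact h
  · exact h.symm

/-- Colourings with different colours on the separator are equivalent. -/
lemma Cut.diff {x y : V} {A B : Finset V} (h : Cut G x y A B) (hconn : Conn G Finset.univ)
    (hdeg : ∀ v, (nb G Finset.univ v).card ≤ k)
    (hsA : (nb G A x).card + 1 < k ∨ (nb G A y).card + 1 < k)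
    (hsB : (nb G B x).card + 1 < k ∨ (nb G B y).card + 1 < k)
    {c c' : V → Fin k} (hc : ProperOn G Finset.univ c) (hc' : ProperOn G Finset.univ c')
    (hxy : c x ≠ c y) (hxy' : c' x ≠ c' y) : KE G Finset.univ c c' := by
  have := h.split.amalgam (k := k) (by
    intro u hu v hv hu' hv' huv
    rcases h.inter hu hu' with rfl | rfl <;> rcases h.inter hv hv' with rfl | rfl
    · exact absurd rfl huv
    · exact Or.inr (Or.inl ⟨rfl, rfl⟩)
    · exact Or.inr (Or.inr ⟨rfl, rfl⟩)
    · exact absurd rfl huv) (h.one hconn hdeg hsA) (h.side.one hconn hdeg hsB) c c'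
    (addE_proper h.xy hc hxy) (addE_proper h.xy hc' hxy')
  exact this.pull (G := G) (S := Finset.univ) id (fun v _ => Finset.mem_univ v)
    (fun p _ q _ e => Or.inl e)

lemma free_colour {N : Finset V} (h : N.card + 1 < k) (c : V → Fin k) (i : Fin k) :
    ∃ m, m ≠ i ∧ ∀ v ∈ N, c v ≠ m := by
  have : ∃ m, m ∉ insert i (N.image c) := by
    by_contra hcon
    push Not at hcon
    have h1 : (Finset.univ : Finset (Fin k)) ⊆ insert i (N.image c) := fun m _ => hcon m
    have h2 := Finset.card_le_card h1
    have h3 := Finset.card_insert_le i (N.image c)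
    have h4 := Finset.card_image_le (s := N) (f := c)
    rw [Finset.card_univ, Fintype.card_fin] at h2
    omega
  obtain ⟨m, hm⟩ := this
  simp only [Finset.mem_insert, Finset.mem_image, not_or, not_exists, not_and] at hm
  exact ⟨m, hm.1, fun v hv => hm.2 v hv⟩

lemma Cut.sep1 {x y : V} {A B : Finset V} (h : Cut G x y A B)
    (hA : (nb G A x).card + 1 < k) (hB : (nb G B x).card + 1 < k)
    {c : V → Fin k} (hc : ProperOn G Finset.univ c) (he : c x = c y) (hna : ¬ G.Adj x y) :
    ∃ f : V → Fin k, KE G Finset.univ c f ∧ f x ≠ f y := by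
  obtain ⟨m1, h1, h1'⟩ := free_colour hA c (c x)
  obtain ⟨m2, h2, h2'⟩ := free_colour hB c (c x)
  have hfix : ∀ t ∈ insert x (insert y A), t ∈ insert x (insert y B) →
      Equiv.swap m1 m2 (c t) = c t := by
    intro t ht ht'
    have : c t = c x := by
      rcases h.inter ht ht' with e | e
      · rw [e]
      · rw [e, he]
    rw [this]
    exact Equiv.swap_apply_of_ne_of_ne h1.symm h2.symm
  have hp := h.split'.perm hc _ (Equiv.swap m1 m2) rfl hfix
  set g : V → Fin k := fun v => if v ∈ insert x (insert y A) then c v else Equiv.swap m1 m2 (c v)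
    with hg
  have hgp := hp.proper hc
  have hgx : g x = c x := by simp [hg]
  have hgy : g y = c x := by simp [hg, he]
  have hfree : ∀ v, G.Adj x v → g v ≠ m1 := by
    intro v hxv
    rcases h.cov v with e | e | e | e
    · exact absurd e hxv.ne'
    · exact absurd (e ▸ hxv) hna
    · have : g v = c v := by simp [hg, e]
      rw [this]
      exact h1' v (mem_nb.2 ⟨e, hxv⟩)
    · have : g v = Equiv.swap m1 m2 (c v) := by
        have h3 : v ∉ A := fun hv => h.disj v hv e
        have h4 : v ≠ x := hxv.ne'
        have h5 : v ≠ y := fun e' => h.yB (e' ▸ e)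
        simp [hg, h3, h4, h5]
      rw [this]
      intro e2
      have e3 : c v = m2 :=
        (Equiv.swap m1 m2).injective (e2.trans (Equiv.swap_apply_right m1 m2).symm)
      exact h2' v (mem_nb.2 ⟨e, hxv⟩) e3
  refine ⟨Function.update g x m1, hp.trans (KE.recolor x hgp ?_ ?_), ?_⟩
  · intro u _ v _ huv
    by_cases hux : u = x
    · subst hux
      rw [Function.update_self, Function.update_of_ne huv.ne']
      exact (hfree v huv).symm
    · by_cases hvx : v = x
      · subst hvx
        rw [Function.update_self, Function.update_of_ne hux]
        exact hfree u huv.symm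
      · rw [Function.update_of_ne hux, Function.update_of_ne hvx]
        exact hgp u (by simp) v (by simp) huv
  · intro v _ hv
    rw [Function.update_of_ne hv]
  · rw [Function.update_self, Function.update_of_ne h.xy.symm, hgy]
    exact h1

lemma Cut.sep2 {x y : V} {A B : Finset V} (h : Cut G x y A B) (hk : 3 ≤ k)
    (hA : (nb G A y).card = 1) (hB : (nb G B x).card = 1)
    {c : V → Fin k} (hc : ProperOn G Finset.univ c) (he : c x = c y) (hna : ¬ G.Adj x y) :
    ∃ f : V → Fin k, KE G Finset.univ c f ∧ f x ≠ f y := by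
  obtain ⟨p, hp⟩ := Finset.card_eq_one.1 hA
  obtain ⟨q, hq⟩ := Finset.card_eq_one.1 hB
  have hp' : p ∈ nb G A y := by rw [hp]; simp
  have hq' : q ∈ nb G B x := by rw [hq]; simp
  rw [mem_nb] at hp' hq'
  have uA : ∀ v ∈ A, G.Adj y v → v = p := fun v hv e => by
    have : v ∈ nb G A y := mem_nb.2 ⟨hv, e⟩
    rw [hp] at this; simpa using this
  have uB : ∀ v ∈ B, G.Adj x v → v = q := fun v hv e => by
    have : v ∈ nb G B x := mem_nb.2 ⟨hv, e⟩
    rw [hq] at this; simpa using this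
  have hpx : c p ≠ c x := by rw [he]; exact (hc y (by simp) p (by simp) hp'.2).symm
  have hqx : c q ≠ c x := (hc x (by simp) q (by simp) hq'.2).symm
  have hfix : ∀ t ∈ insert x (insert y A), t ∈ insert x (insert y B) →
      Equiv.swap (c p) (c q) (c t) = c t := by
    intro t ht ht'
    have : c t = c x := by
      rcases h.inter ht ht' with e | e
      · rw [e]
      · rw [e, he]
    rw [this]
    exact Equiv.swap_apply_of_ne_of_ne hpx.symm hqx.symm
  have hpm := h.split'.perm hc _ (Equiv.swap (c p) (c q)) rfl hfix
  set g : V → Fin k := fun v => if v ∈ insert x (insert y A) then c v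
    else Equiv.swap (c p) (c q) (c v) with hg
  have hgp := hpm.proper hc
  have hgx : g x = c x := by simp [hg]
  have hgy : g y = c x := by simp [hg, he]
  have hgpp : g p = c p := by simp [hg, hp'.1]
  have hgq : g q = c p := by
    have h3 : q ∉ A := fun hv => h.disj q hv hq'.1
    have h4 : q ≠ x := hq'.2.ne'
    have h5 : q ≠ y := fun e' => h.yB (e' ▸ hq'.1)
    simp [hg, h3, h4, h5]
  obtain ⟨m, hmp, hm⟩ := free_colour (N := {x}) (k := k) (by simp; omega) c (c p)
  have hmx : c x ≠ m := hm x (by simp)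
  let f : V → Fin k := fun v => if v ∈ insert x A then Equiv.swap (c x) m (g v) else g v
  have hmix : ∀ u ∈ insert x A, ∀ v, v ∉ insert x A → G.Adj u v → f u ≠ f v := by
    intro u hu v hv huv
    have hv1 : v ≠ x ∧ v ∉ A := by simpa using hv
    have hfu : f u = Equiv.swap (c x) m (g u) := by simp only [f, if_pos hu]
    have hfv : f v = g v := by simp only [f, if_neg hv]
    rw [hfu, hfv]
    rcases h.cov v with e | e | e | e
    · exact absurd e hv1.1
    · rw [Finset.mem_insert] at hu
      rcases hu with e' | e'
      · subst e; subst e'; exact absurd huv hna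
      · subst e
        have := uA u e' huv.symm
        subst this
        rw [hgpp, hgy, Equiv.swap_apply_of_ne_of_ne hpx hmp.symm]
        exact hpx
    · exact absurd e hv1.2
    · rw [Finset.mem_insert] at hu
      rcases hu with e' | e'
      · subst e'
        have := uB v e huv
        subst this
        rw [hgx, hgq, Equiv.swap_apply_left]
        exact hmp
      · exact absurd huv (h.no u e' v e)
  refine ⟨f, hpm.trans (KS.ke ⟨hgp, ?_, c x, m, ?_⟩), ?_⟩
  · intro u _ v _ huv
    by_cases hu : u ∈ insert x A <;> by_cases hv : v ∈ insert x A
    · simp only [f, if_pos hu, if_pos hv]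
      exact fun e => hgp u (by simp) v (by simp) huv ((Equiv.swap (c x) m).injective e)
    · exact hmix u hu v hv huv
    · exact (hmix v hv u hu huv.symm).symm
    · simp only [f, if_neg hu, if_neg hv]
      exact hgp u (by simp) v (by simp) huv
  · intro v _
    by_cases hv : v ∈ insert x A
    · simp only [f, if_pos hv]
      by_cases ea : g v = c x
      · right; rw [ea]; simp
      by_cases eb : g v = m
      · right; rw [eb]; simp
      · left; rw [Equiv.swap_apply_of_ne_of_ne ea eb]
    · simp only [f, if_neg hv]
      exact Or.inl trivial
  · have h1 : f x = m := by simp [f, hgx]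
    have h2 : f y = c x := by
      have : y ∉ insert x A := by simp [h.xy.symm, h.yA]
      simp only [f, if_neg this, hgy]
    rw [h1, h2]
    exact hmx.symm

lemma Cut.sep {x y : V} {A B : Finset V} (h : Cut G x y A B) (hk : 3 ≤ k)
    (hdeg : ∀ v, (nb G Finset.univ v).card ≤ k)
    (hsA : (nb G A x).card + 1 < k ∨ (nb G A y).card + 1 < k)
    (hsB : (nb G B x).card + 1 < k ∨ (nb G B y).card + 1 < k)
    {c : V → Fin k} (hc : ProperOn G Finset.univ c) :
    ∃ f : V → Fin k, KE G Finset.univ c f ∧ f x ≠ f y := by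
  by_cases he : c x = c y
  swap
  · exact ⟨c, KE.refl _, he⟩
  have hna : ¬ G.Adj x y := fun e => hc x (by simp) y (by simp) e he
  have dx := h.deg hdeg
  have dy := h.flip.deg hdeg
  have px := h.posB
  have py := h.flip.posB
  have px' := h.side.posB
  have py' := h.side.flip.posB
  have flip : (∃ f : V → Fin k, KE G Finset.univ c f ∧ f y ≠ f x) →
      ∃ f : V → Fin k, KE G Finset.univ c f ∧ f x ≠ f y := fun ⟨f, h1, h2⟩ => ⟨f, h1, h2.symm⟩
  have hna' : ¬ G.Adj y x := fun e => hna e.symm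
  by_cases h1 : (nb G A x).card + 1 < k
  · by_cases h2 : (nb G B x).card + 1 < k
    · exact h.sep1 h1 h2 hc he hna
    · have h3 := hsB.resolve_left h2
      by_cases h4 : (nb G A y).card + 1 < k
      · exact flip (h.flip.sep1 h4 h3 hc he.symm hna')
      · exact flip (h.flip.sep2 hk (by omega) (by omega) hc he.symm hna')
  · have h3 := hsA.resolve_left h1
    by_cases h2 : (nb G B y).card + 1 < k
    · exact flip (h.flip.sep1 h3 h2 hc he.symm hna')
    · exact h.sep2 hk (by omega) (by omega) hc he hna

lemma Cut.good {x y : V} {A B : Finset V} (h : Cut G x y A B) (hk : 3 ≤ k)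
    (hconn : Conn G Finset.univ) (hdeg : ∀ v, (nb G Finset.univ v).card ≤ k)
    (hsA : (nb G A x).card + 1 < k ∨ (nb G A y).card + 1 < k)
    (hsB : (nb G B x).card + 1 < k ∨ (nb G B y).card + 1 < k) :
    ∀ c c' : V → Fin k, ProperOn G Finset.univ c → ProperOn G Finset.univ c' →
      KE G Finset.univ c c' := by
  intro c c' hc hc'
  obtain ⟨f, hf, hfxy⟩ := h.sep hk hdeg hsA hsB hc
  obtain ⟨f', hf', hfxy'⟩ := h.sep hk hdeg hsA hsB hc'
  exact (hf.trans (h.diff hconn hdeg hsA hsB (hf.proper hc) (hf'.proper hc') hfxy hfxy')).trans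
    hf'.symm

lemma Cut.move {x y : V} {A B : Finset V} (h : Cut G x y A B) (hk : 3 ≤ k)
    (hreg : ∀ v, (nb G Finset.univ v).card = k) (h2 : ∀ v, Conn G (Finset.univ.erase v))
    (hA : ¬ ((nb G A x).card + 1 < k ∨ (nb G A y).card + 1 < k)) :
    ∃ z A' B', Cut G z y A' B' ∧ (nb G A' z).card = 1 ∧ (nb G B' y).card ≤ 1 := by
  have hdeg : ∀ v, (nb G Finset.univ v).card ≤ k := fun v => (hreg v).le
  have dx := h.deg hdeg
  have dy := h.flip.deg hdeg
  have px := h.posB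
  have py := h.flip.posB
  rw [not_or] at hA
  have hBx : (nb G B x).card = 1 := by omega
  have hBy : (nb G B y).card = 1 := by omega
  obtain ⟨p, hp⟩ := Finset.card_eq_one.1 hBx
  obtain ⟨q, hq⟩ := Finset.card_eq_one.1 hBy
  have hp' : p ∈ nb G B x := by rw [hp]; simp
  have hq' : q ∈ nb G B y := by rw [hq]; simp
  rw [mem_nb] at hp' hq'
  have uX : ∀ v ∈ B, G.Adj x v → v = p := fun v hv e => by
    have : v ∈ nb G B x := mem_nb.2 ⟨hv, e⟩
    rw [hp] at this; simpa using this
  have uY : ∀ v ∈ B, G.Adj y v → v = q := fun v hv e => by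
    have : v ∈ nb G B y := mem_nb.2 ⟨hv, e⟩
    rw [hq] at this; simpa using this
  have hbig : ∀ (s t : V), ¬ (∀ v, G.Adj p v → v = s ∨ v = t) := by
    intro s t hall
    have : nb G Finset.univ p ⊆ {s, t} := by
      intro v hv
      simpa using hall v (mem_nb.1 hv).2
    have := (Finset.card_le_card this).trans Finset.card_le_two
    rw [hreg] at this
    omega
  have hpq : p ≠ q := by
    rintro rfl
    have hne : (B.erase p).Nonempty := by
      by_contra hcon
      rw [Finset.not_nonempty_iff_eq_empty] at hcon
      apply hbig x y
      intro v hv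
      rcases h.cov v with e | e | e | e
      · exact Or.inl e
      · exact Or.inr e
      · exact absurd hv.symm (h.no v e p hp'.1)
      · have : v ∈ B.erase p := Finset.mem_erase.2 ⟨hv.ne', e⟩
        rw [hcon] at this; simp at this
    have := (h2 p).2 (B.erase p) (Finset.erase_subset_erase _ (Finset.subset_univ _)) hne (by
      intro u hu v hv huv
      rw [Finset.mem_erase] at hu hv ⊢
      refine ⟨hv.1, ?_⟩
      rcases h.cov v with e | e | e | e
      · subst e; exact absurd (uX u hu.2 huv.symm) hu.1
      · subst e; exact absurd (uY u hu.2 huv.symm) hu.1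
      · exact absurd huv.symm (h.no v e u hu.2)
      · exact e)
    have hx : x ∈ B.erase p := by
      rw [this]; simp [hp'.2.ne]
    exact h.xB (Finset.mem_of_mem_erase hx)
  have hpy : p ≠ y := fun e => h.yB (e ▸ hp'.1)
  have hpA : p ∉ A := fun e => h.disj p e hp'.1
  have npy : ¬ G.Adj y p := fun e => hpq (uY p hp'.1 e)
  refine ⟨p, insert x A, B.erase p, ⟨hpy, ?_, ?_, by simp, ?_, ?_, ?_, ?_, ⟨x, by simp, hp'.2.symm⟩, ?_, ?_,
    ⟨q, Finset.mem_erase.2 ⟨hpq.symm, hq'.1⟩, hq'.2⟩⟩, ?_, ?_⟩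
  · simp [hp'.2.ne', hpA]
  · simp [h.xy.symm, h.yA]
  · simp [h.yB]
  · intro v
    simp only [Finset.mem_insert, Finset.mem_erase]
    have := h.cov v
    tauto
  · intro v hv hv'
    rw [Finset.mem_insert] at hv
    have hv' := Finset.mem_of_mem_erase hv'
    rcases hv with rfl | hv
    · exact h.xB hv'
    · exact h.disj v hv hv'
  · intro u hu v hv huv
    rw [Finset.mem_insert] at hu
    rw [Finset.mem_erase] at hv
    rcases hu with rfl | hu
    · exact hv.1 (uX v hv.2 huv)
    · exact h.no u hu v hv.2 huv
  · obtain ⟨a, ha, hya⟩ := h.nyA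
    exact ⟨a, Finset.mem_insert_of_mem ha, hya⟩
  · by_contra hcon
    push Not at hcon
    apply hbig x x
    intro v hv
    rcases h.cov v with e | e | e | e
    · exact Or.inl e
    · exact absurd (e ▸ hv).symm npy
    · exact absurd hv.symm (h.no v e p hp'.1)
    · exact absurd hv (hcon v (Finset.mem_erase.2 ⟨hv.ne', e⟩))
  · rw [Finset.card_eq_one]
    refine ⟨x, ?_⟩
    ext v
    rw [mem_nb, Finset.mem_insert, Finset.mem_singleton]
    constructor
    · rintro ⟨e | e, hv⟩
      · exact e
      · exact absurd hv.symm (h.no v e p hp'.1)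
    · rintro rfl
      exact ⟨Or.inl rfl, hp'.2.symm⟩
  · exact (Finset.card_le_card (nb_mono (Finset.erase_subset _ _) y)).trans hBy.le

lemma Cut.all {x y : V} {A B : Finset V} (h : Cut G x y A B) (hk : 3 ≤ k)
    (hreg : ∀ v, (nb G Finset.univ v).card = k) (hconn : Conn G Finset.univ)
    (h2 : ∀ v, Conn G (Finset.univ.erase v)) :
    ∀ c c' : V → Fin k, ProperOn G Finset.univ c → ProperOn G Finset.univ c' →
      KE G Finset.univ c c' := by
  have hdeg : ∀ v, (nb G Finset.univ v).card ≤ k := fun v => (hreg v).le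
  have mv : ∀ {A B : Finset V}, Cut G x y A B →
      ¬ ((nb G A x).card + 1 < k ∨ (nb G A y).card + 1 < k) →
      ∀ c c' : V → Fin k, ProperOn G Finset.univ c → ProperOn G Finset.univ c' →
      KE G Finset.univ c c' := by
    intro A B h hA
    obtain ⟨z, A', B', h', h1, h3⟩ := h.move hk hreg h2 hA
    exact h'.good hk hconn hdeg (Or.inl (by omega)) (Or.inr (by omega))
  by_cases hA : (nb G A x).card + 1 < k ∨ (nb G A y).card + 1 < k
  · by_cases hB : (nb G B x).card + 1 < k ∨ (nb G B y).card + 1 < k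
    · exact h.good hk hconn hdeg hA hB
    · exact mv h.side hB
  · exact mv h hA

end cuts

end part17

section part18

/-! ## Assembly -/

lemma regular_case [Fintype V] {G : SimpleGraph V} {k : ℕ} (hk : 3 ≤ k)
    (hreg : ∀ v, (nb G Finset.univ v).card = k) (hconn : Conn G Finset.univ)
    (hexc : ¬ (k = 3 ∧ Nonempty (G ≃g TriangularPrism))) :
    ∀ c c' : V → Fin k, ProperOn G Finset.univ c → ProperOn G Finset.univ c' →
      KE G Finset.univ c c' := by
  obtain ⟨x, -⟩ := hconn.1
  have hcard : 3 < Fintype.card V := by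
    have h1 : (nb G Finset.univ x).card < (Finset.univ : Finset V).card := by
      apply Finset.card_lt_card
      refine ⟨Finset.subset_univ _, fun h => ?_⟩
      exact G.loopless.irrefl _ (mem_nb.1 (h (Finset.mem_univ x))).2
    rw [hreg, Finset.card_univ] at h1
    omega
  by_cases h2 : ∀ v, Conn G (Finset.univ.erase v)
  swap
  · push Not at h2
    obtain ⟨v, hv⟩ := h2
    refine cut_vertex hconn (fun v => (hreg v).le) ?_ hv
    rw [← Finset.card_pos, Finset.card_erase_of_mem (by simp), Finset.card_univ]
    omega
  by_cases h3 : ∀ a b, Conn G (Finset.univ \ {a, b})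
  swap
  · push Not at h3
    obtain ⟨a, b, hab⟩ := h3
    by_cases hne : a = b
    · subst hne
      exfalso
      apply hab
      have := h2 a
      rw [← Finset.sdiff_singleton_eq_erase] at this
      simpa using this
    · obtain ⟨A, B, hAB⟩ := cut_exists (by omega) h2 hne hab
      exact hAB.all hk hreg hconn h2
  intro c c' hc hc'
  by_contra hcon
  have hctx : Ctx G k (fun f => decide (KE G Finset.univ c f)) := by
    refine ⟨hk, hreg, h3, ?_, ?_⟩
    · intro f f' _ _ hff
      simp only [decide_eq_decide]
      exact ⟨fun h => h.trans hff, fun h => h.trans hff.symm⟩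
    · intro i
      cases i with
      | true => exact ⟨c, hc, by simp [KE.refl]⟩
      | false => exact ⟨c', hc', by simp [hcon]⟩
  by_cases hk5 : 5 ≤ k
  · exact no_five hctx hk5 x
  by_cases hk4 : k = 4
  · subst hk4
    exact no_four hctx x
  have hk3 : k = 3 := by omega
  subst hk3
  refine no_three hctx ?_ x
  intro a b e h1 h2 h3
  exact hexc ⟨rfl, tri_prism hctx h1 h2 h3⟩

lemma conn_univ [Fintype V] {G : SimpleGraph V} (h : G.Connected) : Conn G Finset.univ := by
  obtain ⟨x⟩ := h.nonempty
  refine ⟨⟨x, by simp⟩, fun T _ hne hcl => ?_⟩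
  obtain ⟨t, ht⟩ := hne
  apply Finset.eq_univ_of_forall
  intro v
  obtain ⟨p⟩ := h.preconnected t v
  induction p with
  | nil => exact ht
  | cons hadj _ ih => exact ih (hcl _ ht _ (by simp) hadj)

lemma main_KE [Fintype V] {G : SimpleGraph V} {d k : ℕ} (hk : 3 ≤ k) (hdk : k ≤ d)
    (hconn : Conn G Finset.univ) (hdeg : ∀ v, (nb G Finset.univ v).card ≤ k)
    (hexc : ¬ (d = 3 ∧ k = 3 ∧ Nonempty (G ≃g TriangularPrism))) :
    ∀ c c' : V → Fin d, ProperOn G Finset.univ c → ProperOn G Finset.univ c' →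
      KE G Finset.univ c c' := by
  by_cases hs : ∃ s, (nb G Finset.univ s).card < d
  · obtain ⟨s, hs⟩ := hs
    apply KE_of_degenerate
    exact deg_slack hconn (fun _ => d) (fun v _ => (hdeg v).trans hdk) ⟨s, by simp, hs⟩
  · push Not at hs
    obtain ⟨x, -⟩ := hconn.1
    have hdk' : d = k := le_antisymm ((hs x).trans (hdeg x)) hdk
    subst hdk'
    exact regular_case hk (fun v => le_antisymm (hdeg v) (hs v)) hconn
      (fun h => hexc ⟨h.1, h.1, h.2⟩)

end part18


/-- for `d ≥ k ≥ 3` and `G` a connected graph with maximum degree `k`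
admitting a proper `k`-colouring, the proper `d`-colourings of `G` form a single
Kempe class, unless `d = k = 3` and `G` is the triangular prism. -/
theorem stmt14 {V : Type*} [Fintype V] [DecidableEq V] (d k : ℕ) (hk : 3 ≤ k)
    (hdk : k ≤ d) (G : SimpleGraph V) [DecidableRel G.Adj] (hconn : G.Connected)
    (hdeg : ∀ v : V, G.degree v ≤ k)
    (hcol : ∃ c : V → Fin k, IsProperColoring G k c)
    (hexc : ¬ (d = 3 ∧ k = 3 ∧ Nonempty (G ≃g TriangularPrism))) :
    KempeClass G d := by
  intro c c' hc hc'
  apply kempe_of_KE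
  refine main_KE hk hdk (conn_univ hconn) ?_ hexc c c' (fun u _ v _ huv => hc huv)
    (fun u _ v _ huv => hc' huv)
  intro v
  have h1 : nb G Finset.univ v = G.neighborFinset v := by
    ext w
    simp [mem_nb]
  rw [h1]
  exact hdeg v
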